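/- Let r be a positive integer and ε > 0 be real. Let q be a cube-free positive integer (no prime cube divides q), χ a primitive Dirichlet character mod q, and H a positive integer with q^{1/(2r)} ≤ H ≤ q. Let 0 ≤ N_1 < N_2 < ⋯ < N_J < q be integers satisfying N_{j+1} − N_j ≥ H for all 1 ≤ j < J. Then there is a constant C = C(ε, r) such that ∑_{j=1}^{J} max_{1 ≤ h ≤ H} |S(N_j; h)|^{2r} ≤ C · q^{1/2 + 1/(2r) + ε} H^{2r − 2}. -/

import Mathlib

section Stepanov

open Polynomial

variable {K : Type*} [Field K]

lemma pow_sub_dvd_hasseDeriv_mul_pow (g f : K[X]) (N l : ℕ) :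
    f ^ (N - l) ∣ hasseDeriv l (g * f ^ N) := by
  induction N generalizing l with
  | zero => simp
  | succ N ih =>
    rw [show g * f ^ (N + 1) = f * (g * f ^ N) by ring, hasseDeriv_mul]
    refine Finset.dvd_sum fun ij hij => ?_
    have hij' : ij.1 + ij.2 = l := by simpa using hij
    rcases Nat.eq_zero_or_pos ij.1 with h0 | h0
    · rw [h0, hasseDeriv_zero']
      have h2 : ij.2 = l := by omega
      rw [h2]
      rcases le_or_gt l N with h | h
      · rw [Nat.succ_sub h, pow_succ']
        exact mul_dvd_mul_left _ (ih l)
      · rw [show N + 1 - l = 0 by omega]; simp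
    · exact ((pow_dvd_pow f (by omega)).trans (ih ij.2)).mul_left _

lemma exists_hasseDeriv_mul_pow_eq {f : K[X]} (hf : f ≠ 0) (g : K[X]) (N l : ℕ) (hl : l ≤ N) :
    ∃ w : K[X], hasseDeriv l (g * f ^ N) = f ^ (N - l) * w ∧
      w.natDegree ≤ g.natDegree + l * f.natDegree := by
  obtain ⟨w, hw⟩ := pow_sub_dvd_hasseDeriv_mul_pow g f N l
  refine ⟨w, hw, ?_⟩
  rcases eq_or_ne w 0 with rfl | hw0
  · simp
  have h1 := natDegree_hasseDeriv_le (g * f ^ N) l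
  rw [hw, natDegree_mul (pow_ne_zero _ hf) hw0, natDegree_pow] at h1
  have h2 : (g * f ^ N).natDegree ≤ g.natDegree + N * f.natDegree :=
    natDegree_mul_le.trans (by rw [natDegree_pow])
  obtain ⟨t, rfl⟩ := Nat.exists_eq_add_of_le hl
  simp only [Nat.add_sub_cancel_left] at h1
  have : (l + t) * f.natDegree = l * f.natDegree + t * f.natDegree := by ring
  omega

lemma X_sub_C_pow_dvd_of_hasseDeriv_eval_eq_zero {g : K[X]} {α : K} {M : ℕ}
    (h : ∀ l < M, (hasseDeriv l g).eval α = 0) : (X - C α) ^ M ∣ g := by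
  rw [X_sub_C_pow_dvd_iff, X_pow_dvd_iff]
  intro d hd
  have := taylor_coeff α g d
  rw [taylor_apply] at this
  rw [this, h d hd]

/-- Distinct orders of vanishing at a simple zero of `f` force linear independence. -/
lemma eq_zero_of_sum_mul_pow_eq_zero {f u : K[X]} (hfu : f = X * u) (hu : u.eval 0 ≠ 0)
    {d e J : ℕ} (k : Fin d × Fin J → K[X]) (hk : ∀ x, k x = 0 ∨ (k x).natDegree < e)
    (h : ∑ x : Fin d × Fin J, k x * f ^ (e * x.1.1) * X ^ ((d * e + 1) * x.2.1) = 0) : k = 0 := by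
  classical
  by_contra hne
  set τ : Fin d × Fin J → ℕ := fun x => e * x.1.1 + (d * e + 1) * x.2.1 with hτ
  have hS : (Finset.univ.filter fun x => k x ≠ 0).Nonempty := by
    obtain ⟨x, hx⟩ := Function.ne_iff.1 hne
    exact ⟨x, by simpa using hx⟩
  obtain ⟨x0, hx0, hmin⟩ := Finset.exists_min_image _ τ hS
  simp only [Finset.mem_filter, Finset.mem_univ, true_and] at hx0 hmin
  have hgap : ∀ x, k x ≠ 0 → x ≠ x0 → τ x0 + e ≤ τ x := by
    intro x hx hxne
    have hle := hmin x hx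
    have key : ∀ i j i' j' : ℕ, i < d → i' < d → (i, j) ≠ (i', j') →
        e * i + (d * e + 1) * j ≤ e * i' + (d * e + 1) * j' →
        e * i + (d * e + 1) * j + e ≤ e * i' + (d * e + 1) * j' := by
      intro i j i' j' hi hi' hne' hle'
      rcases lt_trichotomy j j' with hj | hj | hj
      · obtain ⟨t, rfl⟩ := Nat.exists_eq_add_of_lt hj
        have : e * (i + 1) ≤ e * d := Nat.mul_le_mul_left _ hi
        nlinarith [Nat.zero_le (e * i'), Nat.zero_le ((d * e + 1) * t)]
      · subst hj
        have hii : i < i' := by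
          rcases lt_trichotomy i i' with hi1 | hi1 | hi1
          · exact hi1
          · exact absurd (by rw [hi1]) hne'
          · rcases Nat.eq_zero_or_pos e with he | he
            · have := hk x0
              subst he
              rcases this with h1 | h1
              · exact absurd h1 hx0
              · omega
            · have : e * (i' + 1) ≤ e * i := Nat.mul_le_mul_left _ hi1
              nlinarith
        have : e * (i + 1) ≤ e * i' := Nat.mul_le_mul_left _ hii
        nlinarith
      · obtain ⟨t, rfl⟩ := Nat.exists_eq_add_of_lt hj
        have : e * (i' + 1) ≤ e * d := Nat.mul_le_mul_left _ hi'
        nlinarith [Nat.zero_le (e * i), Nat.zero_le ((d * e + 1) * t)]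
    refine key _ _ _ _ x0.1.2 x.1.2 ?_ hle
    intro hh
    simp only [Prod.mk.injEq] at hh
    exact hxne (Prod.ext (Fin.ext hh.1.symm) (Fin.ext hh.2.symm))
  have hterm : ∀ x, k x * f ^ (e * x.1.1) * X ^ ((d * e + 1) * x.2.1) =
      X ^ τ x * (k x * u ^ (e * x.1.1)) := by
    intro x; rw [hfu, hτ, mul_pow, pow_add]; ring
  have hdvd : X ^ (τ x0 + e) ∣ X ^ τ x0 * (k x0 * u ^ (e * x0.1.1)) := by
    rw [← Finset.add_sum_erase _ _ (Finset.mem_univ x0), hterm] at h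
    rw [eq_neg_of_add_eq_zero_left h, dvd_neg]
    refine Finset.dvd_sum fun x hx => ?_
    rw [hterm]
    by_cases hkx : k x = 0
    · simp [hkx]
    · exact (pow_dvd_pow X (hgap x hkx (Finset.ne_of_mem_erase hx))).mul_right _
  rw [pow_add, mul_dvd_mul_iff_left (pow_ne_zero _ X_ne_zero)] at hdvd
  have hcop : IsCoprime (X ^ e : K[X]) (u ^ (e * x0.1.1)) := by
    refine IsCoprime.pow ?_
    rw [← sub_zero (X : K[X]), ← C_0]
    refine (Irreducible.coprime_iff_not_dvd (irreducible_X_sub_C 0)).2 ?_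
    rw [dvd_iff_isRoot]; exact hu
  have h3 := natDegree_le_of_dvd (hcop.dvd_of_dvd_mul_right hdvd) hx0
  rw [natDegree_X_pow] at h3
  rcases hk x0 with h4 | h4
  · exact hx0 h4
  · omega

lemma X_pow_card_mul_sub_dvd [Fintype K] (α : K) (j : ℕ) :
    (X - C α) ^ Fintype.card K ∣ (X ^ (Fintype.card K * j) - C (α ^ j) : K[X]) := by
  have h1 : (X - C α) ^ Fintype.card K = (X ^ Fintype.card K - C α : K[X]) := by
    obtain ⟨p, hp⟩ := CharP.exists K
    obtain ⟨n, hpp, hn⟩ := FiniteField.card K p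
    have : Fact p.Prime := ⟨hpp⟩
    conv_rhs => rw [← FiniteField.pow_card α]
    rw [hn, sub_pow_char_pow, C_pow]
  rw [h1, pow_mul, C_pow]
  exact sub_dvd_pow_sub_pow _ _ _

lemma exists_ne_zero_sum_hasseDeriv_eq_zero {f : K[X]} (hf : f ≠ 0) {m d e J M : ℕ}
    (hm : f.natDegree ≤ m) (ζ : K) (hcount : M * (e + M * m + J) < e * d * J) :
    ∃ c : (Fin d × Fin J) × Fin e → K, c ≠ 0 ∧ ∀ α : K, f.eval α ^ e = ζ → ∀ l < M,
      (hasseDeriv l (∑ x : (Fin d × Fin J) × Fin e,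
        C (c x * α ^ x.1.2.1) * (X ^ x.2.1 * f ^ (M + e * x.1.1.1)))).eval α = 0 := by
  classical
  have hw : ∀ (i : Fin d) (s : Fin e) (l : Fin M), ∃ w : K[X],
      hasseDeriv l.1 (X ^ s.1 * f ^ (M + e * i.1)) = f ^ (M + e * i.1 - l.1) * w ∧
      w.natDegree ≤ s.1 + l.1 * f.natDegree := by
    intro i s l
    obtain ⟨w, hw1, hw2⟩ := exists_hasseDeriv_mul_pow_eq hf (X ^ s.1) (M + e * i.1) l.1
      (by have := l.2; omega)
    exact ⟨w, hw1, by rwa [natDegree_X_pow] at hw2⟩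
  choose w hw1 hw2 using hw
  let E : (Fin M) → ((Fin d × Fin J) × Fin e → K) → K[X] := fun l c =>
    ∑ x, C (c x * ζ ^ x.1.1.1) * (w x.1.1 x.2 l * X ^ x.1.2.1)
  let Φ : ((Fin d × Fin J) × Fin e → K) →ₗ[K] (Fin M → Fin (e + M * m + J) → K) :=
    { toFun := fun c l t => (E l c).coeff t.1
      map_add' := by
        intro a b; ext l t
        simp [E, add_mul, Finset.sum_add_distrib]
      map_smul' := by
        intro a b; ext l t
        simp [E, Finset.mul_sum, coeff_C_mul, mul_assoc] }
  have hker : Φ.ker ≠ ⊥ := by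
    apply LinearMap.ker_ne_bot_of_finrank_lt
    simp only [Module.finrank_pi_fintype, Module.finrank_self, Finset.sum_const, Finset.card_univ,
      Fintype.card_prod, Fintype.card_fin, smul_eq_mul, mul_one]
    calc M * (e + M * m + J) < e * d * J := hcount
      _ = d * J * e := by ring
  obtain ⟨c, hc, hc0⟩ := Submodule.exists_mem_ne_zero_of_ne_bot hker
  refine ⟨c, hc0, fun α hα l hl => ?_⟩
  have hE : E ⟨l, hl⟩ c = 0 := by
    ext t
    rw [coeff_zero]
    by_cases ht : t < e + M * m + J
    · have := congrFun (congrFun (LinearMap.mem_ker.1 hc) ⟨l, hl⟩) ⟨t, ht⟩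
      exact this
    · refine coeff_eq_zero_of_natDegree_lt (lt_of_lt_of_le ?_ (not_lt.1 ht))
      rcases Nat.eq_zero_or_pos (e + M * m + J) with h0 | h0
      · exfalso
        have : J = 0 := by omega
        simp [this] at hcount
      · refine lt_of_le_of_lt (b := e + M * m + J - 1) ?_ (by omega)
        refine natDegree_sum_le_of_forall_le _ _ fun x _ => ?_
        refine (natDegree_C_mul_le _ _).trans (natDegree_mul_le.trans ?_)
        rw [natDegree_X_pow]
        have h1 := hw2 x.1.1 x.2 ⟨l, hl⟩
        have h2 : l * f.natDegree ≤ M * m := Nat.mul_le_mul hl.le hm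
        have h3 := x.2.2
        have h4 := x.1.2.2
        simp only at h1
        omega
  have hE' := congrArg (eval α) hE
  simp only [E, eval_finsetSum, eval_zero] at hE'
  simp only [map_sum, eval_finsetSum]
  rw [← mul_zero (f.eval α ^ (M - l)), ← hE', Finset.mul_sum]
  refine Finset.sum_congr rfl fun x _ => ?_
  rw [← smul_eq_C_mul, LinearMap.map_smul, hw1 x.1.1 x.2 ⟨l, hl⟩]
  simp only [eval_smul, eval_mul, eval_pow, eval_X, eval_C, smul_eq_mul]
  rw [show M + e * x.1.1.1 - l = (M - l) + e * x.1.1.1 by omega, pow_add, pow_mul, hα]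
  ring

lemma card_mul_le_of_stepanov [Fintype K] [DecidableEq K] {f u : K[X]} (hfu : f = X * u)
    (hu : u.eval 0 ≠ 0) {m d e J M : ℕ} (hK : Fintype.card K = d * e + 1)
    (hm : f.natDegree ≤ m) (ζ : K) (hM : M ≤ Fintype.card K)
    (hcount : M * (e + M * m + J) < e * d * J) :
    (Finset.univ.filter fun α : K => f.eval α ^ e = ζ).card * M ≤
      M * m + e + d * e * m + J * Fintype.card K := by
  have hf : f ≠ 0 := by
    rw [hfu]
    refine mul_ne_zero X_ne_zero ?_
    rintro rfl
    simp at hu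
  obtain ⟨c, hc0, hc⟩ := exists_ne_zero_sum_hasseDeriv_eq_zero hf hm ζ hcount
  set k : Fin d × Fin J → K[X] := fun x => ∑ s : Fin e, C (c (x, s)) * X ^ s.1 with hk
  set h : K[X] := f ^ M * ∑ x : Fin d × Fin J,
    k x * f ^ (e * x.1.1) * X ^ ((d * e + 1) * x.2.1) with hh
  have hkdeg : ∀ x, k x = 0 ∨ (k x).natDegree < e := by
    intro x
    rcases Nat.eq_zero_or_pos e with h0 | h0
    · subst h0; left; simp [hk]
    · right
      refine lt_of_le_of_lt (b := e - 1) ?_ (by omega)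
      refine natDegree_sum_le_of_forall_le _ _ fun s _ => ?_
      refine (natDegree_C_mul_X_pow_le _ _).trans ?_
      have := s.2; omega
  have hh0 : h ≠ 0 := by
    intro h0
    rcases mul_eq_zero.1 h0 with h1 | h1
    · exact pow_ne_zero _ hf h1
    · have hk0 := eq_zero_of_sum_mul_pow_eq_zero hfu hu k hkdeg h1
      apply hc0
      ext ⟨x, s⟩
      have h2 := congrArg (fun q : K[X] => q.coeff s.1) (congrFun hk0 x)
      simp only [hk, finsetSum_coeff, coeff_C_mul, coeff_X_pow, Pi.zero_apply, coeff_zero] at h2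
      rw [Finset.sum_eq_single s] at h2
      · simpa using h2
      · intro b _ hb
        rw [if_neg (fun h => hb (Fin.ext h.symm)), mul_zero]
      · simp
  have hsum : h = ∑ x : (Fin d × Fin J) × Fin e,
      C (c x) * (X ^ x.2.1 * f ^ (M + e * x.1.1.1)) * X ^ (Fintype.card K * x.1.2.1) := by
    rw [hh, Finset.mul_sum]
    symm
    rw [Fintype.sum_prod_type]
    refine Finset.sum_congr rfl fun x _ => ?_
    rw [hk, hK]
    simp only [Finset.sum_mul, Finset.mul_sum]
    refine Finset.sum_congr rfl fun s _ => ?_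
    ring
  have hdvd : ∀ α ∈ Finset.univ.filter (fun α : K => f.eval α ^ e = ζ), (X - C α) ^ M ∣ h := by
    intro α hα
    simp only [Finset.mem_filter, Finset.mem_univ, true_and] at hα
    have h1 := X_sub_C_pow_dvd_of_hasseDeriv_eval_eq_zero (hc α hα)
    rw [← dvd_sub_left h1, hsum, ← Finset.sum_sub_distrib]
    refine Finset.dvd_sum fun x _ => ?_
    have h2 := (pow_dvd_pow (X - C α) hM).trans (X_pow_card_mul_sub_dvd α x.1.2.1)
    rw [C_mul]
    have h3 : C (c x) * (X ^ x.2.1 * f ^ (M + e * x.1.1.1)) * X ^ (Fintype.card K * x.1.2.1) -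
        C (c x) * C (α ^ x.1.2.1) * (X ^ x.2.1 * f ^ (M + e * x.1.1.1)) =
        C (c x) * (X ^ x.2.1 * f ^ (M + e * x.1.1.1)) *
          (X ^ (Fintype.card K * x.1.2.1) - C (α ^ x.1.2.1)) := by ring
    rw [h3]
    exact h2.mul_left _
  have hprod := Finset.prod_dvd_of_coprime (s := fun α : K => (X - C α) ^ M)
    (t := Finset.univ.filter (fun α : K => f.eval α ^ e = ζ))
    (fun a _ b _ hab => (isCoprime_X_sub_C_of_isUnit_sub (sub_ne_zero.2 hab).isUnit).pow) hdvd
  have hle := natDegree_le_of_dvd hprod hh0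
  rw [natDegree_prod_of_monic _ _ (fun α _ => (monic_X_sub_C α).pow M)] at hle
  simp only [natDegree_pow, natDegree_X_sub_C, mul_one, Finset.sum_const, smul_eq_mul] at hle
  refine hle.trans ?_
  rw [hsum]
  refine natDegree_sum_le_of_forall_le _ _ fun x _ => ?_
  refine natDegree_mul_le.trans ?_
  have h1 : (C (c x) * (X ^ x.2.1 * f ^ (M + e * x.1.1.1))).natDegree ≤
      x.2.1 + (M + e * x.1.1.1) * m := by
    refine (natDegree_C_mul_le _ _).trans (natDegree_mul_le.trans ?_)
    rw [natDegree_X_pow, natDegree_pow]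
    gcongr
  rw [natDegree_X_pow]
  have h2 : Fintype.card K * x.1.2.1 ≤ J * Fintype.card K := by
    rw [mul_comm]; exact Nat.mul_le_mul_right _ x.1.2.2.le
  have h3 : (M + e * x.1.1.1) * m ≤ M * m + d * e * m := by
    rw [add_mul]
    have : e * x.1.1.1 ≤ d * e := by
      rw [mul_comm]; exact Nat.mul_le_mul_right _ x.1.1.2.le
    gcongr
  have h4 := x.2.2
  omega

/-- Stepanov's bound for the number of solutions of `f(α)^((#K-1)/d) = ζ`. -/
theorem exists_card_le_of_stepanov (d m : ℕ) (hd : 0 < d) :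
    ∃ c : ℝ, 0 ≤ c ∧ ∀ (K : Type) [Field K] [Fintype K] [DecidableEq K]
        (f u : K[X]) (e : ℕ) (ζ : K),
      Fintype.card K = d * e + 1 → f = X * u → u.eval 0 ≠ 0 → f.natDegree ≤ m →
      ((Finset.univ.filter fun α : K => f.eval α ^ e = ζ).card : ℝ) ≤
        (Fintype.card K : ℝ) / d + c * √(Fintype.card K) := by
  refine ⟨(2 * m + 3) * (2 * (m + 5)), by positivity, ?_⟩
  intro K _ _ _ f u e ζ hK hfu hu hm
  set κ := Fintype.card K with hκ
  set S := (Finset.univ.filter fun α : K => f.eval α ^ e = ζ).card with hS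
  have hκ1 : 1 < κ := Fintype.one_lt_card
  have hSκ : S ≤ κ := Finset.card_filter_le _ _
  have hsq1 : (1 : ℝ) ≤ √κ := by
    rw [Real.one_le_sqrt]; exact_mod_cast hκ1.le
  have hsq : √κ * √κ = (κ : ℝ) := Real.mul_self_sqrt (by positivity)
  set M := Nat.sqrt ((κ - 2) / (m + 3)) with hMdef
  have hM2 : M * M * (m + 3) ≤ κ - 2 :=
    (Nat.mul_le_mul_right _ (Nat.sqrt_le _)).trans (Nat.div_mul_le_self _ _)
  have hM3 : κ ≤ (M + 1) * (M + 1) * (m + 3) + 2 := by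
    have h1 : (κ - 2) / (m + 3) < (M + 1) * (M + 1) := Nat.lt_succ_sqrt _
    have h2 := (Nat.div_lt_iff_lt_mul (by omega : 0 < m + 3)).1 h1
    omega
  rcases Nat.eq_zero_or_pos M with hM0 | hM0
  · rw [hM0] at hM3
    have h1 : (κ : ℝ) ≤ m + 5 := by
      have : κ ≤ m + 5 := by omega
      exact_mod_cast this
    have h2 : (S : ℝ) ≤ κ := by exact_mod_cast hSκ
    have h3 : 0 ≤ (κ : ℝ) / d := by positivity
    have h4 : (m + 5 : ℝ) * 1 ≤ (2 * m + 3) * (2 * (m + 5)) * √κ := by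
      gcongr
      have : (0:ℝ) ≤ m := Nat.cast_nonneg m
      nlinarith
    linarith
  set J := M / d + 2 with hJ
  have hMκ : M ≤ κ := by nlinarith [Nat.sub_le κ 2]
  have hJd : M + d + 1 ≤ d * J := by
    have h1 := Nat.div_add_mod M d
    have h2 := Nat.mod_lt M hd
    rw [hJ, mul_add]
    omega
  have hJM : J ≤ M + 2 := by
    have := Nat.div_le_self M d; omega
  have hcount : M * (e + M * m + J) < e * d * J := by
    have h1 : e * (M + d + 1) ≤ e * (d * J) := Nat.mul_le_mul_left _ hJd
    have h2 : M * (M * m + J) ≤ M * M * (m + 3) := by nlinarith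
    have h3 : d * e = κ - 1 := by omega
    have h4 : M * M * (m + 3) < d * e := by omega
    nlinarith
  have key := card_mul_le_of_stepanov hfu hu hK hm ζ hMκ hcount
  rw [← hS, ← hκ] at key
  have key' : (S : ℝ) * M ≤ M * m + e + d * e * m + J * κ := by exact_mod_cast key
  have hM0' : (0 : ℝ) < M := by exact_mod_cast hM0
  have hJ' : (J : ℝ) ≤ M / d + 2 := by
    rw [hJ]; push_cast
    gcongr
    exact Nat.cast_div_le
  have hde : (d * e : ℝ) ≤ κ := by
    have : d * e ≤ κ := by omega
    exact_mod_cast this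
  have he : (e : ℝ) ≤ κ := by
    have : e ≤ κ := by nlinarith
    exact_mod_cast this
  have hMbig : √κ ≤ 2 * (m + 5) * M := by
    rw [Real.sqrt_le_left (by positivity)]
    have h1 : (κ : ℝ) ≤ (M + 1) * (M + 1) * (m + 3) + 2 := by exact_mod_cast hM3
    have h2 : (1 : ℝ) ≤ M := by exact_mod_cast hM0
    have h3 : (0 : ℝ) ≤ m := Nat.cast_nonneg m
    have h4 : (M + 1 : ℝ) * (M + 1) ≤ 4 * (M * M) := by nlinarith
    have h5 : (1 : ℝ) ≤ M * M := by nlinarith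
    calc (κ : ℝ) ≤ (M + 1) * (M + 1) * (m + 3) + 2 := h1
      _ ≤ 4 * (M * M) * (m + 3) + 2 * (M * M) :=
        add_le_add (mul_le_mul_of_nonneg_right h4 (by positivity)) (by linarith)
      _ = (M * M) * (4 * (m + 3) + 2) := by ring
      _ ≤ (M * M) * (2 * (m + 5)) ^ 2 := by
        refine mul_le_mul_of_nonneg_left ?_ (by positivity)
        nlinarith
      _ = (2 * (m + 5) * M) ^ 2 := by ring
  have h6 : (S : ℝ) * M ≤ (κ / d) * M + (2 * m + 3) * κ := by
    have h7 : (J : ℝ) * κ ≤ (M / d + 2) * κ := by gcongr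
    have h7' : (M * m : ℝ) ≤ κ * m := by gcongr
    have h8 : (d * e * m : ℝ) ≤ κ * m := by gcongr
    have h9 : (M / d + 2 : ℝ) * κ = κ / d * M + 2 * κ := by ring
    linarith
  have h10 : (κ : ℝ) ≤ 2 * (m + 5) * √κ * M := by
    calc (κ : ℝ) = √κ * √κ := hsq.symm
      _ ≤ √κ * (2 * (m + 5) * M) := by gcongr
      _ = _ := by ring
  have h16 : (S : ℝ) * M ≤ (κ / d + (2 * m + 3) * (2 * (m + 5)) * √κ) * M := by
    have h12 : (2 * m + 3 : ℝ) * κ ≤ (2 * m + 3) * (2 * (m + 5) * √κ * M) := by gcongr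
    calc (S : ℝ) * M ≤ (κ / d) * M + (2 * m + 3) * κ := h6
      _ ≤ (κ / d) * M + (2 * m + 3) * (2 * (m + 5) * √κ * M) := by linarith
      _ = _ := by ring
  exact le_of_mul_le_mul_right h16 hM0'

end Stepanov

section MinpolyCount

open Polynomial IntermediateField Module

variable {F L : Type*} [Field F] [Field L] [Algebra F L]

/-- The characteristic polynomial of `α`, as a power of its minimal polynomial. -/
noncomputable def minpolyPow (F : Type*) {L : Type*} [Field F] [Field L] [Algebra F L] (α : L) :
    F[X] :=
  minpoly F α ^ (finrank F L / (minpoly F α).natDegree)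

lemma natDegree_minpoly_dvd_finrank [FiniteDimensional F L] (α : L) :
    (minpoly F α).natDegree ∣ finrank F L := by
  rw [← adjoin.finrank (IsIntegral.of_finite F α)]
  exact ⟨_, (finrank_mul_finrank F F⟮α⟯ L).symm⟩

lemma natDegree_minpolyPow [FiniteDimensional F L] (α : L) :
    (minpolyPow F α).natDegree = finrank F L := by
  rw [minpolyPow, natDegree_pow]
  exact Nat.div_mul_cancel (natDegree_minpoly_dvd_finrank α)

lemma monic_minpolyPow [FiniteDimensional F L] (α : L) : (minpolyPow F α).Monic :=
  (minpoly.monic (IsIntegral.of_finite F α)).pow _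

lemma norm_eq_neg_one_pow_mul_coeff [FiniteDimensional F L] (α : L) :
    Algebra.norm F α = (-1) ^ finrank F L *
      (minpoly F α).coeff 0 ^ (finrank F L / (minpoly F α).natDegree) := by
  have hα := IsIntegral.of_finite F α
  rw [Algebra.norm_eq_norm_adjoin]
  have h1 := Algebra.PowerBasis.norm_gen_eq_coeff_zero_minpoly (adjoin.powerBasis hα)
  rw [adjoin.powerBasis_gen, adjoin.powerBasis_dim, minpoly_gen] at h1
  have h2 : finrank F⟮α⟯ L = finrank F L / (minpoly F α).natDegree := by
    rw [← finrank_mul_finrank F F⟮α⟯ L, adjoin.finrank hα, Nat.mul_div_cancel_left]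
    exact minpoly.natDegree_pos hα
  rw [h1, mul_pow, ← pow_mul, h2, Nat.mul_div_cancel' (natDegree_minpoly_dvd_finrank α)]

lemma eval_minpolyPow [FiniteDimensional F L] (α : L) (a : F) :
    (minpolyPow F α).eval a = Algebra.norm F (algebraMap F L a - α) := by
  have hα := IsIntegral.of_finite F α
  have h1 : minpoly F (α - algebraMap F L a) = (minpoly F α).comp (X + C a) :=
    minpoly.sub_algebraMap α a
  have h2 := norm_eq_neg_one_pow_mul_coeff (F := F) (α - algebraMap F L a)
  rw [h1, natDegree_comp, natDegree_X_add_C, mul_one, coeff_zero_eq_eval_zero, eval_comp] at h2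
  simp only [eval_add, eval_X, eval_C, zero_add] at h2
  have h3 : algebraMap F L a - α = algebraMap F L (-1) * (α - algebraMap F L a) := by
    simp
  rw [h3, map_mul, h2, Algebra.norm_algebraMap, minpolyPow, eval_pow, ← mul_assoc, ← mul_pow]
  simp

lemma card_minpoly_eq [Finite F] [Fintype L] {P : F[X]} (hP : Irreducible P)
    (hm : P.Monic) (hd : P.natDegree ∣ finrank F L) [DecidableEq F[X]] :
    (Finset.univ.filter fun α : L => minpoly F α = P).card = P.natDegree := by
  classical
  have : Fact (Irreducible P) := ⟨hP⟩
  have hint : FiniteDimensional F (AdjoinRoot P) := (AdjoinRoot.powerBasis hP.ne_zero).finite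
  have hfin : finrank F (AdjoinRoot P) = P.natDegree := by
    rw [(AdjoinRoot.powerBasis hP.ne_zero).finrank, AdjoinRoot.powerBasis_dim]
  obtain ⟨φ⟩ := FiniteField.nonempty_algHom_of_finrank_dvd (F := F) (K := AdjoinRoot P) (L := L)
    (by rwa [hfin])
  have hroot : aeval (φ (AdjoinRoot.root P)) P = 0 := by
    rw [aeval_algHom_apply, AdjoinRoot.aeval_eq, AdjoinRoot.mk_self, map_zero]
  have hmin : ∀ α : L, aeval α P = 0 → minpoly F α = P := fun α hα =>
    (minpoly.eq_of_irreducible_of_monic hP hα hm).symm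
  have hsplit : (P.map (algebraMap F L)).Splits := by
    rw [← hmin _ hroot]
    exact Normal.splits inferInstance _
  have hsep : P.Separable := PerfectField.separable_of_irreducible hP
  rw [← card_rootSet_eq_natDegree hsep hsplit, Fintype.card_subtype]
  congr 1
  ext α
  simp only [Finset.mem_filter, Finset.mem_univ, true_and, mem_rootSet]
  constructor
  · rintro rfl
    exact ⟨hP.ne_zero, minpoly.aeval _ _⟩
  · exact fun h => hmin α h.2

end MinpolyCount

section MonicCount

open Polynomial Module UniqueFactorizationMonoid

variable {F : Type*} [Field F]

lemma pow_dvd_iff_le_count_normalizedFactors [DecidableEq F] {P g : F[X]} (hP : Irreducible P)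
    (hm : P.Monic) (hg : g ≠ 0) (m : ℕ) : P ^ m ∣ g ↔ m ≤ (normalizedFactors g).count P := by
  rw [pow_dvd_iff_le_emultiplicity, emultiplicity_eq_count_normalizedFactors hP hg,
    hm.normalize_eq_self]
  exact Nat.cast_le

lemma sum_count_mul_natDegree [DecidableEq F] {g : F[X]} (hg : g ≠ 0) :
    ∑ P ∈ (normalizedFactors g).toFinset, (normalizedFactors g).count P * P.natDegree =
      g.natDegree := by
  have h1 : (normalizedFactors g).prod.natDegree = g.natDegree :=
    natDegree_eq_of_degree_eq (degree_eq_degree_of_associated (prod_normalizedFactors hg))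
  rw [← h1, natDegree_multiset_prod _ (zero_notMem_normalizedFactors g),
    Finset.sum_multiset_map_count]
  simp

lemma sum_card_minpolyPow_dvd (p : ℕ) [Fact p.Prime] [∀ k, Fintype (GaloisField p k)]
    {g : (ZMod p)[X]} (hg : g ≠ 0) [∀ k, DecidablePred fun α : GaloisField p k =>
      minpolyPow (ZMod p) α ∣ g] :
    ∑ k ∈ Finset.Icc 1 g.natDegree,
      (Finset.univ.filter fun α : GaloisField p k => minpolyPow (ZMod p) α ∣ g).card =
      g.natDegree := by
  classical
  set n := g.natDegree with hn
  have hfac : ∀ P ∈ (normalizedFactors g).toFinset, Irreducible P ∧ P.Monic := by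
    intro P hP
    have hP' := Multiset.mem_toFinset.1 hP
    have h1 := irreducible_of_normalized_factor P hP'
    refine ⟨h1, ?_⟩
    rw [← normalize_normalized_factor P hP']
    exact monic_normalize h1.ne_zero
  have hk : ∀ k ∈ Finset.Icc 1 n,
      (Finset.univ.filter fun α : GaloisField p k => minpolyPow (ZMod p) α ∣ g).card =
      ∑ P ∈ (normalizedFactors g).toFinset,
        if P.natDegree ∣ k ∧ P ^ (k / P.natDegree) ∣ g then P.natDegree else 0 := by
    intro k hk
    have hk0 : k ≠ 0 := by simp at hk; omega
    have hfr := GaloisField.finrank p hk0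
    rw [Finset.card_eq_sum_card_fiberwise (f := fun α : GaloisField p k => minpoly (ZMod p) α)
      (t := (normalizedFactors g).toFinset)]
    · refine Finset.sum_congr rfl fun P hP => ?_
      obtain ⟨hP1, hP2⟩ := hfac P hP
      rw [Finset.filter_filter]
      split_ifs with h
      · rw [← card_minpoly_eq (L := GaloisField p k) hP1 hP2 (by rw [hfr]; exact h.1)]
        congr 1
        ext α
        simp only [Finset.mem_filter, Finset.mem_univ, true_and]
        constructor
        · exact fun h => h.2
        · rintro rfl
          refine ⟨?_, rfl⟩
          rw [minpolyPow, hfr]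
          exact h.2
      · rw [Finset.card_eq_zero, Finset.filter_eq_empty_iff]
        rintro α - ⟨h1, rfl⟩
        apply h
        rw [minpolyPow, hfr] at h1
        refine ⟨?_, h1⟩
        have := natDegree_minpoly_dvd_finrank (F := ZMod p) α
        rwa [hfr] at this
    · intro α hα
      simp only [Finset.coe_filter, Finset.mem_univ, true_and, Set.mem_ofPred_eq] at hα
      have hint := IsIntegral.of_finite (ZMod p) α
      simp only [Finset.mem_coe, Multiset.mem_toFinset]
      have h2 : minpoly (ZMod p) α ∣ g := by
        refine (dvd_pow_self _ ?_).trans hα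
        have := natDegree_minpoly_dvd_finrank (F := ZMod p) α
        have h3 := Nat.div_pos (Nat.le_of_dvd (by rw [hfr]; omega) this)
          (minpoly.natDegree_pos hint)
        omega
      rw [mem_normalizedFactors_iff' hg]
      exact ⟨minpoly.irreducible hint, (minpoly.monic hint).normalize_eq_self, h2⟩
  rw [Finset.sum_congr rfl hk, Finset.sum_comm, hn, ← sum_count_mul_natDegree hg]
  refine Finset.sum_congr rfl fun P hP => ?_
  obtain ⟨hP1, hP2⟩ := hfac P hP
  have hpos : 0 < P.natDegree := hP1.natDegree_pos
  rw [← Finset.sum_filter, Finset.sum_const, smul_eq_mul]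
  congr 1
  trans ((Finset.Icc 1 ((normalizedFactors g).count P)).image fun m => P.natDegree * m).card
  · congr 1
    ext k
    simp only [Finset.mem_filter, Finset.mem_Icc, Finset.mem_image]
    constructor
    · rintro ⟨⟨h1, h2⟩, ⟨m, rfl⟩, h4⟩
      rw [Nat.mul_div_cancel_left _ hpos,
        pow_dvd_iff_le_count_normalizedFactors hP1 hP2 hg] at h4
      refine ⟨m, ⟨?_, h4⟩, rfl⟩
      by_contra hm
      have : m = 0 := by omega
      simp [this] at h1
    · rintro ⟨m, ⟨h1, h2⟩, rfl⟩
      have h3 := (pow_dvd_iff_le_count_normalizedFactors hP1 hP2 hg m).2 h2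
      refine ⟨⟨Nat.mul_pos hpos h1, ?_⟩, dvd_mul_right _ _, ?_⟩
      · have := natDegree_le_of_dvd h3 hg
        rw [natDegree_pow] at this
        rw [mul_comm]
        exact this.trans (sum_count_mul_natDegree hg).ge
      · rwa [Nat.mul_div_cancel_left _ hpos]
  · rw [Finset.card_image_of_injective _ (fun a b h => Nat.eq_of_mul_eq_mul_left hpos h)]
    simp

end MonicCount

section CharLFunction

open Polynomial Module

lemma finite_monic_natDegree_eq (F : Type*) [Field F] [Finite F] (n : ℕ) :
    {g : F[X] | g.Monic ∧ g.natDegree = n}.Finite := by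
  have h1 : Finite (degreeLT F n) := Finite.of_equiv _ (degreeLTEquiv F n).symm.toEquiv
  exact Finite.of_equiv _ (monicEquivDegreeLT (R := F) n).symm

/-- The monic polynomials of degree `n` over a finite field. -/
noncomputable def monicFinset (F : Type*) [Field F] [Finite F] (n : ℕ) : Finset F[X] :=
  (finite_monic_natDegree_eq F n).toFinset

section

variable {F : Type*} [Field F]

/-- The value of a character at `∏ g(a)^{e a}`. -/
noncomputable def charEval (χ : MulChar F ℂ) (A : Finset F) (e : F → ℕ) (g : F[X]) : ℂ :=
  χ (∏ a ∈ A, g.eval a ^ e a)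

lemma charEval_mul (χ : MulChar F ℂ) (A : Finset F) (e : F → ℕ) (g h : F[X]) :
    charEval χ A e (g * h) = charEval χ A e g * charEval χ A e h := by
  simp only [charEval, eval_mul, mul_pow, Finset.prod_mul_distrib, map_mul]

variable [Finite F]

lemma mem_monicFinset {n : ℕ} {g : F[X]} : g ∈ monicFinset F n ↔ g.Monic ∧ g.natDegree = n := by
  simp [monicFinset]

/-- The coefficients of the `L`-function attached to `charEval`. -/
noncomputable def charCoeff (χ : MulChar F ℂ) (A : Finset F) (e : F → ℕ) (n : ℕ) : ℂ :=
  ∑ g ∈ monicFinset F n, charEval χ A e g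

lemma charCoeff_zero (χ : MulChar F ℂ) (A : Finset F) (e : F → ℕ) : charCoeff χ A e 0 = 1 := by
  have : monicFinset F 0 = {1} := by
    ext g
    simp only [mem_monicFinset, Finset.mem_singleton]
    constructor
    · rintro ⟨h1, h2⟩
      exact h1.natDegree_eq_zero.1 h2
    · rintro rfl
      simp
  rw [charCoeff, this]
  simp [charEval]

lemma charCoeff_one [Fintype F] (χ : MulChar F ℂ) (A : Finset F) (e : F → ℕ) :
    charCoeff χ A e 1 = ∑ x, χ (∏ a ∈ A, (x + a) ^ e a) := by
  symm
  refine Finset.sum_bij (fun x _ => X + C x) ?_ ?_ ?_ ?_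
  · intro x _
    rw [mem_monicFinset]
    exact ⟨monic_X_add_C x, natDegree_X_add_C x⟩
  · intro x _ y _ h
    exact C_injective (add_left_cancel h)
  · intro g hg
    rw [mem_monicFinset] at hg
    refine ⟨g.coeff 0, Finset.mem_univ _, ?_⟩
    have h1 := hg.1.leadingCoeff
    rw [leadingCoeff, hg.2] at h1
    rw [eq_X_add_C_of_natDegree_le_one hg.2.le, h1]
    simp
  · intro x _
    simp [charEval, add_comm]

lemma charCoeff_eq_zero [Fintype F] {χ : MulChar F ℂ} (hχ : χ ≠ 1) {A : Finset F} {e : F → ℕ}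
    {a₀ : F} (ha : a₀ ∈ A) (he : e a₀ = 1) {n : ℕ} (hn : A.card ≤ n) :
    charCoeff χ A e n = 0 := by
  classical
  set l : F[X] := Lagrange.basis A id a₀ with hl
  have hinj : Set.InjOn (id : F → F) A := Function.injective_id.injOn
  have hl1 : l.eval a₀ = 1 := Lagrange.eval_basis_self hinj ha
  have hl0 : ∀ a ∈ A, a ≠ a₀ → l.eval a = 0 := fun a hA hne =>
    Lagrange.eval_basis_of_ne (v := id) hne.symm hA
  have hldeg : l.degree < n := by
    rw [hl, Lagrange.degree_basis hinj ha]
    have : 0 < A.card := Finset.card_pos.2 ⟨_, ha⟩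
    exact_mod_cast (by omega : A.card - 1 < n)
  have hshift : ∀ t : F, ∑ g ∈ monicFinset F n, charEval χ A e (g + C t * l) =
      charCoeff χ A e n := by
    intro t
    have hC : ∀ s : F, (C s * l).degree < n := fun s =>
      (by rw [← smul_eq_C_mul]; exact (degree_smul_le _ _).trans_lt hldeg)
    have hmem : ∀ s : F, ∀ g ∈ monicFinset F n, g + C s * l ∈ monicFinset F n := by
      intro s g hg
      rw [mem_monicFinset] at hg ⊢
      have h1 : (C s * l).degree < g.degree := by
        rw [degree_eq_natDegree hg.1.ne_zero, hg.2]; exact hC s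
      exact ⟨hg.1.add_of_left h1, by rw [natDegree_add_eq_left_of_degree_lt h1, hg.2]⟩
    refine Finset.sum_bij' (fun g _ => g + C t * l) (fun g _ => g + C (-t) * l)
      (hmem t) (hmem (-t)) ?_ ?_ ?_
    · intro g _; simp
    · intro g _; simp
    · intro g _; rfl
  have hinner : ∀ g : F[X], ∑ t : F, charEval χ A e (g + C t * l) = 0 := by
    intro g
    have h1 : ∀ t : F, charEval χ A e (g + C t * l) =
        χ (g.eval a₀ + t) * χ (∏ a ∈ A.erase a₀, g.eval a ^ e a) := by
      intro t
      rw [charEval, ← Finset.mul_prod_erase _ _ ha, map_mul, he, pow_one]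
      congr 2
      · simp [hl1]
      · refine Finset.prod_congr rfl fun a hA => ?_
        rw [Finset.mem_erase] at hA
        simp [hl0 a hA.2 hA.1]
    simp_rw [h1, ← Finset.sum_mul]
    have h2 : ∑ t : F, χ (g.eval a₀ + t) = ∑ t : F, χ t :=
      Equiv.sum_comp (Equiv.addLeft (g.eval a₀)) (fun t => χ t)
    rw [h2, MulChar.sum_eq_zero_of_ne_one hχ, zero_mul]
  have h3 : (Fintype.card F : ℂ) * charCoeff χ A e n = 0 := by
    calc (Fintype.card F : ℂ) * charCoeff χ A e n = ∑ t : F, charCoeff χ A e n := by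
          simp
      _ = ∑ t : F, ∑ g ∈ monicFinset F n, charEval χ A e (g + C t * l) := by
          simp_rw [hshift]
      _ = 0 := by rw [Finset.sum_comm]; simp_rw [hinner]; simp
  exact (mul_eq_zero.1 h3).resolve_left (by exact_mod_cast Fintype.card_ne_zero)

end

/-- Character sums over the extensions of `ZMod p`. -/
noncomputable def charPowerSum {p : ℕ} [Fact p.Prime] (χ : MulChar (ZMod p) ℂ)
    (A : Finset (ZMod p)) (e : ZMod p → ℕ) (k : ℕ) [Fintype (GaloisField p k)] : ℂ :=
  ∑ α : GaloisField p k, charEval χ A e (minpolyPow (ZMod p) α)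

lemma mul_charCoeff_eq {p : ℕ} [Fact p.Prime] (χ : MulChar (ZMod p) ℂ)
    (A : Finset (ZMod p)) (e : ZMod p → ℕ) [∀ k, Fintype (GaloisField p k)] (n : ℕ) :
    n * charCoeff χ A e n =
      ∑ k ∈ Finset.Icc 1 n, charPowerSum χ A e k * charCoeff χ A e (n - k) := by
  classical
  have h1 : ∀ k ∈ Finset.Icc 1 n, charPowerSum χ A e k * charCoeff χ A e (n - k) =
      ∑ g ∈ monicFinset (ZMod p) n, ∑ α : GaloisField p k,
        if minpolyPow (ZMod p) α ∣ g then charEval χ A e g else 0 := by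
    intro k hk
    simp only [Finset.mem_Icc] at hk
    have hfr := GaloisField.finrank p (n := k) (by omega)
    rw [charPowerSum, Finset.sum_mul, Finset.sum_comm]
    refine Finset.sum_congr rfl fun α _ => ?_
    rw [charCoeff, Finset.mul_sum, ← Finset.sum_filter]
    have hm := monic_minpolyPow (F := ZMod p) α
    have hd := natDegree_minpolyPow (F := ZMod p) α
    rw [hfr] at hd
    refine Finset.sum_bij (fun h _ => minpolyPow (ZMod p) α * h) ?_ ?_ ?_ ?_
    · intro h hh
      rw [mem_monicFinset] at hh
      rw [Finset.mem_filter, mem_monicFinset]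
      refine ⟨⟨hm.mul hh.1, ?_⟩, dvd_mul_right _ _⟩
      rw [hm.natDegree_mul hh.1, hd, hh.2]; omega
    · intro a _ b _ hab
      exact mul_left_cancel₀ hm.ne_zero hab
    · intro g hg
      rw [Finset.mem_filter, mem_monicFinset] at hg
      obtain ⟨⟨hg1, hg2⟩, h, rfl⟩ := hg
      have hh := hm.of_mul_monic_left hg1
      refine ⟨h, ?_, rfl⟩
      rw [mem_monicFinset]
      rw [hm.natDegree_mul hh, hd] at hg2
      exact ⟨hh, by omega⟩
    · intro h _
      rw [charEval_mul]
  rw [Finset.sum_congr rfl h1, Finset.sum_comm, charCoeff, Finset.mul_sum]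
  refine Finset.sum_congr rfl fun g hg => ?_
  rw [mem_monicFinset] at hg
  have h2 := sum_card_minpolyPow_dvd p hg.1.ne_zero
  rw [hg.2] at h2
  simp_rw [← Finset.sum_filter, Finset.sum_const, nsmul_eq_mul, ← Finset.sum_mul]
  congr 1
  exact_mod_cast h2.symm

end CharLFunction

section CharPowerSum

open Polynomial Module

lemma exists_norm_charPowerSum_le {p : ℕ} [Fact p.Prime] {χ : MulChar (ZMod p) ℂ} (hχ : χ ≠ 1)
    {A : Finset (ZMod p)} {e : ZMod p → ℕ} {a₀ : ZMod p} (ha : a₀ ∈ A) (he : e a₀ = 1)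
    [∀ k, Fintype (GaloisField p k)] :
    ∃ C : ℝ, 0 ≤ C ∧ ∀ k, k ≠ 0 → ‖charPowerSum χ A e k‖ ≤ C * √p ^ k := by
  classical
  have hp : p.Prime := Fact.out
  set m := ∑ a ∈ A, e a with hm
  obtain ⟨c, hc0, hc⟩ := exists_card_le_of_stepanov (p - 1) m (by have := hp.two_le; omega)
  refine ⟨(p - 1 : ℕ) * c + m, by positivity, fun k hk => ?_⟩
  set L := GaloisField p k with hL
  have hcard : Fintype.card L = p ^ k := by
    rw [Fintype.card_eq_nat_card]; exact GaloisField.card p k hk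
  set E := (p ^ k - 1) / (p - 1) with hE
  have hEc : Fintype.card L = (p - 1) * E + 1 := by
    rw [hcard, hE, Nat.mul_div_cancel']
    · have := Nat.pow_pos (n := k) hp.pos; omega
    · exact Nat.sub_one_dvd_pow_sub_one p k
  set u : L[X] := ∏ a ∈ A.erase a₀, (X + C (algebraMap (ZMod p) L (a - a₀))) ^ e a with hu
  set f : L[X] := X * u with hf
  have hfA : f = ∏ a ∈ A, (X + C (algebraMap (ZMod p) L (a - a₀))) ^ e a := by
    rw [← Finset.mul_prod_erase _ _ ha, he]
    simp [hf, hu]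
  have hu0 : u.eval 0 ≠ 0 := by
    rw [hu, eval_prod, Finset.prod_ne_zero_iff]
    intro a hA
    rw [Finset.mem_erase] at hA
    simp only [eval_pow, eval_add, eval_X, eval_C, zero_add]
    refine pow_ne_zero _ ?_
    rw [Ne, map_eq_zero_iff _ (algebraMap (ZMod p) L).injective, sub_eq_zero]
    exact hA.1
  have hfm : f.natDegree ≤ m := by
    rw [hfA]
    refine (natDegree_prod_le _ _).trans (Finset.sum_le_sum fun a _ => ?_)
    refine natDegree_pow_le.trans ?_
    rw [natDegree_X_add_C, mul_one]
  set w : L → ZMod p := fun β => Algebra.norm (ZMod p) (f.eval β) with hw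
  have hsum : charPowerSum χ A e k = ∑ β : L, χ (w β) := by
    rw [charPowerSum, ← Equiv.sum_comp (Equiv.subLeft (algebraMap (ZMod p) L a₀))]
    refine Finset.sum_congr rfl fun β _ => ?_
    rw [charEval, hw, hfA]
    simp only [eval_minpolyPow, Equiv.subLeft_apply, eval_prod, map_prod, eval_pow, map_pow]
    refine Finset.prod_congr rfl fun a _ => ?_
    congr 3
    simp only [eval_add, eval_X, eval_C]
    rw [map_sub (algebraMap (ZMod p) L)]
    ring
  set n : ZMod p → ℕ := fun z => (Finset.univ.filter fun β => w β = z).card with hn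
  have hfib : charPowerSum χ A e k = ∑ z, χ z * n z := by
    rw [hsum, ← Finset.sum_fiberwise (s := Finset.univ) (g := w)]
    refine Finset.sum_congr rfl fun z _ => ?_
    rw [Finset.sum_congr rfl (g := fun _ => χ z)
      (fun β hβ => by rw [(Finset.mem_filter.1 hβ).2])]
    simp [hn, mul_comm]
  have htot : ∑ z, n z = p ^ k := by
    rw [← hcard, ← Finset.card_univ]
    exact (Finset.card_eq_sum_card_fiberwise (fun _ _ => Finset.mem_univ _)).symm
  have hnz : ∀ z, (n z : ℝ) ≤ (p ^ k : ℝ) / (p - 1 : ℕ) + c * √(p ^ k) := by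
    intro z
    have h1 := hc L f u E (algebraMap (ZMod p) L z) hEc hf hu0 hfm
    rw [hcard] at h1
    push_cast at h1 ⊢
    refine le_trans (le_of_eq ?_) h1
    refine congrArg (fun s : Finset L => (s.card : ℝ)) ?_
    ext β
    simp only [Finset.mem_filter, Finset.mem_univ, true_and, hw]
    rw [← (algebraMap (ZMod p) L).injective.eq_iff, FiniteField.algebraMap_norm_eq_pow]
    rw [Nat.card_zmod, ← Fintype.card_eq_nat_card (α := L), hcard]
  have hn0 : (n 0 : ℝ) ≤ m := by
    have hf0 : f ≠ 0 := by
      refine mul_ne_zero X_ne_zero ?_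
      intro h; rw [h] at hu0; simp at hu0
    have h1 : n 0 ≤ f.roots.toFinset.card := by
      refine Finset.card_le_card fun β hβ => ?_
      simp only [Finset.mem_filter, Finset.mem_univ, true_and, hw,
        Algebra.norm_eq_zero_iff] at hβ
      rw [Multiset.mem_toFinset, mem_roots hf0]
      exact hβ
    exact_mod_cast h1.trans ((Multiset.toFinset_card_le _).trans ((card_roots' f).trans hfm))
  set T := (p ^ k : ℝ) / (p - 1 : ℕ) + c * √(p ^ k) with hT
  have hp1 : (0 : ℝ) < (p - 1 : ℕ) := by
    have := hp.two_le
    exact_mod_cast (by omega : 0 < p - 1)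
  have hχ1 : ∀ z, ‖χ z‖ ≤ 1 := DirichletCharacter.norm_le_one χ
  have h1 : charPowerSum χ A e k = ∑ z ∈ Finset.univ.erase 0, χ z * (n z - T) := by
    have h2 : ∑ z, χ z * (n z - T : ℂ) = charPowerSum χ A e k := by
      simp_rw [mul_sub, Finset.sum_sub_distrib, ← Finset.sum_mul,
        MulChar.sum_eq_zero_of_ne_one hχ, hfib]
      simp
    rw [← h2, ← Finset.add_sum_erase _ _ (Finset.mem_univ (0 : ZMod p)), MulChar.map_zero]
    simp
  have h3 : ‖charPowerSum χ A e k‖ ≤ ∑ z ∈ Finset.univ.erase (0 : ZMod p), (T - n z) := by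
    rw [h1]
    refine (norm_sum_le _ _).trans (Finset.sum_le_sum fun z _ => ?_)
    rw [norm_mul]
    have h4 : ‖((n z : ℂ) - T)‖ = T - n z := by
      rw [← Complex.ofReal_natCast, ← Complex.ofReal_sub, Complex.norm_real, Real.norm_eq_abs,
        abs_of_nonpos (by linarith [hnz z])]
      ring
    rw [h4]
    exact mul_le_of_le_one_left (by linarith [hnz z]) (hχ1 z)
  have h5 : ∑ z ∈ Finset.univ.erase (0 : ZMod p), (T - n z) =
      (p - 1 : ℕ) * T - p ^ k + n 0 := by
    rw [Finset.sum_sub_distrib, Finset.sum_const, Finset.card_erase_of_mem (Finset.mem_univ _),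
      Finset.card_univ, ZMod.card, nsmul_eq_mul]
    have h6 : (n 0 : ℝ) + ∑ z ∈ Finset.univ.erase (0 : ZMod p), (n z : ℝ) = p ^ k := by
      rw [Finset.add_sum_erase _ (fun z => (n z : ℝ)) (Finset.mem_univ (0 : ZMod p))]
      exact_mod_cast htot
    linarith
  have hs : √p ^ k = √((p : ℝ) ^ k) := by
    rw [Real.sqrt_eq_rpow, Real.sqrt_eq_rpow, ← Real.rpow_natCast, ← Real.rpow_natCast,
      ← Real.rpow_mul (by positivity), ← Real.rpow_mul (by positivity), mul_comm]
  have h1s : 1 ≤ √((p : ℝ) ^ k) := by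
    rw [Real.one_le_sqrt]
    exact one_le_pow₀ (by exact_mod_cast hp.one_le)
  rw [hs]
  refine h3.trans ?_
  rw [h5, hT, mul_add, mul_div_cancel₀ _ hp1.ne']
  nlinarith [Nat.cast_nonneg (α := ℝ) m]

end CharPowerSum

section RootBound

open Polynomial

/-- The generating function identity `t L'(t) = L(t) N(t)`. -/
lemma eval_mul_tsum_eq {c N : ℕ → ℂ} {C s : ℝ} {L : ℂ[X]} (hL : ∀ n, L.coeff n = c n)
    (hN0 : N 0 = 0) (hrec : ∀ n : ℕ, n * c n = ∑ k ∈ Finset.Icc 1 n, N k * c (n - k))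
    (hs : 0 < s) (hN : ∀ k, ‖N k‖ ≤ C * s ^ k) {t : ℂ} (ht : s * ‖t‖ < 1) :
    t * (derivative L).eval t = L.eval t * ∑' k, N k * t ^ k ∧
      ‖∑' k, N k * t ^ k‖ ≤ C * (1 - s * ‖t‖)⁻¹ := by
  have hbound : ∀ k, ‖N k * t ^ k‖ ≤ C * (s * ‖t‖) ^ k := fun k => by
    rw [norm_mul, norm_pow, mul_pow, ← mul_assoc]
    exact mul_le_mul_of_nonneg_right (hN k) (by positivity)
  have hgeo := (hasSum_geometric_of_lt_one (by positivity) ht).mul_left C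
  have hsumN : Summable fun k => ‖N k * t ^ k‖ :=
    Summable.of_nonneg_of_le (fun _ => norm_nonneg _) hbound hgeo.summable
  refine ⟨?_, ?_⟩
  · have hc0 : ∀ n, n ∉ Finset.range (L.natDegree + 1) → c n * t ^ n = 0 := fun n hn => by
      rw [← hL, coeff_eq_zero_of_natDegree_lt (by simpa using hn), zero_mul]
    have hLt : L.eval t = ∑' n, c n * t ^ n := by
      rw [tsum_eq_sum hc0, eval_eq_sum_range]
      simp_rw [hL]
    have hLsum : Summable fun n => ‖c n * t ^ n‖ :=
      summable_of_ne_finset_zero (s := Finset.range (L.natDegree + 1))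
        (fun n hn => by rw [hc0 n hn, norm_zero])
    have hD : t * (derivative L).eval t = ∑' n : ℕ, n * c n * t ^ n := by
      rw [tsum_eq_sum (s := Finset.range (L.natDegree + 1))
        (fun n hn => by rw [mul_assoc, hc0 n hn, mul_zero])]
      rw [derivative_eval, sum_over_range _ (fun n => by simp), Finset.mul_sum]
      refine Finset.sum_congr rfl fun n _ => ?_
      rcases n with - | n
      · simp
      · rw [hL]; simp [pow_succ]; ring
    rw [hD, hLt, mul_comm,
      tsum_mul_tsum_eq_tsum_sum_antidiagonal_of_summable_norm hsumN hLsum]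
    refine tsum_congr fun n => ?_
    rw [hrec, Finset.Nat.sum_antidiagonal_eq_sum_range_succ_mk, Finset.sum_mul,
      Finset.sum_range_succ' , hN0]
    simp only [zero_mul, add_zero]
    rw [← Finset.sum_image (s := Finset.range n) (g := fun k => k + 1)
      (f := fun k => N k * t ^ k * (c (n - k) * t ^ (n - k))) (by simp)]
    refine (Finset.sum_congr ?_ fun k hk => ?_)
    · ext k
      simp only [Finset.mem_Icc, Finset.mem_image, Finset.mem_range]
      constructor
      · rintro ⟨h1, h2⟩
        exact ⟨k - 1, by omega, by omega⟩
      · rintro ⟨a, h1, rfl⟩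
        omega
    · simp only [Finset.mem_image, Finset.mem_range] at hk
      obtain ⟨a, ha, rfl⟩ := hk
      have : t ^ n = t ^ (a + 1) * t ^ (n - (a + 1)) := by
        rw [← pow_add]; congr 1; omega
      rw [this]; ring
  · exact (tsum_of_norm_bounded hgeo hbound)

lemma one_le_mul_norm_of_isRoot {c N : ℕ → ℂ} {C s : ℝ} {L : ℂ[X]} (hL : ∀ n, L.coeff n = c n)
    (hc0 : c 0 = 1)
    (hN0 : N 0 = 0) (hrec : ∀ n : ℕ, n * c n = ∑ k ∈ Finset.Icc 1 n, N k * c (n - k))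
    (hs : 0 < s) (hC : 0 ≤ C) (hN : ∀ k, ‖N k‖ ≤ C * s ^ k) {t₀ : ℂ} (ht₀ : L.IsRoot t₀) :
    1 ≤ s * ‖t₀‖ := by
  by_contra! hlt
  have hL0 : L ≠ 0 := by
    rintro rfl
    have := hL 0
    rw [hc0] at this
    simp at this
  have ht0 : t₀ ≠ 0 := by
    rintro rfl
    rw [IsRoot.def, ← coeff_zero_eq_eval_zero, hL, hc0] at ht₀
    exact one_ne_zero ht₀
  obtain ⟨U, hU, hUdvd⟩ := exists_eq_pow_rootMultiplicity_mul_and_not_dvd L hL0 t₀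
  set m := L.rootMultiplicity t₀ with hm
  have hm0 : 0 < m := (rootMultiplicity_pos hL0).2 ht₀
  have hUt : U.eval t₀ ≠ 0 := fun h => hUdvd (dvd_iff_isRoot.2 h)
  obtain ⟨j, hj⟩ : ∃ j, m = j + 1 := ⟨m - 1, by omega⟩
  set B := C * (1 - s * ‖t₀‖)⁻¹ with hB
  have hineq : ∀ x : ℝ, 0 < x → x < 1 →
      ‖(m : ℂ) * (t₀ * x) * U.eval (t₀ * x)‖ ≤ ‖t₀ * x - t₀‖ *
        (‖U.eval (t₀ * x)‖ * B + ‖t₀ * x‖ * ‖(derivative U).eval (t₀ * x)‖) := by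
    intro x hx0 hx1
    set t : ℂ := t₀ * x with ht
    have hnt : ‖t‖ ≤ ‖t₀‖ := by
      rw [ht, norm_mul, Complex.norm_real, Real.norm_of_nonneg hx0.le]
      exact mul_le_of_le_one_right (norm_nonneg _) hx1.le
    have htlt : s * ‖t‖ < 1 := (mul_le_mul_of_nonneg_left hnt hs.le).trans_lt hlt
    have hne : t - t₀ ≠ 0 := by
      rw [ht, show t₀ * x - t₀ = t₀ * (x - 1) by ring]
      refine mul_ne_zero ht0 ?_
      rw [← Complex.ofReal_one, ← Complex.ofReal_sub]
      exact_mod_cast (by linarith : x - 1 ≠ 0)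
    obtain ⟨h1, h2⟩ := eval_mul_tsum_eq hL hN0 hrec hs hN htlt
    have h3 : ‖∑' k, N k * t ^ k‖ ≤ B := by
      refine h2.trans ?_
      rw [hB]
      have : 0 < 1 - s * ‖t₀‖ := by linarith
      gcongr
    set n := ∑' k, N k * t ^ k
    rw [hU, hj] at h1
    simp only [derivative_mul, derivative_X_sub_C_pow, eval_mul, eval_add, eval_pow, eval_sub,
      eval_X, eval_C, eval_natCast, map_natCast, Nat.add_sub_cancel] at h1
    have h4 : (m : ℂ) * t * U.eval t =
        (t - t₀) * (U.eval t * n - t * (derivative U).eval t) := by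
      rw [hj]
      apply mul_left_cancel₀ (pow_ne_zero j hne)
      have h5 := h1
      rw [pow_succ] at h5
      linear_combination h5
    rw [h4, norm_mul]
    gcongr
    refine (norm_sub_le _ _).trans ?_
    rw [norm_mul, norm_mul]
    gcongr
  have hlim1 : Filter.Tendsto (fun x : ℝ => ‖(m : ℂ) * (t₀ * x) * U.eval (t₀ * x)‖)
      (nhdsWithin 1 (Set.Ioo 0 1)) (nhds ‖(m : ℂ) * (t₀ * (1 : ℝ)) * U.eval (t₀ * (1 : ℝ))‖) := by
    apply ContinuousAt.continuousWithinAt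
    fun_prop
  have hlim2 : Filter.Tendsto (fun x : ℝ => ‖t₀ * x - t₀‖ *
        (‖U.eval (t₀ * x)‖ * B + ‖t₀ * x‖ * ‖(derivative U).eval (t₀ * x)‖))
      (nhdsWithin 1 (Set.Ioo 0 1)) (nhds (‖t₀ * (1 : ℝ) - t₀‖ *
        (‖U.eval (t₀ * (1 : ℝ))‖ * B +
          ‖t₀ * (1 : ℝ)‖ * ‖(derivative U).eval (t₀ * (1 : ℝ))‖))) := by
    apply ContinuousAt.continuousWithinAt
    fun_prop
  have hnb : (nhdsWithin (1 : ℝ) (Set.Ioo 0 1)).NeBot := by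
    rw [nhdsWithin_Ioo_eq_nhdsLT zero_lt_one]; infer_instance
  have hfin := le_of_tendsto_of_tendsto hlim1 hlim2 (by
    filter_upwards [self_mem_nhdsWithin] with x hx
    exact hineq x hx.1 hx.2)
  simp only [Complex.ofReal_one, mul_one, sub_self, norm_zero, zero_mul] at hfin
  have := norm_le_zero_iff.1 hfin
  simp [ht0, hUt, hm0.ne'] at this

lemma norm_coeff_one_le {c N : ℕ → ℂ} {C s : ℝ} {D : ℕ} (hcD : ∀ n, D < n → c n = 0)
    (hc0 : c 0 = 1) (hN0 : N 0 = 0)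
    (hrec : ∀ n : ℕ, n * c n = ∑ k ∈ Finset.Icc 1 n, N k * c (n - k))
    (hs : 0 < s) (hC : 0 ≤ C) (hN : ∀ k, ‖N k‖ ≤ C * s ^ k) : ‖c 1‖ ≤ D * s := by
  rcases Nat.eq_zero_or_pos D with hD | hD
  · rw [hcD 1 (by omega)]
    simp [hD]
  set L : ℂ[X] := ∑ n ∈ Finset.range (D + 1), Polynomial.C (c n) * X ^ n with hLdef
  have hL : ∀ n, L.coeff n = c n := by
    intro n
    simp only [hLdef, finsetSum_coeff, coeff_C_mul, coeff_X_pow, mul_ite, mul_one, mul_zero,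
      Finset.sum_ite_eq, Finset.mem_range]
    split_ifs with h
    · rfl
    · rw [hcD n (by omega)]
  set R := reflect D L with hR
  have hRc : ∀ n, n ≤ D → R.coeff n = c (D - n) := by
    intro n hn
    rw [hR, coeff_reflect, revAt_le hn, hL]
  have hRdeg : R.natDegree ≤ D := by
    rw [natDegree_le_iff_coeff_eq_zero]
    intro n hn
    rw [hR, coeff_reflect, revAt_eq_self_of_lt hn, hL, hcD n hn]
  have hRD : R.coeff D = 1 := by rw [hRc D le_rfl, Nat.sub_self, hc0]
  have hRdeg' : R.natDegree = D :=
    le_antisymm hRdeg (le_natDegree_of_ne_zero (by rw [hRD]; exact one_ne_zero))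
  have hRm : R.Monic := by rw [Monic, leadingCoeff, hRdeg', hRD]
  have hroot : ∀ ω ∈ R.roots, ‖ω‖ ≤ s := by
    intro ω hω
    rw [mem_roots hRm.ne_zero] at hω
    rcases eq_or_ne ω 0 with rfl | h0
    · simpa using hs.le
    let hinv := invertibleOfNonzero h0
    have h1 := (eval₂_reflect_eq_zero_iff (RingHom.id ℂ) ω D R hRdeg).2 hω
    rw [hR, reflect_reflect, invOf_eq_inv] at h1
    have h2 := one_le_mul_norm_of_isRoot hL hc0 hN0 hrec hs hC hN h1
    rw [norm_inv, ← div_eq_mul_inv, one_le_div (norm_pos_iff.2 h0)] at h2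
    exact h2
  have hsplit := IsAlgClosed.splits R
  have h1 : R.nextCoeff = c 1 := by
    rw [nextCoeff, if_neg (by omega), hRdeg', hRc _ (by omega)]
    congr 1; omega
  have h3 : R.roots.card = D := by rw [← hRdeg']; exact hsplit.natDegree_eq_card_roots.symm
  rw [← h1, hsplit.nextCoeff_eq_neg_sum_roots_of_monic hRm, norm_neg]
  refine (norm_multiset_sum_le _).trans ?_
  refine (Multiset.sum_le_card_nsmul _ s ?_).trans_eq ?_
  · intro x hx
    obtain ⟨ω, hω, rfl⟩ := Multiset.mem_map.1 hx
    exact hroot ω hω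
  · rw [Multiset.card_map, h3, nsmul_eq_mul]

/-- The Weil bound for complete character sums of products of linear factors. -/
theorem norm_sum_mulChar_prod_le {p : ℕ} [Fact p.Prime] {χ : MulChar (ZMod p) ℂ} (hχ : χ ≠ 1)
    {A : Finset (ZMod p)} {e : ZMod p → ℕ} {a₀ : ZMod p} (ha : a₀ ∈ A) (he : e a₀ = 1) :
    ‖∑ x, χ (∏ a ∈ A, (x + a) ^ e a)‖ ≤ (A.card - 1 : ℕ) * √p := by
  classical
  have hfin : ∀ k, Fintype (GaloisField p k) := fun k => Fintype.ofFinite _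
  have hp : p.Prime := Fact.out
  obtain ⟨C, hC, h⟩ := exists_norm_charPowerSum_le hχ ha he
  rw [← charCoeff_one]
  refine norm_coeff_one_le (c := charCoeff χ A e)
    (N := fun k => if k = 0 then 0 else charPowerSum χ A e k) (C := C) ?_
    (charCoeff_zero χ A e) (by simp) ?_ (Real.sqrt_pos.2 (by exact_mod_cast hp.pos)) hC ?_
  · intro n hn
    exact charCoeff_eq_zero hχ ha he (by omega)
  · intro n
    rw [mul_charCoeff_eq]
    refine Finset.sum_congr rfl fun k hk => ?_
    rw [if_neg]
    have := (Finset.mem_Icc.1 hk).1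
    omega
  · intro k
    split_ifs with hk
    · rw [norm_zero]; positivity
    · exact h k hk

end RootBound

section ShiftSum

/-- Complex conjugation, applied or not according to a Boolean. -/
noncomputable def condConj : Bool → ℂ →+* ℂ
  | true => RingHom.id ℂ
  | false => starRingEnd ℂ

lemma norm_condConj (s : Bool) (z : ℂ) : ‖condConj s z‖ = ‖z‖ := by
  cases s <;> simp [condConj]

lemma conj_condConj (s : Bool) (z : ℂ) : starRingEnd ℂ (condConj s z) = condConj (!s) z := by
  cases s <;> simp [condConj]

variable {ι : Type*} [Fintype ι]

/-- The complete sum of a product of shifts of `χ` and its conjugate. -/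
noncomputable def shiftSum {q : ℕ} [NeZero q] (χ : DirichletCharacter ℂ q) (s : ι → Bool)
    (b : ι → ℤ) : ℂ :=
  ∑ x : ZMod q, ∏ i, condConj (s i) (χ (x + b i))

lemma norm_shiftSum_not {q : ℕ} [NeZero q] (χ : DirichletCharacter ℂ q) (s : ι → Bool)
    (b : ι → ℤ) : ‖shiftSum χ (fun i => !s i) b‖ = ‖shiftSum χ s b‖ := by
  rw [← RCLike.norm_conj (shiftSum χ s b)]
  simp only [shiftSum, map_sum, map_prod, conj_condConj]

lemma norm_shiftSum_le {q : ℕ} [NeZero q] (χ : DirichletCharacter ℂ q) (s : ι → Bool)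
    (b : ι → ℤ) : ‖shiftSum χ s b‖ ≤ q := by
  refine (norm_sum_le _ _).trans ((Finset.sum_le_card_nsmul _ _ 1 fun x _ => ?_).trans_eq ?_)
  · rw [norm_prod]
    refine Finset.prod_le_one (fun _ _ => norm_nonneg _) fun i _ => ?_
    rw [norm_condConj]
    exact χ.norm_le_one _
  · simp [ZMod.card]

lemma conj_apply_eq_pow {p : ℕ} [Fact p.Prime] (hp2 : 2 < p) (χ : DirichletCharacter ℂ p)
    (y : ZMod p) : starRingEnd ℂ (χ y) = χ (y ^ (p - 2)) := by
  rcases eq_or_ne y 0 with rfl | hy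
  · rw [zero_pow (by omega), MulChar.map_zero, map_zero]
  · have h1 : χ y * χ (y ^ (p - 2)) = 1 := by
      rw [← map_mul, ← pow_succ', show p - 2 + 1 = p - 1 by omega, ZMod.pow_card_sub_one_eq_one hy,
        map_one]
    have h2 : ‖χ y‖ = 1 := χ.unit_norm_eq_one (Units.mk0 y hy)
    have h3 : χ y ≠ 0 := left_ne_zero_of_mul_eq_one h1
    have h4 : χ y * starRingEnd ℂ (χ y) = 1 := by
      rw [Complex.mul_conj, Complex.normSq_eq_norm_sq, h2]; simp
    exact mul_left_cancel₀ h3 (h4.trans h1.symm)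

lemma norm_shiftSum_prime_le {p : ℕ} [Fact p.Prime] {χ : DirichletCharacter ℂ p} (hχ : χ ≠ 1)
    (s : ι → Bool) (b : ι → ℤ) (i₀ : ι) (hb : ∀ j, j ≠ i₀ → (b j : ZMod p) ≠ b i₀) :
    ‖shiftSum χ s b‖ ≤ Fintype.card ι * √p := by
  classical
  wlog hs : s i₀ = true generalizing s with h
  · rw [← norm_shiftSum_not]
    exact h _ (by simpa using hs)
  have hp : p.Prime := Fact.out
  have hp2 : 2 < p := by
    refine lt_of_le_of_ne hp.two_le ?_
    rintro rfl
    apply hχ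
    ext u
    rw [Subsingleton.elim u 1]
    simp
  set d : ι → ℕ := fun i => if s i then 1 else p - 2 with hd
  set e : ZMod p → ℕ := fun a => ∑ i with (b i : ZMod p) = a, d i with he
  set A : Finset (ZMod p) := Finset.univ.image fun i => (b i : ZMod p) with hA
  have h1 : shiftSum χ s b = ∑ x, χ (∏ a ∈ A, (x + a) ^ e a) := by
    refine Finset.sum_congr rfl fun x _ => ?_
    have h2 : ∀ i, condConj (s i) (χ (x + b i)) = χ ((x + b i) ^ d i) := by
      intro i
      by_cases h : s i = true
      · simp [condConj, hd, h]
      · simp only [Bool.not_eq_true] at h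
        simp only [condConj, hd, h, conj_apply_eq_pow hp2]
        simp
    simp_rw [h2]
    rw [← map_prod]
    congr 1
    rw [← Finset.prod_fiberwise_of_maps_to (s := Finset.univ) (t := A)
      (g := fun i => (b i : ZMod p)) (fun i _ => Finset.mem_image_of_mem _ (Finset.mem_univ i))]
    refine Finset.prod_congr rfl fun a _ => ?_
    rw [he, ← Finset.prod_pow_eq_pow_sum]
    refine Finset.prod_congr rfl fun i hi => ?_
    rw [(Finset.mem_filter.1 hi).2]
  rw [h1]
  have he1 : e (b i₀) = 1 := by
    have : (Finset.univ.filter fun i => (b i : ZMod p) = b i₀) = {i₀} := by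
      ext j
      simp only [Finset.mem_filter, Finset.mem_univ, true_and, Finset.mem_singleton]
      exact ⟨fun h => by_contra fun hj => hb j hj h, fun h => by rw [h]⟩
    rw [he]
    simp [this, hd, hs]
  refine (norm_sum_mulChar_prod_le hχ (Finset.mem_image_of_mem _ (Finset.mem_univ i₀)) he1).trans ?_
  gcongr
  exact (Nat.sub_le _ _).trans Finset.card_image_le

end ShiftSum

section PrimeSquare

open Polynomial

variable {ι : Type*} [Fintype ι]

lemma conj_eq_of_mul_eq_one {z w : ℂ} (hz : ‖z‖ ≤ 1) (hw : ‖w‖ ≤ 1) (h : z * w = 1) :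
    starRingEnd ℂ z = w := by
  have h1 : ‖z‖ * ‖w‖ = 1 := by rw [← norm_mul, h, norm_one]
  have h2 : ‖z‖ = 1 := le_antisymm hz (by nlinarith [norm_nonneg z, norm_nonneg w])
  have h4 : z * starRingEnd ℂ z = 1 := by
    rw [Complex.mul_conj, Complex.normSq_eq_norm_sq, h2]; simp
  exact mul_left_cancel₀ (left_ne_zero_of_mul_eq_one h) (h4.trans h.symm)

lemma p_mul_p_eq_zero {p : ℕ} : (p : ZMod (p ^ 2)) * p = 0 := by
  rw [← Nat.cast_mul, ← sq, ZMod.natCast_self]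

lemma one_add_p_mul_pow {p : ℕ} (w : ZMod (p ^ 2)) (t : ℕ) :
    (1 + (p : ZMod (p ^ 2)) * w) ^ t = 1 + (p : ZMod (p ^ 2)) * ((t : ZMod (p ^ 2)) * w) := by
  induction t with
  | zero => simp
  | succ t ih =>
    rw [pow_succ (1 + (p : ZMod (p ^ 2)) * w), ih]
    push_cast
    linear_combination (t * w * w) * p_mul_p_eq_zero (p := p)

lemma prod_one_add_p_mul {p : ℕ} (w : ι → ZMod (p ^ 2)) :
    ∏ i, (1 + (p : ZMod (p ^ 2)) * w i) = 1 + (p : ZMod (p ^ 2)) * ∑ i, w i := by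
  classical
  induction (Finset.univ : Finset ι) using Finset.induction_on with
  | empty => simp
  | insert i S hi ih =>
    rw [Finset.prod_insert hi, ih, Finset.sum_insert hi]
    linear_combination (w i * ∑ i ∈ S, w i) * p_mul_p_eq_zero (p := p)

variable {p : ℕ} [Fact p.Prime]

/-- The numerator of `∑ ± 1 / (X + b i)`. -/
noncomputable def shiftNumerator (F : Type*) [Field F] [DecidableEq ι] (s : ι → Bool) (b : ι → ℤ) :
    F[X] :=
  ∑ i, C (if s i then 1 else -1) * ∏ j ∈ Finset.univ.erase i, (X + C (b j : F))

lemma card_roots_shiftNumerator_lt (F : Type*) [Field F] [DecidableEq F] [Fintype F]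
    [DecidableEq ι] (s : ι → Bool) (b : ι → ℤ) (i₀ : ι) (hb : ∀ j, j ≠ i₀ → (b j : F) ≠ b i₀) :
    (Finset.univ.filter fun x : F => (shiftNumerator F s b).eval x = 0).card ≤
      Fintype.card ι := by
  have h0 : shiftNumerator F s b ≠ 0 := by
    intro h
    have h1 := congrArg (eval (-(b i₀ : F))) h
    rw [shiftNumerator, eval_finsetSum, Finset.sum_eq_single i₀] at h1
    · simp only [eval_mul, eval_C, eval_prod, eval_add, eval_X, eval_zero, mul_eq_zero] at h1
      rcases h1 with h1 | h1
      · split_ifs at h1 <;> simp at h1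
      · rw [Finset.prod_eq_zero_iff] at h1
        obtain ⟨j, hj, h2⟩ := h1
        refine hb j (Finset.ne_of_mem_erase hj) ?_
        linear_combination h2
    · intro i _ hi
      rw [eval_mul, eval_prod, Finset.prod_eq_zero (i := i₀), mul_zero]
      · simp [hi.symm]
      · simp
    · simp
  have hdeg : (shiftNumerator F s b).natDegree ≤ Fintype.card ι := by
    refine natDegree_sum_le_of_forall_le _ _ fun i _ => ?_
    refine (natDegree_C_mul_le _ _).trans ((natDegree_prod_le _ _).trans ?_)
    simp only [natDegree_X_add_C, Finset.sum_const, smul_eq_mul, mul_one]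
    exact Finset.card_le_univ _
  calc _ ≤ (shiftNumerator F s b).roots.toFinset.card := by
        refine Finset.card_le_card fun x hx => ?_
        rw [Multiset.mem_toFinset, mem_roots h0]
        exact (Finset.mem_filter.1 hx).2
    _ ≤ _ := (Multiset.toFinset_card_le _).trans ((card_roots' _).trans hdeg)

/-- Reduction from `ZMod (p ^ 2)` to `ZMod p`. -/
def redSq (p : ℕ) : ZMod (p ^ 2) →+* ZMod p := ZMod.castHom (dvd_pow_self p two_ne_zero) _

lemma redSq_eq_zero_iff (x : ZMod (p ^ 2)) : redSq p x = 0 ↔ ∃ y, x = (p : ZMod (p ^ 2)) * y := by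
  have hp : p.Prime := Fact.out
  have : NeZero (p ^ 2) := ⟨pow_ne_zero _ hp.ne_zero⟩
  constructor
  · intro h
    obtain ⟨n, rfl⟩ := ZMod.natCast_zmod_surjective x
    rw [map_natCast, ZMod.natCast_eq_zero_iff] at h
    obtain ⟨m, rfl⟩ := h
    exact ⟨m, by push_cast; ring⟩
  · rintro ⟨y, rfl⟩
    rw [map_mul, map_natCast]; simp

lemma isUnit_iff_redSq_ne_zero (x : ZMod (p ^ 2)) : IsUnit x ↔ redSq p x ≠ 0 := by
  have hp : p.Prime := Fact.out
  have : NeZero (p ^ 2) := ⟨pow_ne_zero _ hp.ne_zero⟩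
  constructor
  · intro h
    exact (h.map (redSq p)).ne_zero
  · intro h
    obtain ⟨n, rfl⟩ := ZMod.natCast_zmod_surjective x
    rw [map_natCast, Ne, ZMod.natCast_eq_zero_iff] at h
    rw [ZMod.isUnit_iff_coprime]
    exact ((Nat.Prime.coprime_iff_not_dvd hp).2 h).symm.pow_right 2

lemma redSq_fiber_card [NeZero (p ^ 2)] (a : ZMod p) :
    (Finset.univ.filter fun x : ZMod (p ^ 2) => redSq p x = a).card ≤ p := by
  have hp : p.Prime := Fact.out
  obtain ⟨x₀, rfl⟩ := ZMod.castHom_surjective (dvd_pow_self p two_ne_zero) a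
  calc _ ≤ ((Finset.range p).image fun t : ℕ =>
      x₀ + (p : ZMod (p ^ 2)) * (t : ZMod (p ^ 2))).card := by
        refine Finset.card_le_card fun x hx => ?_
        have h1 : redSq p (x - x₀) = 0 := by
          rw [map_sub, sub_eq_zero]; exact (Finset.mem_filter.1 hx).2
        obtain ⟨y, hy⟩ := (redSq_eq_zero_iff _).1 h1
        obtain ⟨n, rfl⟩ := ZMod.natCast_zmod_surjective y
        refine Finset.mem_image.2 ⟨n % p, Finset.mem_range.2 (Nat.mod_lt _ hp.pos), ?_⟩
        have h2 : (n : ZMod (p ^ 2)) = p * (n / p : ℕ) + (n % p : ℕ) := by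
          exact_mod_cast congrArg (Nat.cast (R := ZMod (p ^ 2))) (Nat.div_add_mod n p).symm
        rw [h2, mul_add, ← mul_assoc, p_mul_p_eq_zero, zero_mul, zero_add] at hy
        rw [← hy]; ring
    _ ≤ _ := Finset.card_image_le.trans (by simp)

lemma norm_shiftSum_prime_sq_le [NeZero (p ^ 2)] {χ : DirichletCharacter ℂ (p ^ 2)}
    (hχ : ∃ w, χ (1 + (p : ZMod (p ^ 2)) * w) ≠ 1)
    (s : ι → Bool) (b : ι → ℤ) (i₀ : ι) (hb : ∀ j, j ≠ i₀ → (b j : ZMod p) ≠ b i₀) :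
    ‖shiftSum χ s b‖ ≤ Fintype.card ι * p := by
  classical
  have hp : p.Prime := Fact.out
  have hp0 : (0 : ℝ) < p := by exact_mod_cast hp.pos
  set g : ZMod (p ^ 2) → ℂ := fun x => ∏ i, condConj (s i) (χ (x + (b i : ZMod (p ^ 2)))) with hg
  set Z := Finset.univ.filter fun x : ZMod (p ^ 2) =>
    (shiftNumerator (ZMod p) s b).eval (redSq p x) = 0 with hZ
  have hχW : ∀ W : ZMod (p ^ 2), redSq p W ≠ 0 → χ (1 + (p : ZMod (p ^ 2)) * W) ≠ 1 := by
    intro W hW h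
    obtain ⟨w, hw⟩ := hχ
    apply hw
    obtain ⟨v, rfl⟩ := (isUnit_iff_redSq_ne_zero W).2 hW
    obtain ⟨t, ht⟩ := ZMod.natCast_zmod_surjective (w * (v⁻¹).1)
    have h1 : w = t * v := by rw [ht, mul_assoc, Units.inv_mul, mul_one]
    rw [h1, ← one_add_p_mul_pow, map_pow, h, one_pow]
  have hinner : ∀ x, x ∉ Z →
      ∑ t ∈ Finset.range p, g (x + (p : ZMod (p ^ 2)) * (t : ZMod (p ^ 2))) = 0 := by
    intro x hx
    by_cases hu : ∀ i, IsUnit (x + (b i : ZMod (p ^ 2)))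
    · choose y hy using hu
      set w : ι → ZMod (p ^ 2) := fun i => (if s i then (1 : ZMod (p ^ 2)) else -1) * ((y i)⁻¹).1
        with hw
      set W := ∑ i, w i with hW
      have hgt : ∀ t : ℕ, g (x + (p : ZMod (p ^ 2)) * (t : ZMod (p ^ 2))) =
          g x * χ (1 + (p : ZMod (p ^ 2)) * W) ^ t := by
        intro t
        rw [← map_pow, one_add_p_mul_pow, hW, Finset.mul_sum, ← prod_one_add_p_mul, map_prod, hg,
          ← Finset.prod_mul_distrib]
        refine Finset.prod_congr rfl fun i _ => ?_
        have h1 : x + (p : ZMod (p ^ 2)) * (t : ZMod (p ^ 2)) + (b i : ZMod (p ^ 2)) =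
            (y i).1 * (1 + (p : ZMod (p ^ 2)) * (t * ((y i)⁻¹).1)) := by
          linear_combination (-(p * t : ZMod (p ^ 2))) * (y i).mul_inv - hy i
        rw [h1, map_mul, map_mul, hy]
        congr 1
        cases hsi : s i
        · refine conj_eq_of_mul_eq_one (χ.norm_le_one _) (χ.norm_le_one _) ?_
          rw [← map_mul, ← map_one χ]
          congr 1
          simp only [hw, hsi]
          simp only [Bool.false_eq_true, if_false]
          linear_combination (-(t * ((y i)⁻¹).1) ^ 2 : ZMod (p ^ 2)) * p_mul_p_eq_zero (p := p)
        · simp [condConj, hw, hsi]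
      simp_rw [hgt, ← Finset.mul_sum]
      have hne : χ (1 + (p : ZMod (p ^ 2)) * W) ≠ 1 := by
        apply hχW
        intro h0
        apply hx
        rw [hZ, Finset.mem_filter]
        refine ⟨Finset.mem_univ _, ?_⟩
        rw [← mul_zero (∏ j, redSq p (y j)), ← h0, hW, map_sum, Finset.mul_sum, shiftNumerator,
          eval_finsetSum]
        refine Finset.sum_congr rfl fun i _ => ?_
        have h1 : redSq p (y i) * redSq p ((y i)⁻¹).1 = 1 := by
          rw [← map_mul, Units.mul_inv, map_one]
        have h2 : redSq p (if s i then (1 : ZMod (p ^ 2)) else -1) =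
            if s i then 1 else -1 := by split_ifs <;> simp
        rw [← Finset.mul_prod_erase _ _ (Finset.mem_univ i)]
        simp only [hw, map_mul, h2, eval_mul, eval_C, eval_prod, eval_add, eval_X, hy,
          map_add, map_intCast, eval_intCast]
        rw [hy, map_add, map_intCast] at h1
        linear_combination (-(if s i then 1 else -1) *
          ∏ j ∈ Finset.univ.erase i, (redSq p x + (b j : ZMod p))) * h1
      have h1 : χ (1 + (p : ZMod (p ^ 2)) * W) ^ p = 1 := by
        rw [← map_pow, one_add_p_mul_pow, ← mul_assoc, p_mul_p_eq_zero]
        simp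
      rw [geom_sum_eq hne, h1, sub_self, zero_div, mul_zero]
    · push Not at hu
      obtain ⟨i, hi⟩ := hu
      refine Finset.sum_eq_zero fun t _ => ?_
      refine Finset.prod_eq_zero (Finset.mem_univ i) ?_
      rw [MulChar.map_nonunit, map_zero]
      rw [isUnit_iff_redSq_ne_zero] at hi ⊢
      simpa using hi
  have hZcard : (Z.card : ℝ) ≤ Fintype.card ι * p := by
    have h1 : Z.card ≤ p * (Finset.univ.filter fun x : ZMod p =>
        (shiftNumerator (ZMod p) s b).eval x = 0).card := by
      refine Finset.card_le_mul_card_image_of_maps_to (f := redSq p) ?_ p ?_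
      · intro x hx
        simpa [hZ] using hx
      · intro a _
        exact (Finset.card_le_card (Finset.filter_subset_filter _ (Finset.subset_univ _))).trans
          (redSq_fiber_card a)
    have h2 := h1.trans (Nat.mul_le_mul_left p (card_roots_shiftNumerator_lt (ZMod p) s b i₀ hb))
    rw [mul_comm] at h2
    exact_mod_cast h2
  have hg1 : ∀ x, ‖g x‖ ≤ 1 := by
    intro x
    rw [hg, norm_prod]
    refine Finset.prod_le_one (fun _ _ => norm_nonneg _) fun i _ => ?_
    rw [norm_condConj]
    exact χ.norm_le_one _
  have hsum : (p : ℂ) * shiftSum χ s b =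
      ∑ x ∈ Z, ∑ t ∈ Finset.range p, g (x + (p : ZMod (p ^ 2)) * (t : ZMod (p ^ 2))) := by
    have h1 : ∀ t : ℕ, ∑ x, g (x + (p : ZMod (p ^ 2)) * (t : ZMod (p ^ 2))) = shiftSum χ s b :=
        fun t =>
      Equiv.sum_comp (Equiv.addRight ((p : ZMod (p ^ 2)) * (t : ZMod (p ^ 2)))) g
    calc (p : ℂ) * shiftSum χ s b =
        ∑ t ∈ Finset.range p, ∑ x, g (x + (p : ZMod (p ^ 2)) * (t : ZMod (p ^ 2))) := by
          simp_rw [h1]; simp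
      _ = ∑ x, ∑ t ∈ Finset.range p, g (x + (p : ZMod (p ^ 2)) * (t : ZMod (p ^ 2))) :=
          Finset.sum_comm
      _ = _ := by
        symm
        exact Finset.sum_subset (Finset.subset_univ _) fun x _ hx => hinner x hx
  have h2 : (p : ℝ) * ‖shiftSum χ s b‖ ≤ p * (Fintype.card ι * p) := by
    calc (p : ℝ) * ‖shiftSum χ s b‖ = ‖(p : ℂ) * shiftSum χ s b‖ := by simp
      _ ≤ ∑ x ∈ Z, (p : ℝ) := by
        rw [hsum]
        refine (norm_sum_le _ _).trans (Finset.sum_le_sum fun x _ => ?_)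
        refine (norm_sum_le _ _).trans ((Finset.sum_le_card_nsmul _ _ 1 fun t _ => hg1 _).trans ?_)
        simp
      _ = p * Z.card := by rw [Finset.sum_const, nsmul_eq_mul, mul_comm]
      _ ≤ _ := by gcongr
  exact le_of_mul_le_mul_left h2 hp0

end PrimeSquare

section ChineseRemainder

/-- A character that is nontrivial on the kernel of reduction modulo `q / p` for every prime
`p` dividing `q`. -/
def IsLocallyPrimitive {q : ℕ} (χ : DirichletCharacter ℂ q) : Prop :=
  ∀ p, p.Prime → p ∣ q → ∃ w : ZMod q,
    IsUnit (1 + ((q / p : ℕ) : ZMod q) * w) ∧ χ (1 + ((q / p : ℕ) : ZMod q) * w) ≠ 1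

lemma exists_eq_natCast_mul_of_castHom_eq_zero {d q : ℕ} (hd : d ∣ q) {a : ZMod q}
    (ha : ZMod.castHom hd (ZMod d) a = 0) : ∃ w : ZMod q, a = (d : ZMod q) * w := by
  obtain ⟨n, rfl⟩ := ZMod.intCast_surjective a
  rw [map_intCast, ZMod.intCast_zmod_eq_zero_iff_dvd] at ha
  obtain ⟨k, rfl⟩ := ha
  exact ⟨k, by push_cast; rfl⟩

lemma DirichletCharacter.IsPrimitive.isLocallyPrimitive {q : ℕ} [NeZero q]
    {χ : DirichletCharacter ℂ q} (hχ : χ.IsPrimitive) : IsLocallyPrimitive χ := by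
  intro p hp hpq
  by_contra! h
  have hd : q / p ∣ q := Nat.div_dvd_of_dvd hpq
  have h1 : χ.FactorsThrough (q / p) := by
    rw [DirichletCharacter.factorsThrough_iff_ker_unitsMap hd]
    intro u hu
    have h2 : ZMod.castHom hd (ZMod (q / p)) ((u : ZMod q) - 1) = 0 := by
      rw [map_sub, map_one, sub_eq_zero]
      exact congrArg Units.val (MonoidHom.mem_ker.1 hu)
    obtain ⟨w, hw⟩ := exists_eq_natCast_mul_of_castHom_eq_zero hd h2
    have h3 : (u : ZMod q) = 1 + ((q / p : ℕ) : ZMod q) * w := by rw [← hw]; ring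
    rw [MonoidHom.mem_ker]
    ext
    rw [MulChar.coe_toUnitHom, h3]
    exact h w (h3 ▸ u.isUnit)
  have h4 : χ.conductor ≤ q / p := Nat.sInf_le h1
  rw [hχ] at h4
  exact absurd h4 (not_le.2 (Nat.div_lt_self (Nat.pos_of_ne_zero (NeZero.ne q)) hp.one_lt))

/-- The component of a Dirichlet character along a section of a projection `ZMod q → ZMod m`. -/
noncomputable def DirichletCharacter.pullback {q m : ℕ} (χ : DirichletCharacter ℂ q)
    (f : ZMod m →* ZMod q)
    (hf : ∀ a, IsUnit (f a) → IsUnit a) : DirichletCharacter ℂ m where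
  toMonoidHom := χ.toMonoidHom.comp f
  map_nonunit' a ha := χ.map_nonunit' _ fun h => ha (hf a h)

/-- The inclusion of the first Chinese remainder factor. -/
def crtLeft {m n : ℕ} (h : m.Coprime n) : ZMod m →* ZMod (m * n) :=
  (ZMod.chineseRemainder h).symm.toRingHom.toMonoidHom.comp (MonoidHom.inl _ _)

/-- The inclusion of the second Chinese remainder factor. -/
def crtRight {m n : ℕ} (h : m.Coprime n) : ZMod n →* ZMod (m * n) :=
  (ZMod.chineseRemainder h).symm.toRingHom.toMonoidHom.comp (MonoidHom.inr _ _)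

lemma crtLeft_apply {m n : ℕ} (h : m.Coprime n) (a : ZMod m) :
    crtLeft h a = (ZMod.chineseRemainder h).symm (a, 1) := rfl

lemma crtRight_apply {m n : ℕ} (h : m.Coprime n) (a : ZMod n) :
    crtRight h a = (ZMod.chineseRemainder h).symm (1, a) := rfl

lemma isUnit_of_isUnit_crtLeft {m n : ℕ} (h : m.Coprime n) (a : ZMod m)
    (ha : IsUnit (crtLeft h a)) : IsUnit a := by
  have := ha.map (ZMod.chineseRemainder h)
  rw [crtLeft_apply, RingEquiv.apply_symm_apply, Prod.isUnit_iff] at this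
  exact this.1

lemma isUnit_of_isUnit_crtRight {m n : ℕ} (h : m.Coprime n) (a : ZMod n)
    (ha : IsUnit (crtRight h a)) : IsUnit a := by
  have := ha.map (ZMod.chineseRemainder h)
  rw [crtRight_apply, RingEquiv.apply_symm_apply, Prod.isUnit_iff] at this
  exact this.2

variable {m n : ℕ} (h : m.Coprime n) (χ : DirichletCharacter ℂ (m * n))

/-- The first Chinese remainder component of a character. -/
noncomputable def charLeft : DirichletCharacter ℂ m :=
    χ.pullback (crtLeft h) (isUnit_of_isUnit_crtLeft h)

/-- The second Chinese remainder component of a character. -/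
noncomputable def charRight : DirichletCharacter ℂ n :=
    χ.pullback (crtRight h) (isUnit_of_isUnit_crtRight h)

lemma charLeft_apply (a : ZMod m) : charLeft h χ a = χ (crtLeft h a) := rfl

lemma charRight_apply (a : ZMod n) : charRight h χ a = χ (crtRight h a) := rfl

lemma apply_crt_symm (a : ZMod m) (b : ZMod n) :
    χ ((ZMod.chineseRemainder h).symm (a, b)) = charLeft h χ a * charRight h χ b := by
  rw [charLeft_apply, charRight_apply, ← map_mul, crtLeft_apply, crtRight_apply, ← map_mul]
  simp

variable {h χ}

lemma IsLocallyPrimitive.charLeft (hχ : IsLocallyPrimitive χ) :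
    IsLocallyPrimitive (charLeft h χ) := by
  intro p hp hpm
  obtain ⟨w, hu, hw⟩ := hχ p hp (hpm.mul_right n)
  set v := (ZMod.chineseRemainder h w).1 with hv
  have h1 : crtLeft h (1 + ((m / p : ℕ) : ZMod m) * ((n : ZMod m) * v)) =
      1 + ((m * n / p : ℕ) : ZMod (m * n)) * w := by
    rw [crtLeft_apply, RingEquiv.symm_apply_eq, ← Nat.div_mul_right_comm hpm]
    ext
    · simp [hv, mul_assoc]
    · simp
  refine ⟨n * v, isUnit_of_isUnit_crtLeft h _ (h1 ▸ hu), ?_⟩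
  rw [charLeft_apply, h1]
  exact hw

lemma IsLocallyPrimitive.charRight (hχ : IsLocallyPrimitive χ) :
    IsLocallyPrimitive (charRight h χ) := by
  intro p hp hpn
  obtain ⟨w, hu, hw⟩ := hχ p hp (hpn.mul_left m)
  set v := (ZMod.chineseRemainder h w).2 with hv
  have h1 : crtRight h (1 + ((n / p : ℕ) : ZMod n) * ((m : ZMod n) * v)) =
      1 + ((m * n / p : ℕ) : ZMod (m * n)) * w := by
    rw [crtRight_apply, RingEquiv.symm_apply_eq, Nat.mul_div_assoc m hpn]
    ext
    · simp
    · simp [hv]; ring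
  refine ⟨m * v, isUnit_of_isUnit_crtRight h _ (h1 ▸ hu), ?_⟩
  rw [charRight_apply, h1]
  exact hw

variable {ι : Type*} [Fintype ι]

lemma shiftSum_mul [NeZero m] [NeZero n] [NeZero (m * n)] (s : ι → Bool) (b : ι → ℤ) :
    shiftSum χ s b = shiftSum (_root_.charLeft h χ) s b * shiftSum (_root_.charRight h χ) s b := by
  rw [shiftSum, ← Equiv.sum_comp (ZMod.chineseRemainder h).symm.toEquiv, Fintype.sum_prod_type,
    shiftSum, shiftSum, Finset.sum_mul_sum]
  refine Finset.sum_congr rfl fun x _ => Finset.sum_congr rfl fun y _ => ?_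
  rw [← Finset.prod_mul_distrib]
  refine Finset.prod_congr rfl fun i _ => ?_
  rw [← map_mul, ← apply_crt_symm]
  congr 2
  change (ZMod.chineseRemainder h).symm (x, y) + (b i : ZMod (m * n)) = _
  rw [RingEquiv.eq_symm_apply, map_add, RingEquiv.apply_symm_apply, map_intCast]
  rfl

/-- The product of the differences between the shift `b i₀` and the other shifts. -/
def shiftDisc [DecidableEq ι] (b : ι → ℤ) (i₀ : ι) : ℕ :=
  (∏ j ∈ Finset.univ.erase i₀, (b i₀ - b j)).natAbs

lemma ne_of_not_dvd_shiftDisc [DecidableEq ι] {b : ι → ℤ} {i₀ : ι} {p : ℕ}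
    (hp : ¬ p ∣ shiftDisc b i₀) (j : ι) (hj : j ≠ i₀) : (b j : ZMod p) ≠ b i₀ := by
  intro h
  apply hp
  rw [shiftDisc, ← Int.natCast_dvd]
  refine dvd_trans ?_ (Finset.dvd_prod_of_mem _ (Finset.mem_erase.2 ⟨hj, Finset.mem_univ j⟩))
  exact (ZMod.intCast_eq_intCast_iff_dvd_sub _ _ _).1 h

lemma norm_shiftSum_prime_pow_le [DecidableEq ι] (s : ι → Bool) (b : ι → ℤ) (i₀ : ι) {p k : ℕ}
    (hp : p.Prime) (hk : 0 < k) (hk2 : k ≤ 2) [NeZero (p ^ k)] (χ : DirichletCharacter ℂ (p ^ k))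
    (hχ : IsLocallyPrimitive χ) :
    ‖shiftSum χ s b‖ ≤ Fintype.card ι * √(p ^ k : ℕ) * (p ^ k).gcd (shiftDisc b i₀) := by
  have : Fact p.Prime := ⟨hp⟩
  have hp0 : (0 : ℝ) < p := by exact_mod_cast hp.pos
  have hι : (1 : ℝ) ≤ Fintype.card ι := by
    exact_mod_cast Fintype.card_pos_iff.2 ⟨i₀⟩
  by_cases hdvd : p ∣ shiftDisc b i₀
  · refine (norm_shiftSum_le _ _ _).trans ?_
    have h1 : (p : ℝ) ≤ (p ^ k).gcd (shiftDisc b i₀) := by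
      exact_mod_cast Nat.le_of_dvd (Nat.gcd_pos_of_pos_left _ (Nat.pow_pos hp.pos))
        (Nat.dvd_gcd (dvd_pow_self p hk.ne') hdvd)
    have h2 : √(p ^ k : ℕ) ≤ p := by
      rw [Real.sqrt_le_left hp0.le]
      exact_mod_cast Nat.pow_le_pow_right hp.pos hk2
    calc ((p ^ k : ℕ) : ℝ) = 1 * √(p ^ k : ℕ) * √(p ^ k : ℕ) := by
          rw [one_mul, Real.mul_self_sqrt (Nat.cast_nonneg _)]
      _ ≤ _ := by gcongr; exact h2.trans h1
  · have hg : (1 : ℝ) ≤ (p ^ k).gcd (shiftDisc b i₀) := by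
      exact_mod_cast Nat.gcd_pos_of_pos_left _ (Nat.pow_pos hp.pos)
    have hb := ne_of_not_dvd_shiftDisc hdvd
    suffices h : ‖shiftSum χ s b‖ ≤ Fintype.card ι * √(p ^ k : ℕ) from
      h.trans (le_mul_of_one_le_right (by positivity) hg)
    obtain ⟨w, hu, hw⟩ := hχ p hp (dvd_pow_self p hk.ne')
    interval_cases k
    · have hb1 : ∀ j, j ≠ i₀ → (b j : ZMod (p ^ 1)) ≠ b i₀ :=
        ne_of_not_dvd_shiftDisc (by rwa [pow_one])
      have : Fact (p ^ 1).Prime := ⟨by rwa [pow_one]⟩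
      refine norm_shiftSum_prime_le ?_ s b i₀ hb1
      rintro rfl
      exact hw (MulChar.one_apply hu)
    · have h1 : p ^ 2 / p = p := by rw [sq, Nat.mul_div_cancel _ hp.pos]
      rw [h1] at hw
      have h2 : √(p ^ 2 : ℕ) = p := by push_cast; exact Real.sqrt_sq hp0.le
      rw [h2]
      exact norm_shiftSum_prime_sq_le ⟨w, hw⟩ s b i₀ hb

/-- Square-root cancellation for products of shifted characters to a cube-free modulus. -/
theorem norm_shiftSum_cubefree_le [DecidableEq ι] (s : ι → Bool) (b : ι → ℤ) (i₀ : ι) {q : ℕ}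
    (hq : ∀ p : ℕ, p.Prime → ¬ p ^ 3 ∣ q) [NeZero q] (χ : DirichletCharacter ℂ q)
    (hχ : IsLocallyPrimitive χ) :
    ‖shiftSum χ s b‖ ≤
      (Fintype.card ι : ℝ) ^ q.primeFactors.card * √q * q.gcd (shiftDisc b i₀) := by
  rename_i inst
  revert inst
  induction q using Nat.recOnPosPrimePosCoprime with
  | zero => intro inst; exact absurd rfl inst.out
  | one =>
    intro inst
    refine (norm_shiftSum_le _ _ _).trans (by simp)
  | prime_pow p k hp hk =>
    intro inst
    refine (norm_shiftSum_prime_pow_le s b i₀ hp hk ?_ χ hχ).trans_eq ?_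
    · by_contra! hk3
      exact hq p hp (pow_dvd_pow p hk3)
    · rw [Nat.primeFactors_prime_pow hk.ne' hp, Finset.card_singleton, pow_one]
  | coprime m n hm hn hmn ihm ihn =>
    intro inst
    have : NeZero m := ⟨by omega⟩
    have : NeZero n := ⟨by omega⟩
    rw [shiftSum_mul (h := hmn), norm_mul, hmn.primeFactors_mul,
      Finset.card_union_of_disjoint hmn.disjoint_primeFactors, pow_add, Nat.cast_mul,
      Real.sqrt_mul (Nat.cast_nonneg _), Nat.gcd_comm (m * n), hmn.gcd_mul, Nat.cast_mul]
    refine (mul_le_mul (ihm (fun p hp hpm => hq p hp (hpm.mul_right n)) _ hχ.charLeft)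
      (ihn (fun p hp hpn => hq p hp (hpn.mul_left m)) _ hχ.charRight) (norm_nonneg _)
      (by positivity)).trans_eq ?_
    rw [Nat.gcd_comm m, Nat.gcd_comm n]
    ring

end ChineseRemainder

section DivisorBounds

lemma exists_prod_primeFactors_le {ε : ℝ} (hε : 0 < ε) (g : ℕ → ℝ) {K C : ℝ} (hK : 1 ≤ K)
    (hC : 1 ≤ C) (hg0 : ∀ v, 0 ≤ g v) (hgK : ∀ v, 1 ≤ v → g v ≤ K ^ v)
    (hgC : ∀ v, 1 ≤ v → g v ≤ C * (2 : ℝ) ^ (ε * v)) :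
    ∃ D : ℝ, 1 ≤ D ∧ ∀ n : ℕ, n ≠ 0 →
      ∏ p ∈ n.primeFactors, g (n.factorization p) ≤ D * (n : ℝ) ^ ε := by
  set P := ⌈K ^ ε⁻¹⌉₊ with hP
  refine ⟨C ^ P, one_le_pow₀ hC, fun n hn => ?_⟩
  have h1 : ∀ p ∈ n.primeFactors, g (n.factorization p) ≤
      (if p < P then C else 1) * ((p : ℝ) ^ n.factorization p) ^ ε := by
    intro p hp
    have hpp := Nat.prime_of_mem_primeFactors hp
    have hv : 1 ≤ n.factorization p :=
      (hpp.dvd_iff_one_le_factorization hn).1 (Nat.dvd_of_mem_primeFactors hp)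
    have h2 : (2 : ℝ) ≤ p := by exact_mod_cast hpp.two_le
    have hpow : ((p : ℝ) ^ n.factorization p) ^ ε = (p : ℝ) ^ (ε * n.factorization p) := by
      rw [← Real.rpow_natCast, ← Real.rpow_mul (by positivity), mul_comm]
    split_ifs with h
    · refine (hgC _ hv).trans ?_
      rw [hpow]
      gcongr
    · rw [one_mul, hpow]
      refine (hgK _ hv).trans ?_
      rw [Real.rpow_mul (by positivity), Real.rpow_natCast]
      gcongr
      calc K = (K ^ ε⁻¹) ^ ε := by
            rw [← Real.rpow_mul (by positivity), inv_mul_cancel₀ hε.ne', Real.rpow_one]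
        _ ≤ (p : ℝ) ^ ε := by
            gcongr
            exact (Nat.le_ceil _).trans (by exact_mod_cast not_lt.1 h)
  refine (Finset.prod_le_prod (fun _ _ => hg0 _) h1).trans ?_
  rw [Finset.prod_mul_distrib, Real.finsetProd_rpow _ _ (fun _ _ => by positivity)]
  have h3 : ∏ p ∈ n.primeFactors, (p : ℝ) ^ n.factorization p = n := by
    have := Nat.prod_factorization_pow_eq_self hn
    rw [Nat.prod_factorization_eq_prod_primeFactors] at this
    exact_mod_cast this
  rw [h3]
  gcongr
  rw [Finset.prod_ite, Finset.prod_const_one, mul_one, Finset.prod_const]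
  refine pow_le_pow_right₀ hC ?_
  calc _ ≤ (Finset.range P).card := Finset.card_le_card fun p hp => by
        simpa using (Finset.mem_filter.1 hp).2
    _ = P := Finset.card_range P

lemma exists_pow_card_primeFactors_le {ε : ℝ} (hε : 0 < ε) {K : ℝ} (hK : 1 ≤ K) :
    ∃ D : ℝ, 1 ≤ D ∧ ∀ n : ℕ, n ≠ 0 → K ^ n.primeFactors.card ≤ D * (n : ℝ) ^ ε := by
  obtain ⟨D, hD, h⟩ := exists_prod_primeFactors_le hε (fun _ => K) hK hK (fun _ => by positivity)
    (fun v hv => le_self_pow₀ hK (by omega))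
    (fun v _ => le_mul_of_one_le_right (by positivity)
      (Real.one_le_rpow (by norm_num) (by positivity)))
  exact ⟨D, hD, fun n hn => by simpa using h n hn⟩

lemma exists_card_divisors_le {ε : ℝ} (hε : 0 < ε) :
    ∃ D : ℝ, 1 ≤ D ∧ ∀ n : ℕ, n ≠ 0 → (n.divisors.card : ℝ) ≤ D * (n : ℝ) ^ ε := by
  have hl : 0 < ε * Real.log 2 := mul_pos hε (Real.log_pos (by norm_num))
  obtain ⟨D, hD, h⟩ := exists_prod_primeFactors_le hε (fun v => (v : ℝ) + 1) (K := 2)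
    (C := 1 + (ε * Real.log 2)⁻¹) (by norm_num) (le_add_of_nonneg_right (inv_pos.2 hl).le)
        (fun _ => by positivity)
    (fun v _ => by
      have := one_add_mul_le_pow (a := (1 : ℝ)) (by norm_num) v
      norm_num at this
      linarith)
    (fun v _ => by
      rw [Real.rpow_def_of_pos (by norm_num)]
      have h1 := Real.add_one_le_exp (Real.log 2 * (ε * v))
      calc (v : ℝ) + 1 ≤ (1 + (ε * Real.log 2)⁻¹) * (Real.log 2 * (ε * v) + 1) := by
            have h2 : (ε * Real.log 2)⁻¹ * (Real.log 2 * (ε * v)) = v := by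
              field_simp
            have h3 : 0 < (ε * Real.log 2)⁻¹ := inv_pos.2 hl
            have h4 : 0 ≤ Real.log 2 * (ε * v) := by positivity
            linarith
        _ ≤ _ := by gcongr)
  refine ⟨D, hD, fun n hn => ?_⟩
  rw [Nat.card_divisors hn]
  exact_mod_cast h n hn

lemma sum_gcd_le (q h : ℕ) (hq : q ≠ 0) :
    ∑ k ∈ Finset.Ioc 0 h, q.gcd k ≤ h * q.divisors.card := by
  calc ∑ k ∈ Finset.Ioc 0 h, q.gcd k
      ≤ ∑ k ∈ Finset.Ioc 0 h, ∑ d ∈ q.divisors, if d ∣ k then d else 0 := by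
        refine Finset.sum_le_sum fun k _ => ?_
        have h1 : q.gcd k ∈ q.divisors := Nat.mem_divisors.2 ⟨Nat.gcd_dvd_left _ _, hq⟩
        refine le_trans ?_ (Finset.single_le_sum (fun _ _ => Nat.zero_le _) h1)
        rw [if_pos (Nat.gcd_dvd_right _ _)]
    _ = ∑ d ∈ q.divisors, d * (h / d) := by
        rw [Finset.sum_comm]
        refine Finset.sum_congr rfl fun d _ => ?_
        rw [← Finset.sum_filter, Finset.sum_const, Nat.Ioc_filter_dvd_card_eq_div, smul_eq_mul,
          mul_comm]
    _ ≤ ∑ d ∈ q.divisors, h := Finset.sum_le_sum fun d _ => Nat.mul_div_le h d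
    _ = _ := by rw [Finset.sum_const, smul_eq_mul, mul_comm]

lemma sum_range_gcd_sub_le (q h m : ℕ) (hq : q ≠ 0) (hm : m < h) :
    ∑ k ∈ Finset.range h, (if k = m then 0 else q.gcd ((m : ℤ) - k).natAbs) ≤
      2 * h * q.divisors.card := by
  have h1 : ∀ f : ℕ → ℕ, ∑ k ∈ Finset.range h, f k =
      ∑ k ∈ Finset.range m, f k + f m + ∑ k ∈ Finset.range (h - m - 1), f (m + 1 + k) := by
    intro f
    rw [← Finset.sum_range_succ, ← Finset.sum_range_add]
    congr 2; omega
  rw [h1, if_pos rfl, add_zero, two_mul, add_mul]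
  have h2 : ∀ n ≤ h, ∑ k ∈ Finset.range n, q.gcd (k + 1) ≤ h * q.divisors.card := by
    intro n hn
    calc _ = ∑ k ∈ Finset.Ioc 0 n, q.gcd k := by
          rw [← Finset.Ico_add_one_add_one_eq_Ioc, Finset.sum_Ico_eq_sum_range]
          simp [add_comm]
      _ ≤ n * q.divisors.card := sum_gcd_le q n hq
      _ ≤ _ := Nat.mul_le_mul_right _ hn
  refine add_le_add (le_trans (le_of_eq ?_) (h2 m hm.le)) (le_trans (le_of_eq ?_)
      (h2 (h - m - 1) (by omega)))
  · rw [← Finset.sum_range_reflect]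
    refine Finset.sum_congr rfl fun k hk => ?_
    rw [Finset.mem_range] at hk
    rw [if_neg (by omega)]
    congr 1; omega
  · refine Finset.sum_congr rfl fun k hk => ?_
    rw [if_neg (by omega)]
    congr 1; omega

lemma gcd_prod_natAbs_le {ι : Type*} (q : ℕ) (hq : q ≠ 0) (s : Finset ι) (f : ι → ℤ) :
    q.gcd (∏ i ∈ s, f i).natAbs ≤ ∏ i ∈ s, q.gcd (f i).natAbs := by
  classical
  induction s using Finset.induction_on with
  | empty => simp
  | insert a s ha ih =>
    rw [Finset.prod_insert ha, Finset.prod_insert ha, Int.natAbs_mul]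
    exact (Nat.le_of_dvd (Nat.mul_pos (Nat.gcd_pos_of_pos_left _ (Nat.pos_of_ne_zero hq))
      (Nat.gcd_pos_of_pos_left _ (Nat.pos_of_ne_zero hq)))
          (Nat.gcd_mul_right_dvd_mul_gcd _ _ _)).trans
      (Nat.mul_le_mul_left _ ih)

end DivisorBounds

section Moments

/-- The sum of `χ` over the `h` residues following `x`. -/
noncomputable def shortSum {q : ℕ} (χ : DirichletCharacter ℂ q) (x : ZMod q) (h : ℕ) : ℂ :=
  ∑ n ∈ Finset.range h, χ (x + (n + 1 : ℕ))

lemma shortSum_add {q : ℕ} (χ : DirichletCharacter ℂ q) (x : ZMod q) (h k : ℕ) :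
    shortSum χ x (h + k) = shortSum χ x h + shortSum χ (x + h) k := by
  rw [shortSum, Finset.sum_range_add, shortSum, shortSum]
  congr 1
  refine Finset.sum_congr rfl fun n _ => ?_
  congr 1
  push_cast
  ring

lemma norm_shortSum_pow {q : ℕ} (χ : DirichletCharacter ℂ q) (x : ZMod q) (h r : ℕ) :
    ((‖shortSum χ x h‖ ^ (2 * r) : ℝ) : ℂ) =
      ∑ n ∈ Fintype.piFinset fun _ : Bool × Fin r => Finset.range h,
        ∏ i, condConj i.1 (χ (x + ((n i + 1 : ℕ) : ℤ))) := by
  rw [← Finset.prod_univ_sum (fun _ : Bool × Fin r => Finset.range h)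
    (fun i k => condConj i.1 (χ (x + ((k + 1 : ℕ) : ℤ))))]
  simp_rw [← map_sum, Int.cast_natCast]
  rw [Fintype.prod_prod_type]
  simp only [Fintype.prod_bool, Finset.prod_const, Finset.card_univ, Fintype.card_fin, condConj,
    RingHom.id_apply]
  rw [← mul_pow]
  change _ = (shortSum χ x h * starRingEnd ℂ (shortSum χ x h)) ^ r
  rw [Complex.mul_conj, Complex.normSq_eq_norm_sq, pow_mul]
  push_cast
  rfl

lemma sum_norm_shortSum_pow_le {q : ℕ} [NeZero q] (χ : DirichletCharacter ℂ q) (h r : ℕ) :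
    ∑ x, ‖shortSum χ x h‖ ^ (2 * r) ≤
      ∑ n ∈ Fintype.piFinset fun _ : Bool × Fin r => Finset.range h,
        ‖shiftSum χ (fun i : Bool × Fin r => i.1) (fun i => ((n i + 1 : ℕ) : ℤ))‖ := by
  have h1 : ((∑ x, ‖shortSum χ x h‖ ^ (2 * r) : ℝ) : ℂ) =
      ∑ n ∈ Fintype.piFinset fun _ : Bool × Fin r => Finset.range h,
        shiftSum χ (fun i : Bool × Fin r => i.1) (fun i => ((n i + 1 : ℕ) : ℤ)) := by
    rw [Complex.ofReal_sum]
    simp_rw [norm_shortSum_pow]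
    rw [Finset.sum_comm]
    rfl
  have h2 : 0 ≤ ∑ x, ‖shortSum χ x h‖ ^ (2 * r) := by positivity
  calc _ = ‖((∑ x, ‖shortSum χ x h‖ ^ (2 * r) : ℝ) : ℂ)‖ := by
        rw [Complex.norm_real, Real.norm_of_nonneg h2]
    _ ≤ _ := by rw [h1]; exact norm_sum_le _ _

variable {ι : Type*} [Fintype ι]

lemma card_image_le_of_forall_exists_ne {α : Type*} [DecidableEq α] (n : ι → α)
    (hn : ∀ i, ∃ j, j ≠ i ∧ n j = n i) : 2 * (Finset.univ.image n).card ≤ Fintype.card ι := by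
  classical
  refine Finset.mul_card_image_le_card _ _ fun b hb => ?_
  obtain ⟨i, -, rfl⟩ := Finset.mem_image.1 hb
  obtain ⟨j, hj, hij⟩ := hn i
  exact Finset.one_lt_card.2 ⟨j, by simpa using hij, i, by simp, hj⟩

variable [DecidableEq ι]

lemma card_filter_paired_le (h r : ℕ) (hr : 0 < r) (hι : Fintype.card ι = 2 * r) :
    ((Fintype.piFinset fun _ : ι => Finset.range h).filter
      fun n => ∀ i, ∃ j, j ≠ i ∧ n j = n i).card ≤ r ^ (2 * r) * h ^ r := by
  have h1 : ((Fintype.piFinset fun _ : ι => Finset.range h).filter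
      fun n => ∀ i, ∃ j, j ≠ i ∧ n j = n i) ⊆
      (Finset.univ ×ˢ Fintype.piFinset fun _ : Fin r => Finset.range h).image
        fun gf : (ι → Fin r) × (Fin r → ℕ) => gf.2 ∘ gf.1 := by
    intro n hn
    rw [Finset.mem_filter, Fintype.mem_piFinset] at hn
    have hc := card_image_le_of_forall_exists_ne n hn.2
    have hc2 : Fintype.card (Finset.univ.image n) ≤ Fintype.card (Fin r) := by
      rw [Fintype.card_coe, Fintype.card_fin]; omega
    obtain ⟨e⟩ := Function.Embedding.nonempty_of_card_le hc2
    have hι0 : 0 < Fintype.card ι := by omega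
    obtain ⟨i₁⟩ := Fintype.card_pos_iff.1 hι0
    have : Nonempty (Finset.univ.image n) := ⟨⟨n i₁, Finset.mem_image_of_mem _ (Finset.mem_univ _)⟩⟩
    refine Finset.mem_image.2 ⟨(fun i => e ⟨n i, Finset.mem_image_of_mem _ (Finset.mem_univ _)⟩,
      fun k => (Function.invFun e k).1), ?_, ?_⟩
    · rw [Finset.mem_product, Fintype.mem_piFinset]
      refine ⟨Finset.mem_univ _, fun k => ?_⟩
      obtain ⟨i, -, hi⟩ := Finset.mem_image.1 (Function.invFun e k).2
      dsimp only
      rw [← hi]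
      exact hn.1 i
    · funext i
      simp [Function.leftInverse_invFun e.injective _]
  refine (Finset.card_le_card h1).trans (Finset.card_image_le.trans_eq ?_)
  simp [Fintype.card_piFinset, hι]

lemma sum_prod_gcd_le (q h : ℕ) (hq : q ≠ 0) (i₀ : ι) :
    ∑ n ∈ Fintype.piFinset fun _ : ι => Finset.range h, ∏ j ∈ Finset.univ.erase i₀,
      (if n j = n i₀ then 0 else q.gcd ((n i₀ : ℤ) - n j).natAbs) ≤
      h * (2 * h * q.divisors.card) ^ (Fintype.card ι - 1) := by
  calc _ = ∑ n ∈ Fintype.piFinset fun _ : ι => Finset.range h, ∑ m ∈ Finset.range h,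
        ∏ j, (if j = i₀ then if n j = m then 1 else 0 else
          if n j = m then 0 else q.gcd ((m : ℤ) - n j).natAbs) := by
        refine Finset.sum_congr rfl fun n hn => ?_
        rw [Finset.sum_eq_single (n i₀)]
        · rw [← Finset.mul_prod_erase _ _ (Finset.mem_univ i₀), if_pos rfl, if_pos rfl, one_mul]
          refine Finset.prod_congr rfl fun j hj => ?_
          rw [if_neg (Finset.ne_of_mem_erase hj)]
        · intro m _ hm
          refine Finset.prod_eq_zero (Finset.mem_univ i₀) ?_
          rw [if_pos rfl, if_neg hm.symm]
        · intro h1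
          exact absurd (Fintype.mem_piFinset.1 hn i₀) h1
    _ = ∑ m ∈ Finset.range h, ∏ j, ∑ k ∈ Finset.range h, (if j = i₀ then if k = m then 1 else 0 else
          if k = m then 0 else q.gcd ((m : ℤ) - k).natAbs) := by
        rw [Finset.sum_comm]
        refine Finset.sum_congr rfl fun m _ => ?_
        rw [Finset.prod_univ_sum]
    _ ≤ ∑ m ∈ Finset.range h, (2 * h * q.divisors.card) ^ (Fintype.card ι - 1) := by
        refine Finset.sum_le_sum fun m hm => ?_
        rw [← Finset.mul_prod_erase _ _ (Finset.mem_univ i₀)]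
        simp only [if_true]
        rw [Finset.sum_ite_eq', if_pos hm, one_mul, ← Finset.card_univ,
          ← Finset.card_erase_of_mem (Finset.mem_univ i₀)]
        refine Finset.prod_le_pow_card _ _ _ fun j hj => ?_
        simp only [if_neg (Finset.ne_of_mem_erase hj)]
        exact sum_range_gcd_sub_le q h m hq (Finset.mem_range.1 hm)
    _ = _ := by simp

lemma sum_norm_shiftSum_le {q : ℕ} [NeZero q] (hq : ∀ p : ℕ, p.Prime → ¬ p ^ 3 ∣ q)
    {χ : DirichletCharacter ℂ q} (hχ : IsLocallyPrimitive χ) (s : ι → Bool) (h r : ℕ) (hr : 0 < r)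
    (hι : Fintype.card ι = 2 * r) :
    ∑ n ∈ Fintype.piFinset fun _ : ι => Finset.range h,
        ‖shiftSum χ s (fun i => ((n i + 1 : ℕ) : ℤ))‖ ≤
      r ^ (2 * r) * h ^ r * q + (2 * r : ℝ) ^ q.primeFactors.card * √q *
        (2 * r * (h * (2 * h * q.divisors.card) ^ (2 * r - 1))) := by
  rw [← Finset.sum_filter_add_sum_filter_not _ fun n => ∀ i, ∃ j, j ≠ i ∧ n j = n i]
  refine add_le_add ?_ ?_
  · refine (Finset.sum_le_card_nsmul _ _ (q : ℝ) fun n _ => norm_shiftSum_le _ _ _).trans ?_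
    rw [nsmul_eq_mul]
    gcongr
    exact_mod_cast card_filter_paired_le h r hr hι
  · set K := (2 * r : ℝ) ^ q.primeFactors.card * √q with hK
    set F : (ι → ℕ) → ι → ℕ := fun n i₀ => ∏ j ∈ Finset.univ.erase i₀,
      (if n j = n i₀ then 0 else q.gcd ((n i₀ : ℤ) - n j).natAbs) with hF
    calc _ ≤ ∑ n ∈ (Fintype.piFinset fun _ : ι => Finset.range h).filter
            (fun n => ¬ ∀ i, ∃ j, j ≠ i ∧ n j = n i), ∑ i₀, K * (F n i₀ : ℝ) := by
          refine Finset.sum_le_sum fun n hn => ?_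
          have h1 := (Finset.mem_filter.1 hn).2
          push Not at h1
          obtain ⟨i₀, hi₀⟩ := h1
          have h2 := norm_shiftSum_cubefree_le s (fun i => ((n i + 1 : ℕ) : ℤ)) i₀ hq χ hχ
          refine h2.trans (le_trans ?_ (Finset.single_le_sum (fun i _ => by positivity)
            (Finset.mem_univ i₀)))
          have h3 : q.gcd (shiftDisc (fun i => ((n i + 1 : ℕ) : ℤ)) i₀) ≤ F n i₀ := by
            refine (gcd_prod_natAbs_le q (NeZero.ne q) _ _).trans_eq ?_
            refine Finset.prod_congr rfl fun j hj => ?_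
            rw [if_neg (hi₀ j (Finset.ne_of_mem_erase hj))]
            congr 2
            push_cast; ring
          rw [hK]
          have h4 : (q.gcd (shiftDisc (fun i => ((n i + 1 : ℕ) : ℤ)) i₀) : ℝ) ≤ F n i₀ := by
            exact_mod_cast h3
          have h5 : (Fintype.card ι : ℝ) = 2 * r := by exact_mod_cast hι
          rw [h5]
          gcongr
      _ ≤ ∑ n ∈ Fintype.piFinset fun _ : ι => Finset.range h, ∑ i₀, K * (F n i₀ : ℝ) :=
          Finset.sum_le_sum_of_subset_of_nonneg (Finset.filter_subset _ _)
            fun _ _ _ => by positivity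
      _ = K * ∑ i₀, ((∑ n ∈ Fintype.piFinset fun _ : ι => Finset.range h, F n i₀ : ℕ) : ℝ) := by
          rw [Finset.sum_comm, Finset.mul_sum]
          refine Finset.sum_congr rfl fun i _ => ?_
          rw [← Finset.mul_sum, Nat.cast_sum]
      _ ≤ K * ∑ i₀ : ι, ((h * (2 * h * q.divisors.card) ^ (2 * r - 1) : ℕ) : ℝ) := by
          gcongr with i
          rw [← hι]
          exact sum_prod_gcd_le q h (NeZero.ne q) i
      _ = _ := by simp [hι]

/-- The even moments of short sums of a primitive character to a cube-free modulus. -/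
theorem exists_moment_shortSum_le (r : ℕ) (hr : 0 < r) {ε : ℝ} (hε : 0 < ε) :
    ∃ C : ℝ, 1 ≤ C ∧ ∀ (q : ℕ) [NeZero q], (∀ p : ℕ, p.Prime → ¬ p ^ 3 ∣ q) →
      ∀ χ : DirichletCharacter ℂ q, IsLocallyPrimitive χ → ∀ h : ℕ,
        ∑ x, ‖shortSum χ x h‖ ^ (2 * r) ≤
          C * (q : ℝ) ^ ε * (√q * h ^ (2 * r) + q * h ^ r) := by
  set δ := ε / (2 * r) with hδ
  have hr1 : (1 : ℝ) ≤ r := by exact_mod_cast hr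
  have hδ0 : 0 < δ := by positivity
  obtain ⟨D, hD, hDd⟩ := exists_card_divisors_le hδ0
  obtain ⟨E, hE, hEd⟩ := exists_pow_card_primeFactors_le hδ0 (K := 2 * r) (by linarith)
  refine ⟨r ^ (2 * r) + E * (2 * r * (2 * D) ^ (2 * r - 1)), ?_, ?_⟩
  · have : (1 : ℝ) ≤ r ^ (2 * r) := one_le_pow₀ hr1
    have h2 : 0 ≤ E * (2 * r * (2 * D) ^ (2 * r - 1)) := by positivity
    linarith
  intro q _ hq χ hχ h
  have hq0 : q ≠ 0 := NeZero.ne q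
  have hq1 : (1 : ℝ) ≤ q := by exact_mod_cast Nat.pos_of_ne_zero hq0
  have h1 := (sum_norm_shortSum_pow_le χ h r).trans
    (sum_norm_shiftSum_le hq hχ (fun i : Bool × Fin r => i.1) h r hr (by simp))
  refine h1.trans ?_
  have hqε : 1 ≤ (q : ℝ) ^ ε := Real.one_le_rpow hq1 hε.le
  have h2 : (2 * r : ℝ) ^ q.primeFactors.card * √q *
        (2 * r * (h * (2 * h * q.divisors.card) ^ (2 * r - 1))) ≤
      E * (2 * r * (2 * D) ^ (2 * r - 1)) * (q : ℝ) ^ ε * (√q * h ^ (2 * r)) := by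
    calc _ ≤ (E * (q : ℝ) ^ δ) * √q *
          (2 * r * (h * (2 * h * (D * (q : ℝ) ^ δ)) ^ (2 * r - 1))) := by
          gcongr
          · exact hEd q hq0
          · exact hDd q hq0
      _ = E * (2 * r * (2 * D) ^ (2 * r - 1)) * (((q : ℝ) ^ δ) ^ (2 * r - 1 + 1)) *
            (√q * (h ^ (2 * r - 1 + 1))) := by
          rw [mul_pow (2 * (h : ℝ)), mul_pow 2 (h : ℝ), mul_pow 2 D, mul_pow D]
          ring
      _ = _ := by
          rw [show 2 * r - 1 + 1 = 2 * r by omega, ← Real.rpow_natCast ((q : ℝ) ^ δ),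
            ← Real.rpow_mul (by positivity)]
          congr 3
          rw [hδ]
          push_cast
          field_simp
  have h3 : (r : ℝ) ^ (2 * r) * h ^ r * q ≤ r ^ (2 * r) * (q : ℝ) ^ ε * (q * h ^ r) := by
    calc (r : ℝ) ^ (2 * r) * h ^ r * q = r ^ (2 * r) * 1 * (q * h ^ r) := by ring
      _ ≤ _ := by gcongr
  have h4 : 0 ≤ (r : ℝ) ^ (2 * r) * (q : ℝ) ^ ε * (√q * h ^ (2 * r)) := by positivity
  have h5 : 0 ≤ E * (2 * r * (2 * D) ^ (2 * r - 1)) * (q : ℝ) ^ ε * (q * h ^ r) := by positivity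
  linarith [h2, h3, h4, h5]

end Moments

section Plancherel

open ZMod

variable {q : ℕ} [NeZero q]

lemma norm_stdAddChar (a : ZMod q) : ‖stdAddChar a‖ = 1 := by
  rw [stdAddChar_apply]
  exact Circle.norm_coe _

lemma sum_norm_dft_sq (f : ZMod q → ℂ) : ∑ k, ‖𝓕 f k‖ ^ 2 = q * ∑ j, ‖f j‖ ^ 2 := by
  have h1 : ∀ z : ℂ, ((‖z‖ ^ 2 : ℝ) : ℂ) = z * starRingEnd ℂ z := by
    intro z
    rw [Complex.mul_conj, Complex.normSq_eq_norm_sq]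
  have h2 : ((∑ k, ‖𝓕 f k‖ ^ 2 : ℝ) : ℂ) = ((q * ∑ j, ‖f j‖ ^ 2 : ℝ) : ℂ) := by
    rw [Complex.ofReal_mul, Complex.ofReal_sum, Complex.ofReal_sum]
    simp_rw [h1, dft_apply, map_sum, Finset.sum_mul_sum]
    rw [Finset.sum_comm, Finset.mul_sum]
    refine Finset.sum_congr rfl fun i _ => ?_
    rw [Finset.sum_comm, Finset.sum_eq_single i]
    · have h3 : ∀ k, stdAddChar (-(i * k)) • f i * starRingEnd ℂ (stdAddChar (-(i * k)) • f i) =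
          f i * starRingEnd ℂ (f i) := by
        intro k
        rw [← h1, ← h1, norm_smul, norm_stdAddChar, one_mul]
      simp_rw [h3]
      rw [Finset.sum_const, Finset.card_univ, ZMod.card, nsmul_eq_mul]
      rfl
    · intro j _ hj
      have h3 : ∀ k, stdAddChar (-(i * k)) • f i * starRingEnd ℂ (stdAddChar (-(j * k)) • f j) =
          f i * starRingEnd ℂ (f j) * stdAddChar (k * (j - i)) := by
        intro k
        rw [smul_eq_mul, smul_eq_mul, map_mul, ← AddChar.map_neg_eq_conj,
          show k * (j - i) = -(i * k) + -(-(j * k)) by ring, AddChar.map_add_eq_mul]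
        ring
      simp_rw [h3]
      rw [← Finset.mul_sum, AddChar.sum_mulShift _ (isPrimitive_stdAddChar q),
        if_neg (sub_ne_zero.2 hj), Nat.cast_zero, mul_zero]
    · simp
  exact_mod_cast h2

lemma norm_gaussSum_sq_le {χ : DirichletCharacter ℂ q} (hχ : χ.IsPrimitive) :
    ‖gaussSum χ stdAddChar‖ ^ 2 ≤ q := by
  have h1 := sum_norm_dft_sq (χ : ZMod q → ℂ)
  simp_rw [hχ.fourierTransform_eq_inv_mul_gaussSum, norm_mul, mul_pow] at h1
  rw [← Finset.sum_mul] at h1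
  have h2 : ∀ k, ‖χ⁻¹ (-k)‖ = ‖χ k‖ := by
    intro k
    by_cases hk : IsUnit k
    · obtain ⟨u, rfl⟩ := hk
      rw [χ.unit_norm_eq_one, ← Units.val_neg, DirichletCharacter.unit_norm_eq_one]
    · rw [MulChar.map_nonunit _ hk, MulChar.map_nonunit]
      simpa using hk
  simp_rw [h2] at h1
  have h3 : 0 < ∑ k, ‖χ k‖ ^ 2 := by
    refine Finset.sum_pos' (fun _ _ => by positivity) ⟨1, Finset.mem_univ _, ?_⟩
    simp
  nlinarith

lemma norm_dft_sq_le {χ : DirichletCharacter ℂ q} (hχ : χ.IsPrimitive) (k : ZMod q) :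
    ‖𝓕 χ k‖ ^ 2 ≤ q := by
  rw [hχ.fourierTransform_eq_inv_mul_gaussSum, norm_mul, mul_pow]
  refine le_trans ?_ (norm_gaussSum_sq_le hχ)
  exact mul_le_of_le_one_left (by positivity)
    (pow_le_one₀ (norm_nonneg _) (DirichletCharacter.norm_le_one _ _))

/-- The indicator function of `{-1, …, -h}`. -/
noncomputable def negIntervalIndicator (q h : ℕ) (y : ZMod q) : ℂ :=
  ∑ n ∈ Finset.range h, if y = -((n + 1 : ℕ) : ZMod q) then 1 else 0

lemma dft_shortSum (χ : DirichletCharacter ℂ q) (h : ℕ) (k : ZMod q) :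
    𝓕 (fun x => shortSum χ x h) k = 𝓕 (negIntervalIndicator q h) k * 𝓕 χ k := by
  have h1 : 𝓕 (negIntervalIndicator q h) k =
      ∑ n ∈ Finset.range h, stdAddChar (((n + 1 : ℕ) : ZMod q) * k) := by
    simp_rw [dft_apply, negIntervalIndicator, Finset.smul_sum]
    rw [Finset.sum_comm]
    refine Finset.sum_congr rfl fun n _ => ?_
    simp only [smul_eq_mul, mul_ite, mul_one, mul_zero, Finset.sum_ite_eq', Finset.mem_univ,
      if_true]
    congr 1
    ring
  rw [h1, Finset.sum_mul]
  simp_rw [dft_apply, shortSum, Finset.smul_sum]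
  rw [Finset.sum_comm]
  refine Finset.sum_congr rfl fun n _ => ?_
  rw [Finset.mul_sum, ← Equiv.sum_comp (Equiv.subRight ((n + 1 : ℕ) : ZMod q))]
  refine Finset.sum_congr rfl fun j _ => ?_
  simp only [Equiv.subRight_apply, sub_add_cancel, smul_eq_mul]
  rw [← mul_assoc, ← AddChar.map_add_eq_mul]
  congr 2
  ring

lemma sum_norm_negIntervalIndicator_sq {h : ℕ} (hh : h ≤ q) :
    ∑ y, ‖negIntervalIndicator q h y‖ ^ 2 = h := by
  have h1 : ∀ y, ‖negIntervalIndicator q h y‖ ^ 2 =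
      ∑ n ∈ Finset.range h, if y = -((n + 1 : ℕ) : ZMod q) then (1 : ℝ) else 0 := by
    intro y
    have hinj : ∀ n ∈ Finset.range h, ∀ m ∈ Finset.range h,
        y = -((n + 1 : ℕ) : ZMod q) → y = -((m + 1 : ℕ) : ZMod q) → n = m := by
      intro n hn m hm h1 h2
      have h3 : ((n + 1 : ℕ) : ZMod q) = ((m + 1 : ℕ) : ZMod q) := neg_injective (h1.symm.trans h2)
      have h4 : ((n : ℕ) : ZMod q) = (m : ℕ) := by
        push_cast at h3; exact add_right_cancel h3
      rw [ZMod.natCast_eq_natCast_iff'] at h4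
      rw [Finset.mem_range] at hn hm
      rwa [Nat.mod_eq_of_lt (by omega), Nat.mod_eq_of_lt (by omega)] at h4
    rw [negIntervalIndicator]
    by_cases hy : ∃ n ∈ Finset.range h, y = -((n + 1 : ℕ) : ZMod q)
    · obtain ⟨n, hn, hyn⟩ := hy
      rw [Finset.sum_eq_single n, Finset.sum_eq_single n, if_pos hyn, if_pos hyn]
      · simp
      · exact fun m hm hmn => if_neg fun h => hmn (hinj m hm n hn h hyn)
      · exact fun h => absurd hn h
      · exact fun m hm hmn => if_neg fun h => hmn (hinj m hm n hn h hyn)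
      · exact fun h => absurd hn h
    · push Not at hy
      rw [Finset.sum_eq_zero fun n hn => if_neg (hy n hn),
        Finset.sum_eq_zero fun n hn => if_neg (hy n hn)]
      simp
  simp_rw [h1]
  rw [Finset.sum_comm]
  simp

lemma sum_norm_shortSum_sq_le {χ : DirichletCharacter ℂ q} (hχ : χ.IsPrimitive) {h : ℕ}
    (hh : h ≤ 2 * q) : ∑ x, ‖shortSum χ x h‖ ^ 2 ≤ 2 * (q * h) := by
  have hq0 : (0 : ℝ) < q := by exact_mod_cast Nat.pos_of_ne_zero (NeZero.ne q)
  have key : ∀ k ≤ q, ∑ x, ‖shortSum χ x k‖ ^ 2 ≤ q * k := by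
    intro k hk
    have h1 := sum_norm_dft_sq (fun x => shortSum χ x k)
    have h2 := sum_norm_dft_sq (negIntervalIndicator q k)
    rw [sum_norm_negIntervalIndicator_sq hk] at h2
    refine le_of_mul_le_mul_left ?_ hq0
    calc _ = ∑ a, ‖𝓕 (negIntervalIndicator q k) a‖ ^ 2 * ‖𝓕 χ a‖ ^ 2 := by
          rw [← h1]
          refine Finset.sum_congr rfl fun a _ => ?_
          rw [dft_shortSum, norm_mul, mul_pow]
      _ ≤ ∑ a, ‖𝓕 (negIntervalIndicator q k) a‖ ^ 2 * q := by
          gcongr with a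
          exact norm_dft_sq_le hχ a
      _ = _ := by rw [← Finset.sum_mul, h2, mul_comm]
  set a := h / 2
  set b := h - a with hb
  have hab : h = a + b := by omega
  calc ∑ x, ‖shortSum χ x h‖ ^ 2
      ≤ ∑ x, (2 * ‖shortSum χ x a‖ ^ 2 + 2 * ‖shortSum χ (x + a) b‖ ^ 2) := by
        gcongr with x
        rw [hab, shortSum_add]
        have h1 := norm_add_le (shortSum χ x a) (shortSum χ (x + a) b)
        have h2 := norm_nonneg (shortSum χ x a + shortSum χ (x + a) b)
        nlinarith [sq_nonneg (‖shortSum χ x a‖ - ‖shortSum χ (x + a) b‖)]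
    _ = 2 * ∑ x, ‖shortSum χ x a‖ ^ 2 + 2 * ∑ x, ‖shortSum χ x b‖ ^ 2 := by
        rw [Finset.sum_add_distrib, ← Finset.mul_sum, ← Finset.mul_sum]
        congr 2
        exact Equiv.sum_comp (Equiv.addRight (a : ZMod q)) fun x => ‖shortSum χ x b‖ ^ 2
    _ ≤ 2 * (q * a) + 2 * (q * b) := by
        gcongr <;> apply key <;> omega
    _ = 2 * (q * h) := by rw [hab]; push_cast; ring

end Plancherel

section Maximal

variable {q : ℕ} (χ : DirichletCharacter ℂ q)

/-- The maximum of the short sums starting at `x` of length at most `K`. -/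
noncomputable def maxSum (x : ZMod q) (K : ℕ) : ℝ :=
  (Finset.range (K + 1)).sup' Finset.nonempty_range_add_one fun k => ‖shortSum χ x k‖

lemma norm_shortSum_le_maxSum (x : ZMod q) {k K : ℕ} (hk : k ≤ K) :
    ‖shortSum χ x k‖ ≤ maxSum χ x K :=
  Finset.le_sup' (fun k => ‖shortSum χ x k‖) (Finset.mem_range.2 (by omega))

lemma maxSum_nonneg (x : ZMod q) (K : ℕ) : 0 ≤ maxSum χ x K :=
  (norm_nonneg _).trans (norm_shortSum_le_maxSum χ x (Nat.zero_le K))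

lemma exists_maxSum_eq (x : ZMod q) (K : ℕ) : ∃ k ≤ K, maxSum χ x K = ‖shortSum χ x k‖ := by
  obtain ⟨k, hk, h⟩ := Finset.exists_mem_eq_sup' (s := Finset.range (K + 1))
    Finset.nonempty_range_add_one fun k => ‖shortSum χ x k‖
  exact ⟨k, by rw [Finset.mem_range] at hk; omega, h⟩

lemma norm_shortSum_le_sub (x : ZMod q) {s h K : ℕ} (hK : s + h ≤ K) :
    ‖shortSum χ x h‖ ≤ 2 * maxSum χ (x - s) K := by
  have h1 := shortSum_add χ (x - s) s h
  rw [sub_add_cancel] at h1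
  have h2 : shortSum χ x h = shortSum χ (x - s) (s + h) - shortSum χ (x - s) s := by
    rw [h1]; ring
  rw [h2, two_mul]
  exact (norm_sub_le _ _).trans (add_le_add (norm_shortSum_le_maxSum χ _ hK)
    (norm_shortSum_le_maxSum χ _ (by omega)))

lemma exists_dyadic_bound (p : ℕ) (hp : p ≠ 0) (m : ℕ) : ∀ (x : ZMod q) (k : ℕ), k < 2 ^ m →
    ∃ a : ℕ → ℝ, (∀ i, 0 ≤ a i) ∧ ‖shortSum χ x k‖ ≤ ∑ i ∈ Finset.range m, a i ∧
      ∀ i ∈ Finset.range m, a i ^ p ≤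
        ∑ t ∈ Finset.range (2 ^ (m - i)), ‖shortSum χ (x + (t * 2 ^ i : ℕ)) (2 ^ i)‖ ^ p := by
  induction m with
  | zero =>
    intro x k hk
    obtain rfl : k = 0 := by simpa using hk
    exact ⟨0, fun _ => le_rfl, by simp [shortSum], by simp⟩
  | succ m ih =>
    intro x k hk
    by_cases hkm : k < 2 ^ m
    · obtain ⟨a, ha0, ha, hap⟩ := ih x k hkm
      refine ⟨fun i => if i < m then a i else 0, fun i => ?_, ?_, fun i hi => ?_⟩
      · dsimp only; split_ifs
        exacts [ha0 i, le_rfl]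
      · rw [Finset.sum_range_succ, if_neg (lt_irrefl m), add_zero]
        refine ha.trans_eq (Finset.sum_congr rfl fun i hi => ?_)
        rw [if_pos (Finset.mem_range.1 hi)]
      · dsimp only
        split_ifs with h
        · refine (hap i (Finset.mem_range.2 h)).trans ?_
          refine Finset.sum_le_sum_of_subset_of_nonneg ?_ fun _ _ _ => by positivity
          exact Finset.range_subset_range.2 (Nat.pow_le_pow_right (by norm_num) (by omega))
        · rw [zero_pow hp]
          positivity
    · push Not at hkm
      obtain ⟨k', rfl⟩ := Nat.exists_eq_add_of_le hkm
      have hk' : k' < 2 ^ m := by rw [pow_succ] at hk; omega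
      obtain ⟨a, ha0, ha, hap⟩ := ih (x + (2 ^ m : ℕ)) k' hk'
      refine ⟨fun i => if i < m then a i else ‖shortSum χ x (2 ^ m)‖, fun i => ?_, ?_,
        fun i hi => ?_⟩
      · dsimp only; split_ifs
        exacts [ha0 i, norm_nonneg _]
      · rw [Finset.sum_range_succ, if_neg (lt_irrefl m), shortSum_add, add_comm]
        refine (norm_add_le _ _).trans (add_le_add (ha.trans_eq ?_) le_rfl)
        refine Finset.sum_congr rfl fun i hi => ?_
        rw [if_pos (Finset.mem_range.1 hi)]
      · dsimp only
        split_ifs with h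
        · refine (hap i (Finset.mem_range.2 h)).trans ?_
          have h1 : 2 ^ (m + 1 - i) = 2 ^ (m - i) + 2 ^ (m - i) := by
            rw [show m + 1 - i = m - i + 1 by omega, pow_succ]; ring
          rw [h1, Finset.sum_range_add]
          refine (le_of_eq ?_).trans (le_add_of_nonneg_left (by positivity))
          refine Finset.sum_congr rfl fun t _ => ?_
          have h2 : 2 ^ m = 2 ^ (m - i) * 2 ^ i := by rw [← pow_add]; congr 1; omega
          rw [add_mul, ← h2]
          congr 3
          push_cast
          ring
        · obtain rfl : i = m := by rw [Finset.mem_range] at hi; omega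
          refine le_trans (le_of_eq ?_) (Finset.single_le_sum (fun t _ => by positivity)
            (Finset.mem_range.2 (Nat.pow_pos (by norm_num) : 0 < 2 ^ (i + 1 - i))))
          simp

lemma sum_maxSum_pow_le [NeZero q] {p K m : ℕ} (hp : p ≠ 0) (hK : K < 2 ^ m) :
    ∑ x, maxSum χ x K ^ p ≤ (m : ℝ) ^ (p - 1) *
      ∑ i ∈ Finset.range m, 2 ^ (m - i) * ∑ x, ‖shortSum χ x (2 ^ i)‖ ^ p := by
  calc ∑ x, maxSum χ x K ^ p
      ≤ ∑ x, (m : ℝ) ^ (p - 1) * ∑ i ∈ Finset.range m, ∑ t ∈ Finset.range (2 ^ (m - i)),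
        ‖shortSum χ (x + (t * 2 ^ i : ℕ)) (2 ^ i)‖ ^ p := by
        refine Finset.sum_le_sum fun x _ => ?_
        obtain ⟨k, hk, hkx⟩ := exists_maxSum_eq χ x K
        obtain ⟨a, ha0, ha, hap⟩ := exists_dyadic_bound χ p hp m x k (hk.trans_lt hK)
        rw [hkx]
        have h1 : (∑ i ∈ Finset.range m, a i) ^ p ≤
            (m : ℝ) ^ (p - 1) * ∑ i ∈ Finset.range m, a i ^ p := by
          rcases Nat.eq_zero_or_pos m with rfl | hm
          · simp [hp]
          have h2 := pow_sum_div_card_le_sum_pow (s := Finset.range m) (f := a)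
            (fun i _ => ha0 i) (p - 1)
          rw [Nat.sub_add_cancel (Nat.pos_of_ne_zero hp), Finset.card_range,
            div_le_iff₀ (by positivity)] at h2
          rwa [mul_comm]
        refine (pow_le_pow_left₀ (norm_nonneg _) ha p).trans (h1.trans ?_)
        gcongr with i hi
        exact hap i hi
    _ = (m : ℝ) ^ (p - 1) * ∑ i ∈ Finset.range m, ∑ t ∈ Finset.range (2 ^ (m - i)),
        ∑ x, ‖shortSum χ (x + (t * 2 ^ i : ℕ)) (2 ^ i)‖ ^ p := by
        rw [← Finset.mul_sum, Finset.sum_comm]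
        congr 1
        refine Finset.sum_congr rfl fun i _ => ?_
        rw [Finset.sum_comm]
    _ = _ := by
        congr 1
        refine Finset.sum_congr rfl fun i _ => ?_
        have h1 : ∀ t : ℕ, ∑ x, ‖shortSum χ (x + (t * 2 ^ i : ℕ)) (2 ^ i)‖ ^ p =
            ∑ x, ‖shortSum χ x (2 ^ i)‖ ^ p := fun t =>
          Equiv.sum_comp (Equiv.addRight ((t * 2 ^ i : ℕ) : ZMod q))
            fun x => ‖shortSum χ x (2 ^ i)‖ ^ p
        simp_rw [h1]
        simp

lemma sum_maxSum_pow_le_of_moment [NeZero q] {s K : ℕ} (hs : 0 < s) (hK : 0 < K) {a b : ℝ}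
    (ha : 0 ≤ a) (hb : 0 ≤ b)
    (hmom : ∀ h ≤ K, ∑ x, ‖shortSum χ x h‖ ^ (2 * s) ≤ a * h ^ (2 * s) + b * h ^ s) :
    ∑ x, maxSum χ x K ^ (2 * s) ≤ ((Nat.log 2 K + 1 : ℕ) : ℝ) ^ (2 * s) * 4 ^ s *
      (a * K ^ (2 * s) + b * K ^ s) := by
  set m := Nat.log 2 K + 1 with hm
  have hmK : 2 ^ m ≤ 2 * K := by
    rw [hm, pow_succ, mul_comm]
    exact Nat.mul_le_mul_left 2 (Nat.pow_log_le_self 2 hK.ne')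
  have hmK' : (2 : ℝ) ^ m ≤ 2 * K := by exact_mod_cast hmK
  refine (sum_maxSum_pow_le χ (by omega) (Nat.lt_pow_succ_log_self (by norm_num) K)).trans ?_
  rw [Nat.succ_eq_add_one, ← hm]
  have hterm : ∀ i ∈ Finset.range m, 2 ^ (m - i) * ∑ x, ‖shortSum χ x (2 ^ i)‖ ^ (2 * s) ≤
      4 ^ s * (a * K ^ (2 * s) + b * K ^ s) := by
    intro i hi
    rw [Finset.mem_range] at hi
    have hiK : 2 ^ i ≤ K := by
      have : 2 ^ (i + 1) ≤ 2 ^ m := Nat.pow_le_pow_right (by norm_num) hi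
      rw [pow_succ] at this; omega
    have h1 := hmom _ hiK
    have h2 : ∀ t, 1 ≤ t → (2 : ℝ) ^ (m - i) * ((2 ^ i : ℕ) : ℝ) ^ t ≤ (2 * K) ^ t := by
      intro t ht
      push_cast
      calc (2 : ℝ) ^ (m - i) * (2 ^ i) ^ t ≤ (2 ^ (m - i)) ^ t * (2 ^ i) ^ t := by
            gcongr
            exact le_self_pow₀ (one_le_pow₀ (by norm_num)) (by omega)
        _ = (2 ^ m) ^ t := by
            rw [← mul_pow, ← pow_add, Nat.sub_add_cancel hi.le]
        _ ≤ _ := by gcongr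
    calc _ ≤ 2 ^ (m - i) * (a * (2 ^ i : ℕ) ^ (2 * s) + b * (2 ^ i : ℕ) ^ s) := by gcongr
      _ = a * (2 ^ (m - i) * (2 ^ i : ℕ) ^ (2 * s)) + b * (2 ^ (m - i) * (2 ^ i : ℕ) ^ s) := by
          ring
      _ ≤ a * (2 * K) ^ (2 * s) + b * (2 * K) ^ s := by
          gcongr
          · exact h2 _ (by omega)
          · exact h2 _ hs
      _ = 4 ^ s * (a * K ^ (2 * s)) + 2 ^ s * (b * K ^ s) := by
          rw [mul_pow, mul_pow, pow_mul 2]; norm_num; ring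
      _ ≤ 4 ^ s * (a * K ^ (2 * s)) + 4 ^ s * (b * K ^ s) := by
          gcongr; norm_num
      _ = _ := by ring
  calc _ ≤ (m : ℝ) ^ (2 * s - 1) * ∑ i ∈ Finset.range m, 4 ^ s * (a * K ^ (2 * s) + b * K ^ s) := by
        exact mul_le_mul_of_nonneg_left (Finset.sum_le_sum hterm) (by positivity)
    _ = (m : ℝ) ^ (2 * s - 1 + 1) * 4 ^ s * (a * K ^ (2 * s) + b * K ^ s) := by
        rw [Finset.sum_const, Finset.card_range, nsmul_eq_mul]; ring
    _ = _ := by rw [Nat.sub_add_cancel (by omega)]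

lemma exists_log_pow_le (t : ℕ) {ε : ℝ} (hε : 0 < ε) :
    ∃ D : ℝ, 1 ≤ D ∧ ∀ q K : ℕ, 0 < q → K ≤ 4 * q →
      ((Nat.log 2 K + 1 : ℕ) : ℝ) ^ t ≤ D * (q : ℝ) ^ ε := by
  set δ := ε / (t + 1) with hδ
  have hδ0 : 0 < δ := by positivity
  have hl2 : 0 < Real.log 2 := Real.log_pos (by norm_num)
  refine ⟨max 1 ((8 ^ δ / δ / Real.log 2) ^ t), le_max_left _ _, fun q K hq hK => ?_⟩
  have hq1 : (1 : ℝ) ≤ q := by exact_mod_cast hq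
  have h1 : (2 : ℝ) ^ (Nat.log 2 K + 1) ≤ 8 * q := by
    have : 2 ^ Nat.log 2 K ≤ 4 * q := by
      rcases Nat.eq_zero_or_pos K with rfl | hK0
      · simp; omega
      · exact (Nat.pow_log_le_self 2 hK0.ne').trans hK
    rw [pow_succ]
    have h2 : (2 : ℝ) ^ Nat.log 2 K ≤ 4 * q := by exact_mod_cast this
    linarith
  have h2 : ((Nat.log 2 K + 1 : ℕ) : ℝ) ≤ 8 ^ δ / δ / Real.log 2 * (q : ℝ) ^ δ := by
    have h3 := Real.log_le_log (by positivity) h1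
    rw [Real.log_pow] at h3
    have h4 := Real.log_le_rpow_div (x := 8 * q) (by positivity) hδ0
    rw [Real.mul_rpow (by norm_num) (by positivity)] at h4
    rw [div_mul_eq_mul_div, le_div_iff₀ hl2]
    exact h3.trans (h4.trans_eq (by ring))
  calc _ ≤ (8 ^ δ / δ / Real.log 2 * (q : ℝ) ^ δ) ^ t := by gcongr
    _ = (8 ^ δ / δ / Real.log 2) ^ t * (q : ℝ) ^ (δ * t) := by
        rw [mul_pow, ← Real.rpow_natCast ((q : ℝ) ^ δ), ← Real.rpow_mul (by positivity)]
    _ ≤ _ := by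
        gcongr
        · exact le_max_right _ _
        · rw [hδ, div_mul_eq_mul_div, div_le_iff₀ (by positivity)]
          nlinarith

/-- The even moments of the maximal short sums. -/
theorem exists_moment_maxSum_le (r : ℕ) (hr : 0 < r) {ε : ℝ} (hε : 0 < ε) :
    ∃ C : ℝ, 1 ≤ C ∧ ∀ (q : ℕ) [NeZero q], (∀ p : ℕ, p.Prime → ¬ p ^ 3 ∣ q) →
      ∀ χ : DirichletCharacter ℂ q, IsLocallyPrimitive χ → ∀ K : ℕ, 0 < K → K ≤ 4 * q →
        ∑ x, maxSum χ x K ^ (2 * r) ≤ C * (q : ℝ) ^ ε * (√q * K ^ (2 * r) + q * K ^ r) := by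
  obtain ⟨C, hC, hmom⟩ := exists_moment_shortSum_le r hr (half_pos hε)
  obtain ⟨D, hD, hlog⟩ := exists_log_pow_le (2 * r) (half_pos hε)
  refine ⟨D * 4 ^ r * C, ?_, fun q _ hq χ hχ K hK hKq => ?_⟩
  · exact one_le_mul_of_one_le_of_one_le (one_le_mul_of_one_le_of_one_le hD
      (one_le_pow₀ (by norm_num))) hC
  have hq0 : 0 < q := Nat.pos_of_ne_zero (NeZero.ne q)
  have h1 := sum_maxSum_pow_le_of_moment χ (a := C * (q : ℝ) ^ (ε / 2) * √q)
    (b := C * (q : ℝ) ^ (ε / 2) * q) hr hK (by positivity) (by positivity)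
    (fun h _ => (hmom q hq χ hχ h).trans_eq (by ring))
  refine h1.trans ?_
  calc _ ≤ D * (q : ℝ) ^ (ε / 2) * 4 ^ r * (C * (q : ℝ) ^ (ε / 2) * √q * K ^ (2 * r) +
        C * (q : ℝ) ^ (ε / 2) * q * K ^ r) := by
        gcongr
        exact hlog q K hq0 hKq
    _ = D * 4 ^ r * C * ((q : ℝ) ^ (ε / 2) * (q : ℝ) ^ (ε / 2)) *
        (√q * K ^ (2 * r) + q * K ^ r) := by ring
    _ = _ := by
        rw [← Real.rpow_add (by positivity), add_halves]

/-- The mean square of the maximal short sums. -/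
theorem exists_meanSquare_maxSum_le {ε : ℝ} (hε : 0 < ε) :
    ∃ C : ℝ, 1 ≤ C ∧ ∀ (q : ℕ) [NeZero q] (χ : DirichletCharacter ℂ q), χ.IsPrimitive →
      ∀ K : ℕ, 0 < K → K ≤ 2 * q → ∑ x, maxSum χ x K ^ 2 ≤ C * (q : ℝ) ^ ε * (q * K) := by
  obtain ⟨D, hD, hlog⟩ := exists_log_pow_le 2 hε
  refine ⟨D * 8, by linarith, fun q _ χ hχ K hK hKq => ?_⟩
  have hq0 : 0 < q := Nat.pos_of_ne_zero (NeZero.ne q)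
  have h1 := sum_maxSum_pow_le_of_moment χ (s := 1) (a := 0) (b := 2 * q) one_pos hK le_rfl
    (by positivity) (fun h hh => (sum_norm_shortSum_sq_le hχ (hh.trans hKq)).trans_eq (by ring))
  rw [mul_one] at h1
  refine h1.trans ?_
  calc _ ≤ D * (q : ℝ) ^ ε * 4 ^ 1 * (0 * K ^ 2 + 2 * q * K ^ 1) := by
        gcongr
        exact hlog q K hq0 (by omega)
    _ = _ := by ring

end Maximal

section Spacing

variable {q : ℕ}

lemma sum_range_natCast_zmod [NeZero q] {M : Type*} [AddCommMonoid M] (f : ZMod q → M) :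
    ∑ n ∈ Finset.range q, f n = ∑ x, f x := by
  refine Finset.sum_nbij' (fun n => (n : ZMod q)) ZMod.val (by simp)
    (fun x _ => Finset.mem_range.2 (ZMod.val_lt x)) (fun n hn => ?_) (fun x _ => ?_)
    fun _ _ => rfl
  · exact ZMod.val_cast_of_lt (Finset.mem_range.1 hn)
  · exact ZMod.natCast_zmod_val x

/-- A set of residue representatives whose gaps are at least `H`. -/
def IsSpaced (q H : ℕ) (A : Finset ℕ) : Prop :=
  (∀ a ∈ A, a < q) ∧ ∀ a ∈ A, ∀ b ∈ A, a < b → a + H ≤ b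

lemma IsSpaced.mono {H : ℕ} {A B : Finset ℕ} (hA : IsSpaced q H A) (h : B ⊆ A) :
    IsSpaced q H B :=
  ⟨fun a ha => hA.1 a (h ha), fun a ha b hb => hA.2 a (h ha) b (h hb)⟩

lemma IsSpaced.sum_le [NeZero q] {H : ℕ} {A : Finset ℕ} (hA : IsSpaced q H A) (hH : H ≤ q)
    {f : ZMod q → ℝ} (hf : ∀ x, 0 ≤ f x) :
    ∑ a ∈ A, ∑ s ∈ Finset.range H, f ((a : ZMod q) - s) ≤ 2 * ∑ x, f x := by
  have hinj : Set.InjOn (fun z : ℕ × ℕ => z.1 + q - z.2)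
      (A ×ˢ Finset.range H : Finset (ℕ × ℕ)) := by
    rintro ⟨a, s⟩ h1 ⟨b, t⟩ h2 h
    simp only [Finset.coe_product, Set.mem_prod, Finset.mem_coe, Finset.mem_range] at h1 h2 h
    have h3 := hA.2 a h1.1 b h2.1
    have h4 := hA.2 b h2.1 a h1.1
    rw [Prod.mk.injEq]
    rcases lt_trichotomy a b with hab | hab | hab
    · have := h3 hab; omega
    · exact ⟨hab, by omega⟩
    · have := h4 hab; omega
  rw [← Finset.sum_product']
  calc _ = ∑ z ∈ A ×ˢ Finset.range H, f ((z.1 + q - z.2 : ℕ) : ZMod q) := by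
        refine Finset.sum_congr rfl fun z hz => ?_
        rw [Finset.mem_product, Finset.mem_range] at hz
        rw [Nat.cast_sub (by omega), Nat.cast_add, ZMod.natCast_self, add_zero]
    _ = ∑ n ∈ (A ×ˢ Finset.range H).image fun z : ℕ × ℕ => z.1 + q - z.2, f (n : ZMod q) := by
        rw [Finset.sum_image hinj]
    _ ≤ ∑ n ∈ Finset.range (q + q), f (n : ZMod q) := by
        refine Finset.sum_le_sum_of_subset_of_nonneg (fun n hn => ?_) fun _ _ _ => hf _
        obtain ⟨z, hz, rfl⟩ := Finset.mem_image.1 hn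
        rw [Finset.mem_product] at hz
        have := hA.1 _ hz.1
        rw [Finset.mem_range]
        omega
    _ = _ := by
        rw [Finset.sum_range_add]
        simp only [Nat.cast_add, ZMod.natCast_self, zero_add]
        rw [sum_range_natCast_zmod, two_mul]

lemma IsSpaced.sum_maxSum_sq_le [NeZero q] (χ : DirichletCharacter ℂ q) {H : ℕ} {A : Finset ℕ}
    (hA : IsSpaced q H A) (hH : H ≤ q) :
    H * ∑ a ∈ A, maxSum χ a H ^ 2 ≤ 8 * ∑ x, maxSum χ x (2 * H) ^ 2 := by
  have h1 : ∀ a ∈ A, H * maxSum χ a H ^ 2 ≤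
      ∑ s ∈ Finset.range H, 4 * maxSum χ ((a : ZMod q) - s) (2 * H) ^ 2 := by
    intro a _
    obtain ⟨k, hk, hka⟩ := exists_maxSum_eq χ (a : ZMod q) H
    have h2 := Finset.card_nsmul_le_sum (Finset.range H)
      (fun s : ℕ => 4 * maxSum χ ((a : ZMod q) - s) (2 * H) ^ 2) (maxSum χ a H ^ 2) fun s hs => by
        rw [Finset.mem_range] at hs
        have := norm_shortSum_le_sub χ (a : ZMod q) (s := s) (h := k) (K := 2 * H) (by omega)
        rw [hka]
        calc _ ≤ (2 * maxSum χ ((a : ZMod q) - s) (2 * H)) ^ 2 := by gcongr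
          _ = _ := by ring
    rwa [Finset.card_range, nsmul_eq_mul] at h2
  rw [Finset.mul_sum]
  refine (Finset.sum_le_sum h1).trans ((hA.sum_le hH
    (f := fun x => 4 * maxSum χ x (2 * H) ^ 2) fun _ => by positivity).trans_eq ?_)
  rw [← Finset.mul_sum]
  ring

/-- The mean square of maximal short sums at spaced points. -/
theorem exists_spaced_meanSquare_le {ε : ℝ} (hε : 0 < ε) :
    ∃ C : ℝ, 1 ≤ C ∧ ∀ (q : ℕ) [NeZero q] (χ : DirichletCharacter ℂ q), χ.IsPrimitive →
      ∀ H : ℕ, 0 < H → H ≤ q → ∀ A : Finset ℕ, IsSpaced q H A →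
        ∑ a ∈ A, maxSum χ a H ^ 2 ≤ C * (q : ℝ) ^ ε * q := by
  obtain ⟨C, hC, hmean⟩ := exists_meanSquare_maxSum_le hε
  refine ⟨16 * C, by linarith, fun q _ χ hχ H hH hHq A hA => ?_⟩
  have h1 := hA.sum_maxSum_sq_le χ hHq
  have h2 := hmean q χ hχ (2 * H) (by omega) (by omega)
  have hH' : (0 : ℝ) < H := by exact_mod_cast hH
  refine le_of_mul_le_mul_left (h1.trans ?_) hH'
  push_cast at h2
  linarith

lemma sum_Ioc_eq_shortSum (χ : DirichletCharacter ℂ q) (N h : ℕ) :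
    ∑ n ∈ Finset.Ioc N (N + h), χ (n : ZMod q) = shortSum χ N h := by
  rw [shortSum]
  symm
  refine Finset.sum_nbij' (fun n => N + (n + 1)) (fun n => n - N - 1) ?_ ?_ ?_ ?_ ?_
  all_goals simp only [Finset.mem_range, Finset.mem_Ioc]
  any_goals intros; omega
  intros
  push_cast
  rfl

end Spacing

section Amplification

variable {q : ℕ}

lemma sum_range_mul_eq {M : Type*} [AddCommMonoid M] (f : ℕ → M) (p B : ℕ) :
    ∑ n ∈ Finset.range (p * B), f n =
      ∑ c ∈ Finset.range p, ∑ i ∈ Finset.range B, f (c + p * i) := by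
  rw [Finset.sum_comm]
  induction B with
  | zero => simp
  | succ B ih =>
    rw [mul_add_one, Finset.sum_range_add, Finset.sum_range_succ, ih]
    simp_rw [add_comm]

lemma sum_range_eq_sum_residues {M : Type*} [AddCommMonoid M] (f : ℕ → M) {p B h : ℕ}
    (hp : 0 < p) (hh : h ≤ p * B) :
    ∑ n ∈ Finset.range h, f n =
      ∑ c ∈ Finset.range p, ∑ i ∈ Finset.range ((h + (p - 1 - c)) / p), f (c + p * i) := by
  have h1 : ∑ n ∈ Finset.range h, f n =
      ∑ n ∈ Finset.range (p * B), if n < h then f n else 0 := by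
    rw [← Finset.sum_filter]
    congr 1
    ext n
    simp only [Finset.mem_filter, Finset.mem_range]
    omega
  rw [h1, sum_range_mul_eq]
  refine Finset.sum_congr rfl fun c hc => ?_
  rw [Finset.mem_range] at hc
  rw [← Finset.sum_filter]
  congr 1
  ext i
  simp only [Finset.mem_filter, Finset.mem_range]
  have h2 : c + p * i < h ↔ i < (h + (p - 1 - c)) / p := by
    rw [← Nat.add_one_le_iff (n := i), Nat.le_div_iff_mul_le hp, add_mul, one_mul, mul_comm i p]
    omega
  rw [← h2, and_iff_right_iff_imp]
  intro h3
  exact Nat.lt_of_mul_lt_mul_left (lt_of_le_of_lt (Nat.le_add_left _ _) (h3.trans_le hh))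

lemma shortSum_eq_sum_residues (χ : DirichletCharacter ℂ q) {p B h : ℕ} (hp : 0 < p)
    (hpq : p.Coprime q) (hh : h ≤ p * B) (x : ZMod q) :
    shortSum χ x h = χ p * ∑ c ∈ Finset.range p,
      shortSum χ ((p : ZMod q)⁻¹ * (x - (p - 1 - c : ℕ))) ((h + (p - 1 - c)) / p) := by
  rw [shortSum, sum_range_eq_sum_residues _ hp hh, Finset.mul_sum]
  refine Finset.sum_congr rfl fun c hc => ?_
  rw [Finset.mem_range] at hc
  rw [shortSum, Finset.mul_sum]
  refine Finset.sum_congr rfl fun i _ => ?_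
  rw [← map_mul]
  congr 1
  rw [mul_add, ← mul_assoc, ZMod.coe_mul_inv_eq_one p hpq, one_mul]
  have h1 : (p : ZMod q) = (p - 1 - c : ℕ) + c + 1 := by
    have : p = (p - 1 - c) + c + 1 := by omega
    exact_mod_cast congrArg (Nat.cast : ℕ → ZMod q) this
  push_cast
  linear_combination -h1

lemma mul_norm_shortSum_le (χ : DirichletCharacter ℂ q) {p B h : ℕ} (hp : 0 < p)
    (hpq : p.Coprime q) (hh : h ≤ p * B) (x : ZMod q) :
    B * ‖shortSum χ x h‖ ≤
      2 * ∑ s ∈ Finset.range (p * B), maxSum χ ((p : ZMod q)⁻¹ * (x - s)) (2 * B) := by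
  rw [shortSum_eq_sum_residues χ hp hpq hh, norm_mul, sum_range_mul_eq]
  set y : ℕ → ZMod q := fun c => (p : ZMod q)⁻¹ * (x - c) with hy
  have h1 : ∀ c ∈ Finset.range p, B * ‖shortSum χ (y c) ((h + c) / p)‖ ≤
      2 * ∑ i ∈ Finset.range B, maxSum χ ((p : ZMod q)⁻¹ * (x - (c + p * i : ℕ))) (2 * B) := by
    intro c hc
    rw [Finset.mem_range] at hc
    have hk : (h + c) / p ≤ B := by
      rw [← Nat.lt_add_one_iff, Nat.div_lt_iff_lt_mul hp, add_mul, mul_comm B]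
      omega
    have h2 := Finset.card_nsmul_le_sum (Finset.range B)
      (fun i : ℕ => 2 * maxSum χ ((p : ZMod q)⁻¹ * (x - (c + p * i : ℕ))) (2 * B))
      ‖shortSum χ (y c) ((h + c) / p)‖ fun i hi => by
        rw [Finset.mem_range] at hi
        have h3 := norm_shortSum_le_sub χ (y c) (s := i) (h := (h + c) / p) (K := 2 * B) (by omega)
        have h4 : (p : ZMod q)⁻¹ * (x - (c + p * i : ℕ)) = y c - i := by
          rw [hy]
          push_cast
          linear_combination (-(i : ZMod q)) * ZMod.coe_mul_inv_eq_one p hpq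
        rwa [h4]
    rwa [Finset.card_range, nsmul_eq_mul, ← Finset.mul_sum] at h2
  have h4 : ‖∑ c ∈ Finset.range p, shortSum χ ((p : ZMod q)⁻¹ * (x - (p - 1 - c : ℕ)))
      ((h + (p - 1 - c)) / p)‖ ≤ ∑ c ∈ Finset.range p, ‖shortSum χ (y c) ((h + c) / p)‖ := by
    refine (norm_sum_le _ _).trans_eq ?_
    exact Finset.sum_range_reflect (fun c => ‖shortSum χ (y c) ((h + c) / p)‖) p
  calc _ ≤ B * (1 * ∑ c ∈ Finset.range p, ‖shortSum χ (y c) ((h + c) / p)‖) := by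
        gcongr
        exact χ.norm_le_one _
    _ ≤ _ := by
        rw [one_mul, Finset.mul_sum, Finset.mul_sum]
        exact Finset.sum_le_sum h1

lemma mul_maxSum_le (χ : DirichletCharacter ℂ q) {p B H L : ℕ} (hp : 0 < p)
    (hpq : p.Coprime q) (hH : H ≤ p * B) (hL : p * B ≤ L) (x : ZMod q) :
    B * maxSum χ x H ≤
      2 * ∑ s ∈ Finset.range L, maxSum χ ((p : ZMod q)⁻¹ * (x - s)) (2 * B) := by
  obtain ⟨k, hk, hkx⟩ := exists_maxSum_eq χ x H
  rw [hkx]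
  refine (mul_norm_shortSum_le χ hp hpq (hk.trans hH) x).trans ?_
  gcongr
  exact fun _ _ _ => maxSum_nonneg χ _ _

/-- The number of representations `p * v = a - s` with `p ∈ P`, `a ∈ A`, `s < L`. -/
noncomputable def dilationCount (P A : Finset ℕ) (L : ℕ) (v : ZMod q) : ℝ :=
  ∑ p ∈ P, ∑ a ∈ A, ((Finset.range L).filter fun s : ℕ => (p : ZMod q)⁻¹ * (a - s) = v).card

lemma dilationCount_nonneg (P A : Finset ℕ) (L : ℕ) (v : ZMod q) : 0 ≤ dilationCount P A L v := by
  rw [dilationCount]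
  positivity

lemma sum_dilationCount_mul [NeZero q] (P A : Finset ℕ) (L : ℕ) (f : ZMod q → ℝ) :
    ∑ v, dilationCount P A L v * f v =
      ∑ p ∈ P, ∑ a ∈ A, ∑ s ∈ Finset.range L, f ((p : ZMod q)⁻¹ * (a - s)) := by
  simp_rw [dilationCount, Finset.sum_mul]
  rw [Finset.sum_comm]
  refine Finset.sum_congr rfl fun p _ => ?_
  rw [Finset.sum_comm]
  refine Finset.sum_congr rfl fun a _ => ?_
  simp_rw [Finset.card_filter, Nat.cast_sum, Finset.sum_mul]
  rw [Finset.sum_comm]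
  refine Finset.sum_congr rfl fun s _ => ?_
  simp

lemma sum_dilationCount [NeZero q] (P A : Finset ℕ) (L : ℕ) :
    ∑ v : ZMod q, dilationCount P A L v = P.card * A.card * L := by
  have := sum_dilationCount_mul (q := q) P A L fun _ => 1
  simp only [mul_one, Finset.sum_const, Finset.card_range, nsmul_eq_mul] at this
  rw [this, mul_assoc]

/-- Amplification of large values of maximal sums by dilations. -/
lemma le_sum_dilationCount_mul [NeZero q] (χ : DirichletCharacter ℂ q) {P A : Finset ℕ}
    {B H L : ℕ} {V : ℝ} (hP : ∀ p ∈ P, 0 < p ∧ p.Coprime q ∧ H ≤ p * B ∧ p * B ≤ L)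
    (hA : ∀ a ∈ A, V ≤ maxSum χ a H) :
    V * B * (P.card * A.card) ≤ 2 * ∑ v, dilationCount P A L v * maxSum χ v (2 * B) := by
  rw [sum_dilationCount_mul, Finset.mul_sum]
  have h1 := Finset.card_nsmul_le_sum P (fun p => 2 * ∑ a ∈ A, ∑ s ∈ Finset.range L,
    maxSum χ ((p : ZMod q)⁻¹ * (a - s)) (2 * B)) (A.card * (V * B)) fun p hp => by
      obtain ⟨hp0, hpq, hH, hL⟩ := hP p hp
      rw [Finset.mul_sum, ← nsmul_eq_mul]
      refine Finset.card_nsmul_le_sum A _ _ fun a ha => ?_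
      refine le_trans ?_ (mul_maxSum_le χ hp0 hpq hH hL a)
      rw [mul_comm]
      exact mul_le_mul_of_nonneg_left (hA a ha) (by positivity)
  rw [nsmul_eq_mul] at h1
  linarith

/-- Hölder's inequality for three factors with exponents `2r`. -/
lemma sum_mul_pow_le {ι : Type*} (s : Finset ι) {w f : ι → ℝ} (hw : ∀ i, 0 ≤ w i)
    (hf : ∀ i, 0 ≤ f i) {r : ℕ} (hr : 0 < r) :
    (∑ i ∈ s, w i * f i) ^ (2 * r) ≤
      (∑ i ∈ s, w i) ^ (2 * r - 2) * (∑ i ∈ s, w i ^ 2) * ∑ i ∈ s, f i ^ (2 * r) := by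
  obtain ⟨k, rfl⟩ := Nat.exists_eq_add_of_le' hr
  set W := ∑ i ∈ s, w i with hW
  have hW0 : 0 ≤ W := Finset.sum_nonneg fun i _ => hw i
  have h1 : (∑ i ∈ s, w i * f i) ^ (k + 1) ≤ W ^ k * ∑ i ∈ s, w i * f i ^ (k + 1) := by
    rcases hW0.eq_or_lt with h0 | h0
    · have h2 : ∀ i ∈ s, w i = 0 := (Finset.sum_eq_zero_iff_of_nonneg fun i _ => hw i).1 h0.symm
      rw [Finset.sum_eq_zero fun i hi => by rw [h2 i hi, zero_mul], zero_pow (by omega)]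
      have : 0 ≤ ∑ i ∈ s, w i * f i ^ (k + 1) :=
        Finset.sum_nonneg fun i _ => mul_nonneg (hw i) (pow_nonneg (hf i) _)
      positivity
    · have h2 := Real.pow_arith_mean_le_arith_mean_pow s (fun i => w i / W) f
        (fun i _ => div_nonneg (hw i) hW0) (by rw [← Finset.sum_div, div_self h0.ne'])
        (fun i _ => hf i) (k + 1)
      simp_rw [div_mul_eq_mul_div] at h2
      rw [← Finset.sum_div, ← Finset.sum_div, div_pow, div_le_div_iff₀ (by positivity) h0] at h2
      refine le_of_mul_le_mul_right (h2.trans_eq ?_) h0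
      ring
  have h3 := Finset.sum_mul_sq_le_sq_mul_sq s w fun i => f i ^ (k + 1)
  simp_rw [← pow_mul] at h3
  have h5 : 0 ≤ ∑ i ∈ s, w i * f i := Finset.sum_nonneg fun i _ => mul_nonneg (hw i) (hf i)
  calc (∑ i ∈ s, w i * f i) ^ (2 * (k + 1)) = ((∑ i ∈ s, w i * f i) ^ (k + 1)) ^ 2 := by
        rw [← pow_mul, mul_comm]
    _ ≤ (W ^ k * ∑ i ∈ s, w i * f i ^ (k + 1)) ^ 2 := by gcongr
    _ = W ^ (2 * (k + 1) - 2) * (∑ i ∈ s, w i * f i ^ (k + 1)) ^ 2 := by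
        rw [mul_pow, ← pow_mul, show 2 * (k + 1) - 2 = k * 2 by omega]
    _ ≤ W ^ (2 * (k + 1) - 2) * ((∑ i ∈ s, w i ^ 2) * ∑ i ∈ s, f i ^ ((k + 1) * 2)) := by gcongr
    _ = _ := by rw [mul_assoc, mul_comm (k + 1) 2]

end Amplification

section Dispersion

open ZMod

variable {q : ℕ} [NeZero q]

lemma half_le_norm_sum_stdAddChar {D : ℕ} {z : ℤ} (hz : ∀ m < D, 6 * (m * z.natAbs) ≤ q) :
    (D : ℝ) / 2 ≤ ‖∑ m ∈ Finset.range D, stdAddChar ((m : ZMod q) * (z : ZMod q))‖ := by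
  refine le_trans ?_ (Complex.re_le_norm _)
  rw [Complex.re_sum]
  have h1 := Finset.card_nsmul_le_sum (Finset.range D)
    (fun m : ℕ => (stdAddChar ((m : ZMod q) * (z : ZMod q))).re) (1 / 2) fun m hm => ?_
  · rw [Finset.card_range, nsmul_eq_mul] at h1
    linarith
  have h2 := hz m (Finset.mem_range.1 hm)
  have hq : (0 : ℝ) < q := by exact_mod_cast Nat.pos_of_ne_zero (NeZero.ne q)
  have h3 : stdAddChar ((m : ZMod q) * (z : ZMod q)) =
      stdAddChar ((m * z : ℤ) : ZMod q) := by push_cast; rfl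
  have h4 : (2 * Real.pi * Complex.I * ((m * z : ℤ) : ℂ) / q) =
      ((2 * Real.pi * (m * z) / q : ℝ) : ℂ) * Complex.I := by push_cast; ring
  rw [h3, stdAddChar_coe, h4, Complex.exp_ofReal_mul_I_re, ← Real.cos_abs, ← Real.cos_pi_div_three]
  refine Real.cos_le_cos_of_nonneg_of_le_pi (abs_nonneg _) (by linarith [Real.pi_pos]) ?_
  have h5 : 6 * ((m : ℝ) * |(z : ℝ)|) ≤ q := by
    have : ((z.natAbs : ℕ) : ℝ) = |(z : ℝ)| := by rw [Nat.cast_natAbs, Int.cast_abs]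
    rw [← this]
    exact_mod_cast h2
  rw [abs_div, abs_mul, abs_mul (m : ℝ), abs_of_pos (by positivity : (0 : ℝ) < 2 * Real.pi),
    abs_of_pos hq, Nat.abs_cast, div_le_div_iff₀ hq (by norm_num)]
  nlinarith [Real.pi_pos]

/-- A large sieve inequality for spaced points and frequencies in a short interval. -/
lemma IsSpaced.sum_norm_sq_le {H : ℕ} {A : Finset ℕ} (hA : IsSpaced q H A) (hH0 : 0 < H)
    (hH : H ≤ q) {d m : ℕ} (hd : 6 * (H * d) ≤ q) (hm : m ≤ d) :
    H * ∑ k ∈ Finset.range (d + 1),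
        ‖∑ a ∈ A, stdAddChar (((m : ZMod q) - (k : ZMod q)) * (a : ZMod q))‖ ^ 2 ≤
      8 * q * A.card := by
  set μ : ZMod q → ℝ := fun y => ∑ a ∈ A, ∑ s ∈ Finset.range H,
      if (a : ZMod q) - s = y then 1 else 0
    with hμ
  have hμ0 : ∀ y, 0 ≤ μ y := fun y => by
    refine Finset.sum_nonneg fun _ _ => Finset.sum_nonneg fun _ _ => ?_
    split_ifs <;> norm_num
  have hμ2 : ∀ y, μ y ≤ 2 := fun y => by
    have := hA.sum_le hH (f := fun x => if x = y then 1 else 0) fun x => by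
      split_ifs <;> norm_num
    rwa [Finset.sum_ite_eq' Finset.univ y, if_pos (Finset.mem_univ _), mul_one] at this
  have hμs : ∑ y, μ y = A.card * H := by
    simp_rw [hμ]
    rw [Finset.sum_comm]
    simp_rw [fun a : ℕ => Finset.sum_comm (s := (Finset.univ : Finset (ZMod q)))
      (t := Finset.range H) (f := fun y s => if (a : ZMod q) - s = y then (1 : ℝ) else 0)]
    simp
  have hμsq : ∑ y, μ y ^ 2 ≤ 2 * (A.card * H) := by
    rw [← hμs, Finset.mul_sum]
    refine Finset.sum_le_sum fun y _ => ?_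
    nlinarith [hμ0 y, hμ2 y]
  have hdft : ∀ k : ZMod q, 𝓕 (fun y => (μ y : ℂ)) (-k) =
      (∑ a ∈ A, stdAddChar (k * (a : ZMod q))) *
          ∑ s ∈ Finset.range H, stdAddChar ((s : ZMod q) * -k) := by
    intro k
    rw [dft_apply, Finset.sum_mul_sum]
    simp_rw [hμ, Complex.ofReal_sum, Finset.smul_sum]
    rw [Finset.sum_comm]
    refine Finset.sum_congr rfl fun a _ => ?_
    rw [Finset.sum_comm]
    refine Finset.sum_congr rfl fun s _ => ?_
    rw [Finset.sum_eq_single ((a : ZMod q) - s) (fun y _ hy => by rw [if_neg hy.symm]; simp)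
      (by simp), if_pos rfl, Complex.ofReal_one, smul_eq_mul, mul_one, ← AddChar.map_add_eq_mul]
    congr 1
    ring
  have hq0 : 0 < q := Nat.pos_of_ne_zero (NeZero.ne q)
  have hHd : d ≤ H * d := Nat.le_mul_of_pos_left d hH0
  have hterm : ∀ k ∈ Finset.range (d + 1),
      (H : ℝ) ^ 2 * ‖∑ a ∈ A, stdAddChar (((m : ZMod q) - (k : ZMod q)) * (a : ZMod q))‖ ^ 2 ≤
        4 * ‖𝓕 (fun y => (μ y : ℂ)) (k - m)‖ ^ 2 := by
    intro k hk
    rw [Finset.mem_range] at hk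
    have h1 := half_le_norm_sum_stdAddChar (q := q) (D := H) (z := (k : ℤ) - m) fun s hs => by
      have h2 : ((k : ℤ) - m).natAbs ≤ d := by omega
      exact (Nat.mul_le_mul_left 6 (Nat.mul_le_mul hs.le h2)).trans hd
    have h3 : (k : ZMod q) - m = -((m : ZMod q) - (k : ZMod q)) := by ring
    rw [h3, hdft, norm_mul, mul_pow]
    push_cast at h1
    rw [h3] at h1
    have h4 : (H : ℝ) ^ 2 ≤
        4 * ‖∑ s ∈ Finset.range H,
            stdAddChar ((s : ZMod q) * -((m : ZMod q) - (k : ZMod q)))‖ ^ 2 := by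
      calc (H : ℝ) ^ 2 = 4 * ((H : ℝ) / 2) ^ 2 := by ring
        _ ≤ _ := by gcongr
    calc _ ≤ (4 * ‖∑ s ∈ Finset.range H,
        stdAddChar ((s : ZMod q) * -((m : ZMod q) - (k : ZMod q)))‖ ^ 2) *
          ‖∑ a ∈ A, stdAddChar (((m : ZMod q) - (k : ZMod q)) * (a : ZMod q))‖ ^ 2 := by gcongr
      _ = _ := by ring
  have hinj : Set.InjOn (fun k : ℕ => (k : ZMod q) - m) (Finset.range (d + 1)) := by
    intro k hk l hl hkl
    rw [Finset.mem_coe, Finset.mem_range] at hk hl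
    have h1 : (k : ZMod q) = l := sub_left_injective hkl
    have h2 := congrArg ZMod.val h1
    rwa [ZMod.val_cast_of_lt (by omega), ZMod.val_cast_of_lt (by omega)] at h2
  have hsum : (H : ℝ) ^ 2 *
      ∑ k ∈ Finset.range (d + 1),
          ‖∑ a ∈ A, stdAddChar (((m : ZMod q) - (k : ZMod q)) * (a : ZMod q))‖ ^ 2 ≤
        8 * q * (A.card * H) := by
    rw [Finset.mul_sum]
    calc _ ≤ ∑ k ∈ Finset.range (d + 1), 4 * ‖𝓕 (fun y => (μ y : ℂ)) (k - m)‖ ^ 2 :=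
          Finset.sum_le_sum hterm
      _ = 4 * ∑ x ∈ (Finset.range (d + 1)).image fun k : ℕ => (k : ZMod q) - m,
          ‖𝓕 (fun y => (μ y : ℂ)) x‖ ^ 2 := by
          rw [Finset.sum_image hinj, Finset.mul_sum]
      _ ≤ 4 * ∑ x, ‖𝓕 (fun y => (μ y : ℂ)) x‖ ^ 2 := by
          gcongr
          exact Finset.subset_univ _
      _ = 4 * (q * ∑ y, μ y ^ 2) := by
          rw [sum_norm_dft_sq]
          simp only [Complex.norm_real, Real.norm_eq_abs, sq_abs]
      _ ≤ 4 * (q * (2 * (A.card * H))) := by gcongr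
      _ = _ := by ring
  have hH' : (0 : ℝ) < H := by exact_mod_cast hH0
  refine le_of_mul_le_mul_left ((le_of_eq ?_).trans (hsum.trans_eq ?_)) hH' <;> ring

/-- Parseval's identity for an exponential sum with frequencies `φ z`. -/
lemma sum_norm_sum_stdAddChar_sq {α : Type*} (S : Finset α) (φ : α → ZMod q) (g : α → ℂ) :
    ∑ v : ZMod q, ‖∑ z ∈ S, stdAddChar (-(φ z * v)) * g z‖ ^ 2 =
      q * ∑ n : ZMod q, ‖∑ z ∈ S with φ z = n, g z‖ ^ 2 := by
  rw [← sum_norm_dft_sq]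
  refine Finset.sum_congr rfl fun v _ => ?_
  congr 2
  rw [dft_apply]
  simp_rw [Finset.smul_sum, Finset.sum_filter]
  rw [Finset.sum_comm]
  refine Finset.sum_congr rfl fun z _ => ?_
  simp

lemma norm_sum_sq_le_card_mul {α : Type*} (S : Finset α) (g : α → ℂ) :
    ‖∑ z ∈ S, g z‖ ^ 2 ≤ S.card * ∑ z ∈ S, ‖g z‖ ^ 2 := by
  refine (pow_le_pow_left₀ (norm_nonneg _) (norm_sum_le S g) 2).trans ?_
  have := sq_sum_le_card_mul_sum_sq (s := S) (f := fun z => ‖g z‖)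
  exact_mod_cast this

end Dispersion

section DispersionBound

open ZMod

variable {q : ℕ}

/-- The integer frequency attached to `(p, m, k)`. -/
def dilationFreq (z : ℕ × ℕ × ℕ) : ℤ := (z.1 : ℤ) * ((z.2.1 : ℤ) - z.2.2)

/-- A smooth majorant, up to scaling, for the number of representations by dilations. -/
noncomputable def dilationMajorant [NeZero q] (P A : Finset ℕ) (d : ℕ) (v : ZMod q) : ℝ :=
  ∑ p ∈ P, ∑ a ∈ A, ‖∑ m ∈ Finset.range (d + 1),
    stdAddChar ((m : ZMod q) * ((a : ZMod q) - (p : ZMod q) * v))‖ ^ 2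

lemma dilationMajorant_eq [NeZero q] (P A : Finset ℕ) (d : ℕ) (v : ZMod q) :
    (dilationMajorant P A d v : ℂ) =
      ∑ z ∈ P ×ˢ (Finset.range (d + 1) ×ˢ Finset.range (d + 1)),
        stdAddChar (-((dilationFreq z : ZMod q) * v)) *
          ∑ a ∈ A, stdAddChar (((z.2.1 : ZMod q) - (z.2.2 : ZMod q)) * (a : ZMod q)) := by
  have h1 : ∀ w : ZMod q,
      ((‖∑ m ∈ Finset.range (d + 1), stdAddChar ((m : ZMod q) * w)‖ ^ 2 : ℝ) : ℂ) =
      ∑ m ∈ Finset.range (d + 1), ∑ k ∈ Finset.range (d + 1),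
        stdAddChar (((m : ZMod q) - (k : ZMod q)) * w) := by
    intro w
    rw [← Complex.normSq_eq_norm_sq, ← Complex.mul_conj, map_sum, Finset.sum_mul_sum]
    refine Finset.sum_congr rfl fun m _ => Finset.sum_congr rfl fun k _ => ?_
    rw [← AddChar.map_neg_eq_conj, ← AddChar.map_add_eq_mul]
    congr 1
    ring
  rw [dilationMajorant, Complex.ofReal_sum, Finset.sum_product]
  refine Finset.sum_congr rfl fun p _ => ?_
  rw [Complex.ofReal_sum, Finset.sum_product]
  simp_rw [h1]
  rw [Finset.sum_comm]
  refine Finset.sum_congr rfl fun m _ => ?_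
  rw [Finset.sum_comm]
  refine Finset.sum_congr rfl fun k _ => ?_
  rw [Finset.mul_sum]
  refine Finset.sum_congr rfl fun a _ => ?_
  rw [← AddChar.map_add_eq_mul, dilationFreq]
  congr 1
  push_cast
  ring

lemma card_dilationFreq_eq_le {P : Finset ℕ} {d X : ℕ} (hP : ∀ p ∈ P, 0 < p ∧ p ≤ X)
    (hX : 2 * (X * d) < q) {R : ℝ} (hR : ∀ k : ℕ, k ≠ 0 → k ≤ q → (k.divisors.card : ℝ) ≤ R)
    (hR0 : 0 ≤ R) {n : ZMod q} (hn : n ≠ 0) :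
    (((P ×ˢ (Finset.range (d + 1) ×ˢ Finset.range (d + 1))).filter
      fun z => (dilationFreq z : ZMod q) = n).card : ℝ) ≤ R * (d + 1) := by
  classical
  set S := (P ×ˢ (Finset.range (d + 1) ×ˢ Finset.range (d + 1))).filter
      fun z => (dilationFreq z : ZMod q) = n with hS
  have hmem : ∀ z ∈ S, z.1 ∈ P ∧ z.2.1 ≤ d ∧ z.2.2 ≤ d ∧ (dilationFreq z : ZMod q) = n := by
    intro z hz
    simp only [hS, Finset.mem_filter, Finset.mem_product, Finset.mem_range] at hz
    exact ⟨hz.1.1, by omega, by omega, hz.2⟩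
  have habs : ∀ z ∈ S, |dilationFreq z| ≤ (X * d : ℕ) := by
    intro z hz
    obtain ⟨h1, h2, h3, _⟩ := hmem z hz
    rw [dilationFreq, abs_mul, Nat.abs_cast, Nat.cast_mul]
    have h4 : |(z.2.1 : ℤ) - z.2.2| ≤ d := by rw [abs_le]; omega
    have h5 : (z.1 : ℤ) ≤ X := by exact_mod_cast (hP _ h1).2
    exact mul_le_mul h5 h4 (abs_nonneg _) (by positivity)
  rcases S.eq_empty_or_nonempty with h0 | ⟨z0, hz0⟩
  · rw [h0]
    simp only [Finset.card_empty, Nat.cast_zero]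
    positivity
  have heq : ∀ z ∈ S, dilationFreq z = dilationFreq z0 := by
    intro z hz
    have h1 := (hmem z hz).2.2.2.trans (hmem z0 hz0).2.2.2.symm
    rw [ZMod.intCast_eq_intCast_iff_dvd_sub] at h1
    have h2 := Int.eq_zero_of_abs_lt_dvd h1 (by
      have h3 := abs_le.1 (habs z hz)
      have h4 := abs_le.1 (habs z0 hz0)
      rw [abs_lt]
      omega)
    omega
  set N := (dilationFreq z0).natAbs with hN
  have hN0 : N ≠ 0 := by
    rw [hN, Int.natAbs_ne_zero]
    intro h
    apply hn
    rw [← (hmem z0 hz0).2.2.2, h, Int.cast_zero]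
  have hNq : N ≤ q := by
    have := habs z0 hz0
    rw [Int.abs_eq_natAbs] at this
    omega
  have hcard : S.card ≤ (N.divisors ×ˢ Finset.range (d + 1)).card := by
    refine Finset.card_le_card_of_injOn (fun z => (z.1, z.2.1)) (fun z hz => ?_) ?_
    · have hz' := hmem z hz
      simp only [Finset.coe_product, Set.mem_prod, Finset.mem_coe, Nat.mem_divisors,
        Finset.mem_range]
      refine ⟨⟨?_, hN0⟩, by omega⟩
      rw [hN, ← heq z hz, dilationFreq, Int.natAbs_mul, Int.natAbs_natCast]
      exact dvd_mul_right _ _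
    · rintro ⟨p, m, k⟩ hz ⟨p', m', k'⟩ hz' h
      have h1 := (heq _ hz).trans (heq _ hz').symm
      simp only [Prod.mk.injEq] at h
      obtain ⟨rfl, rfl⟩ := h
      have hp := (hP _ (hmem _ hz).1).1
      simp only [dilationFreq] at h1
      have h2 := mul_left_cancel₀ (by omega : (p : ℤ) ≠ 0) h1
      simp only [Prod.mk.injEq, true_and]
      omega
  rw [Finset.card_product, Finset.card_range] at hcard
  calc (S.card : ℝ) ≤ N.divisors.card * (d + 1) := by exact_mod_cast hcard
    _ ≤ _ := by gcongr; exact hR N hN0 hNq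

lemma card_dilationFreq_eq_zero_le {P : Finset ℕ} {d X : ℕ} (hP : ∀ p ∈ P, 0 < p ∧ p ≤ X)
    (hX : 2 * (X * d) < q) :
    ((P ×ˢ (Finset.range (d + 1) ×ˢ Finset.range (d + 1))).filter
      fun z => (dilationFreq z : ZMod q) = 0).card ≤ P.card * (d + 1) := by
  rw [← Finset.card_range (d + 1), ← Finset.card_product, Finset.card_range]
  refine Finset.card_le_card_of_injOn (fun z => (z.1, z.2.1)) (fun z hz => ?_) ?_
  · simp only [Finset.coe_filter, Finset.mem_product, Set.mem_ofPred_eq] at hz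
    simp only [Finset.coe_product, Set.mem_prod, Finset.mem_coe]
    exact ⟨hz.1.1, hz.1.2.1⟩
  · have hk : ∀ p m k : ℕ, (p, m, k) ∈ (P ×ˢ (Finset.range (d + 1) ×ˢ Finset.range (d + 1))).filter
        (fun z => (dilationFreq z : ZMod q) = 0) → k = m := by
      intro p m k hz
      rw [Finset.mem_filter, Finset.mem_product, Finset.mem_product, Finset.mem_range,
        Finset.mem_range, dilationFreq] at hz
      dsimp only at hz
      obtain ⟨⟨hp, hm, hk⟩, hz⟩ := hz
      have h1 := (ZMod.intCast_zmod_eq_zero_iff_dvd _ _).1 hz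
      have h2 := Int.eq_zero_of_abs_lt_dvd h1 (by
        rw [abs_mul, Nat.abs_cast]
        have h4 : |(m : ℤ) - k| ≤ d := by rw [abs_le]; omega
        have h5 : (p : ℤ) ≤ X := by exact_mod_cast (hP _ hp).2
        have h6 := mul_le_mul h5 h4 (abs_nonneg _) (by positivity)
        have h7 : 2 * ((X : ℤ) * d) < q := by exact_mod_cast hX
        have h8 : (0 : ℤ) ≤ X * d := by positivity
        omega)
      have := (hP _ hp).1
      rcases mul_eq_zero.1 h2 with h | h <;> omega
    rintro ⟨p, m, k⟩ hz ⟨p', m', k'⟩ hz' h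
    have h1 := hk _ _ _ hz
    have h2 := hk _ _ _ hz'
    simp only [Prod.mk.injEq] at h ⊢
    omega

end DispersionBound

section SecondMoment

open ZMod

variable {q : ℕ} [NeZero q]

lemma sum_dilationMajorant_sq_le {H : ℕ} {A P : Finset ℕ} (hA : IsSpaced q H A) (hH0 : 0 < H)
    (hH : H ≤ q) {d X : ℕ} (hd : 6 * (H * d) ≤ q) (hP : ∀ p ∈ P, 0 < p ∧ p ≤ X)
    (hX : 2 * (X * d) < q) {R : ℝ} (hR : ∀ k : ℕ, k ≠ 0 → k ≤ q → (k.divisors.card : ℝ) ≤ R)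
    (hR0 : 0 ≤ R) :
    ∑ v : ZMod q, dilationMajorant P A d v ^ 2 ≤
      q * (d + 1) ^ 2 * ((P.card * A.card) ^ 2 + 8 * R * (P.card * A.card) * (q / H)) := by
  set S := P ×ˢ (Finset.range (d + 1) ×ˢ Finset.range (d + 1)) with hS
  set g : ℕ × ℕ × ℕ → ℂ := fun z =>
    ∑ a ∈ A, stdAddChar (((z.2.1 : ZMod q) - (z.2.2 : ZMod q)) * (a : ZMod q)) with hg
  have hg_le : ∀ z, ‖g z‖ ≤ A.card := fun z => by
    refine (norm_sum_le _ _).trans_eq ?_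
    simp_rw [norm_stdAddChar]
    simp
  have hH' : (0 : ℝ) < H := by exact_mod_cast hH0
  have hgS : ∑ z ∈ S, ‖g z‖ ^ 2 ≤ P.card * (d + 1) * (8 * q * A.card / H) := by
    rw [hS, Finset.sum_product]
    have h1 : ∀ p ∈ P, ∑ y ∈ Finset.range (d + 1) ×ˢ Finset.range (d + 1), ‖g (p, y)‖ ^ 2 ≤
        (d + 1) * (8 * q * A.card / H) := by
      intro p _
      rw [Finset.sum_product]
      have h2 := Finset.sum_le_card_nsmul (Finset.range (d + 1))
        (fun m => ∑ k ∈ Finset.range (d + 1), ‖g (p, m, k)‖ ^ 2) (8 * q * A.card / H) fun m hm => by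
          rw [Finset.mem_range] at hm
          rw [le_div_iff₀ hH', mul_comm]
          exact hA.sum_norm_sq_le hH0 hH hd (by omega)
      rw [Finset.card_range, nsmul_eq_mul] at h2
      push_cast at h2
      exact h2
    have h3 := Finset.sum_le_card_nsmul P _ _ h1
    rw [nsmul_eq_mul] at h3
    linarith
  have hG : ∀ v : ZMod q, dilationMajorant P A d v ^ 2 =
      ‖∑ z ∈ S, stdAddChar (-((dilationFreq z : ZMod q) * v)) * g z‖ ^ 2 := by
    intro v
    rw [← dilationMajorant_eq, Complex.norm_real, Real.norm_eq_abs, sq_abs]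
  simp_rw [hG]
  rw [sum_norm_sum_stdAddChar_sq S (fun z => (dilationFreq z : ZMod q)) g,
    ← Finset.add_sum_erase _ _ (Finset.mem_univ (0 : ZMod q))]
  have hzero : ‖∑ z ∈ S with (dilationFreq z : ZMod q) = 0, g z‖ ^ 2 ≤
      (P.card * (d + 1) * A.card) ^ 2 := by
    refine pow_le_pow_left₀ (norm_nonneg _) ?_ 2
    refine (norm_sum_le _ _).trans ((Finset.sum_le_card_nsmul _ _ _ fun z _ => hg_le z).trans ?_)
    rw [nsmul_eq_mul]
    gcongr
    exact_mod_cast card_dilationFreq_eq_zero_le hP hX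
  have hne : ∑ n ∈ Finset.univ.erase (0 : ZMod q),
      ‖∑ z ∈ S with (dilationFreq z : ZMod q) = n, g z‖ ^ 2 ≤
        R * (d + 1) * (P.card * (d + 1) * (8 * q * A.card / H)) := by
    calc _ ≤ ∑ n ∈ Finset.univ.erase (0 : ZMod q),
          R * (d + 1) * ∑ z ∈ S with (dilationFreq z : ZMod q) = n, ‖g z‖ ^ 2 := by
          refine Finset.sum_le_sum fun n hn => (norm_sum_sq_le_card_mul _ _).trans ?_
          gcongr
          exact card_dilationFreq_eq_le hP hX hR hR0 (Finset.ne_of_mem_erase hn)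
      _ ≤ ∑ n : ZMod q, R * (d + 1) * ∑ z ∈ S with (dilationFreq z : ZMod q) = n, ‖g z‖ ^ 2 := by
          refine Finset.sum_le_sum_of_subset_of_nonneg (Finset.subset_univ _) fun _ _ _ => ?_
          positivity
      _ = R * (d + 1) * ∑ z ∈ S, ‖g z‖ ^ 2 := by
          rw [← Finset.mul_sum, Finset.sum_fiberwise]
      _ ≤ _ := by gcongr
  calc _ ≤ q * ((P.card * (d + 1) * A.card) ^ 2 +
        R * (d + 1) * (P.card * (d + 1) * (8 * q * A.card / H))) := by gcongr
    _ = _ := by ring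

lemma dilationCount_le (P A : Finset ℕ) {L d : ℕ} (hP : ∀ p ∈ P, p.Coprime q)
    (hd : 6 * (L * d) ≤ q) (v : ZMod q) :
    dilationCount P A L v ≤
      ((L / q + 1 : ℕ) : ℝ) * (4 / ((d : ℝ) + 1) ^ 2) * dilationMajorant P A d v := by
  rw [dilationCount, dilationMajorant, Finset.mul_sum]
  refine Finset.sum_le_sum fun p hp => ?_
  rw [Finset.mul_sum]
  refine Finset.sum_le_sum fun a _ => ?_
  set F := (Finset.range L).filter fun s : ℕ => (p : ZMod q)⁻¹ * (a - s) = v with hF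
  have hs : ∀ s ∈ F, s < L ∧ (s : ZMod q) = a - p * v := by
    intro s hs
    rw [hF, Finset.mem_filter, Finset.mem_range] at hs
    refine ⟨hs.1, ?_⟩
    rw [← hs.2]
    linear_combination ((a : ZMod q) - s) * ZMod.coe_mul_inv_eq_one p (hP p hp)
  rcases F.eq_empty_or_nonempty with h0 | ⟨s0, hs0⟩
  · rw [h0, Finset.card_empty, Nat.cast_zero]
    positivity
  have hcard : F.card ≤ L / q + 1 := by
    rw [← Finset.card_range (L / q + 1)]
    refine Finset.card_le_card_of_injOn (fun s => s / q) (fun s h => ?_) fun s h t h' hst => ?_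
    · rw [Finset.mem_coe, Finset.mem_range, Nat.lt_add_one_iff]
      exact Nat.div_le_div_right (hs s h).1.le
    · have h1 : (s : ZMod q) = t := (hs s h).2.trans (hs t h').2.symm
      rw [ZMod.natCast_eq_natCast_iff'] at h1
      rw [← Nat.div_add_mod s q, ← Nat.div_add_mod t q, h1]
      dsimp only at hst
      rw [hst]
  have hE : 1 ≤ 4 / ((d : ℝ) + 1) ^ 2 * ‖∑ m ∈ Finset.range (d + 1),
      stdAddChar ((m : ZMod q) * ((a : ZMod q) - (p : ZMod q) * v))‖ ^ 2 := by
    have h1 := half_le_norm_sum_stdAddChar (q := q) (D := d + 1) (z := s0) fun m hm => by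
      rw [Int.natAbs_natCast, mul_comm m]
      exact (Nat.mul_le_mul_left 6 (Nat.mul_le_mul (hs s0 hs0).1.le (by omega))).trans hd
    rw [Int.cast_natCast, (hs s0 hs0).2] at h1
    push_cast at h1
    have h2 := pow_le_pow_left₀ (by positivity) h1 2
    rw [div_mul_eq_mul_div, le_div_iff₀ (by positivity)]
    linarith
  calc (F.card : ℝ) ≤ ((L / q + 1 : ℕ) : ℝ) * 1 := by rw [mul_one]; exact_mod_cast hcard
    _ ≤ _ := by
      rw [mul_assoc]
      gcongr

/-- The second moment of the number of representations by dilations. -/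
lemma sum_dilationCount_sq_le {H : ℕ} {A P : Finset ℕ} (hA : IsSpaced q H A) (hH0 : 0 < H)
    (hH : H ≤ q) {L X : ℕ} (hP : ∀ p ∈ P, 0 < p ∧ p.Coprime q ∧ p ≤ X) (hXL : X ≤ L) (hHL : H ≤ L)
    {R : ℝ} (hR : ∀ k : ℕ, k ≠ 0 → k ≤ q → (k.divisors.card : ℝ) ≤ R) (hR1 : 1 ≤ R)
    (hq : P.card * A.card * H ≤ q) :
    ∑ v : ZMod q, dilationCount P A L v ^ 2 ≤
      5184 * ((L / q + 1 : ℕ) : ℝ) ^ 2 * R * (L : ℝ) ^ 2 * (P.card * A.card) / H := by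
  have hq0 : 0 < q := Nat.pos_of_ne_zero (NeZero.ne q)
  have hL0 : 0 < 6 * L := by omega
  set d := q / (6 * L) with hd
  have hd1 : 6 * (L * d) ≤ q := by rw [← mul_assoc]; exact Nat.mul_div_le q (6 * L)
  have hd2 : q < 6 * L * (d + 1) := by
    rw [mul_comm]; exact Nat.lt_mul_of_div_lt (Nat.lt_succ_self _) hL0
  have hHd : 6 * (H * d) ≤ q :=
    (Nat.mul_le_mul_left 6 (Nat.mul_le_mul_right d hHL)).trans hd1
  have hXd : 2 * (X * d) < q := by
    have := Nat.mul_le_mul_right d hXL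
    omega
  have h1 := sum_dilationMajorant_sq_le hA hH0 hH hHd (fun p hp => ⟨(hP p hp).1, (hP p hp).2.2⟩)
    hXd hR (by linarith)
  set U : ℝ := P.card * A.card with hU
  have hU0 : 0 ≤ U := by positivity
  have hH' : (0 : ℝ) < H := by exact_mod_cast hH0
  have hq' : (0 : ℝ) < q := by exact_mod_cast hq0
  have hUq : U ≤ q / H := by
    rw [le_div_iff₀ hH', hU]
    exact_mod_cast hq
  have h2 : U ^ 2 + 8 * R * U * (q / H) ≤ 9 * R * U * (q / H) := by
    have h3 : U * U ≤ U * (q / H) := by gcongr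
    have h4 : 1 * (U * (q / H)) ≤ R * (U * (q / H)) := by gcongr
    nlinarith
  set W : ℝ := ((L / q + 1 : ℕ) : ℝ) with hW
  have h5 : (q : ℝ) / (d + 1) ≤ 6 * L := by
    rw [div_le_iff₀ (by positivity)]
    exact_mod_cast hd2.le
  calc _ ≤ ∑ v : ZMod q, (W * (4 / ((d : ℝ) + 1) ^ 2) * dilationMajorant P A d v) ^ 2 := by
        refine Finset.sum_le_sum fun v _ => pow_le_pow_left₀ (dilationCount_nonneg _ _ _ _) ?_ 2
        exact dilationCount_le P A (fun p hp => (hP p hp).2.1) hd1 v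
    _ = (W * (4 / ((d : ℝ) + 1) ^ 2)) ^ 2 * ∑ v : ZMod q, dilationMajorant P A d v ^ 2 := by
        simp_rw [mul_pow]
        rw [← Finset.mul_sum]
    _ ≤ (W * (4 / ((d : ℝ) + 1) ^ 2)) ^ 2 * (q * (d + 1) ^ 2 * (9 * R * U * (q / H))) := by
        gcongr
        exact h1.trans (by gcongr)
    _ = 144 * W ^ 2 * R * (q / (d + 1)) ^ 2 * U / H := by
        field_simp
        ring
    _ ≤ 144 * W ^ 2 * R * (6 * L) ^ 2 * U / H := by gcongr
    _ = _ := by ring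

/-- Large values of maximal sums at spaced points, in terms of a moment over all residues. -/
theorem IsSpaced.large_values_le (χ : DirichletCharacter ℂ q) {H : ℕ} {A P : Finset ℕ}
    (hA : IsSpaced q H A) (hH0 : 0 < H) (hH : H ≤ q) {B X r : ℕ} (hr : 0 < r) {V : ℝ} (hV : 0 ≤ V)
    (hAV : ∀ a ∈ A, V ≤ maxSum χ a H)
    (hP : ∀ p ∈ P, 0 < p ∧ p.Coprime q ∧ p ≤ X ∧ H ≤ p * B) (hP0 : P.Nonempty)
    {R : ℝ} (hR : ∀ k : ℕ, k ≠ 0 → k ≤ q → (k.divisors.card : ℝ) ≤ R) (hR1 : 1 ≤ R)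
    (hq : P.card * A.card * H ≤ q) :
    A.card * V ^ (2 * r) ≤ 5184 * 4 ^ r * ((X * B / q + 1 : ℕ) : ℝ) ^ 2 * R * X ^ (2 * r) /
      (P.card * H) * ∑ v, maxSum χ v (2 * B) ^ (2 * r) := by
  set Q := ∑ v, maxSum χ v (2 * B) ^ (2 * r) with hQ
  have hQ0 : 0 ≤ Q := Finset.sum_nonneg fun v _ => pow_nonneg (maxSum_nonneg χ v _) _
  rcases A.eq_empty_or_nonempty with rfl | hA0
  · rw [Finset.card_empty, Nat.cast_zero, zero_mul]
    positivity
  obtain ⟨p0, hp0⟩ := hP0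
  have hB0 : 0 < B := by
    have := (hP p0 hp0).2.2.2
    exact Nat.pos_of_ne_zero fun h => by simp [h] at this; omega
  have hT : (0 : ℝ) < P.card := by exact_mod_cast Finset.card_pos.2 ⟨p0, hp0⟩
  have hJ : (0 : ℝ) < A.card := by exact_mod_cast Finset.card_pos.2 hA0
  have hH' : (0 : ℝ) < H := by exact_mod_cast hH0
  have hB' : (0 : ℝ) < B := by exact_mod_cast hB0
  set U : ℝ := P.card * A.card with hU
  have hU0 : 0 < U := by positivity
  have h1 := le_sum_dilationCount_mul χ (P := P) (A := A) (B := B) (H := H) (L := X * B)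
    (fun p hp => ⟨(hP p hp).1, (hP p hp).2.1, (hP p hp).2.2.2,
      Nat.mul_le_mul_right B (hP p hp).2.2.1⟩) hAV
  have h2 := sum_dilationCount_sq_le hA hH0 hH (L := X * B) (X := X)
    (fun p hp => ⟨(hP p hp).1, (hP p hp).2.1, (hP p hp).2.2.1⟩)
    (Nat.le_mul_of_pos_right X hB0)
    ((hP p0 hp0).2.2.2.trans (Nat.mul_le_mul_right B (hP p0 hp0).2.2.1)) hR hR1 hq
  have h3 := sum_mul_pow_le Finset.univ (dilationCount_nonneg (q := q) P A (X * B))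
    (fun v => maxSum_nonneg χ v (2 * B)) hr
  rw [sum_dilationCount] at h3
  set W : ℝ := ((X * B / q + 1 : ℕ) : ℝ) with hW
  rw [← hU] at h1 h2 h3
  have h4 : (V * B * U) ^ (2 * r) ≤ 4 ^ r * ((U * (X * B : ℕ)) ^ (2 * r - 2) *
      (5184 * W ^ 2 * R * ((X * B : ℕ) : ℝ) ^ 2 * U / H) * Q) := by
    calc _ ≤ (2 * ∑ v, dilationCount P A (X * B) v * maxSum χ v (2 * B)) ^ (2 * r) :=
          pow_le_pow_left₀ (by positivity) h1 _
      _ = 4 ^ r * (∑ v, dilationCount P A (X * B) v * maxSum χ v (2 * B)) ^ (2 * r) := by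
          rw [mul_pow, pow_mul 2]; norm_num
      _ ≤ _ := by
          gcongr
          exact h3.trans (by gcongr)
  obtain ⟨k, rfl⟩ := Nat.exists_eq_add_of_le' hr
  have h5 : 2 * (k + 1) - 2 = 2 * k := by omega
  rw [h5] at h4
  push_cast at h4
  have h6 : (0 : ℝ) < B ^ (2 * (k + 1)) * U ^ (2 * k + 1) * P.card := by positivity
  refine le_of_mul_le_mul_left ?_ h6
  calc _ = (V * B * U) ^ (2 * (k + 1)) := by rw [hU]; ring
    _ ≤ _ := h4
    _ = _ := by
      field_simp
      ring

end SecondMoment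

section Dilations

lemma le_primeCounting_mul_log {X : ℕ} (hX : 5 ≤ X) :
    (X : ℝ) / 4 ≤ X.primeCounting * Real.log X := by
  have hX' : (5 : ℝ) ≤ X := by exact_mod_cast hX
  have hl : 0 < Real.log X := Real.log_pos (by linarith)
  have h1 := Chebyshev.pi_ge X
  rw [div_le_iff₀ hl] at h1
  have h2 := Real.log_le_sub_one_of_pos (x := ((X : ℝ) + 1) / 8) (by positivity)
  rw [Real.log_div (by positivity) (by norm_num), show (8 : ℝ) = 2 ^ 3 by norm_num,
    Real.log_pow] at h2
  push_cast at h2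
  have h3 := Real.log_two_gt_d9
  have h4 := Real.log_two_lt_d9
  nlinarith

lemma primeCounting_le_card_coprime_add (q X : ℕ) (hq : q ≠ 0) :
    X.primeCounting ≤ ((Finset.Icc 1 X).filter fun n => n.Coprime q).card + q.primeFactors.card := by
  classical
  rw [Nat.primeCounting, Nat.primeCounting', Nat.count_eq_card_filter_range]
  refine (Finset.card_le_card (fun p hp => ?_)).trans (Finset.card_union_le _ _)
  rw [Finset.mem_filter, Finset.mem_range] at hp
  rw [Finset.mem_union, Finset.mem_filter, Finset.mem_Icc, Nat.mem_primeFactors]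
  by_cases h : p ∣ q
  · exact Or.inr ⟨hp.2, h, hq⟩
  · exact Or.inl ⟨⟨hp.2.pos, by omega⟩, (Nat.Prime.coprime_iff_not_dvd hp.2).2 h⟩

lemma exists_le_card_coprime {ε : ℝ} (hε : 0 < ε) :
    ∃ D : ℝ, 1 ≤ D ∧ ∀ q X : ℕ, 1 ≤ X → X ≤ q →
      (X : ℝ) ≤ D * (q : ℝ) ^ ε * ((Finset.Icc 1 X).filter fun n => n.Coprime q).card := by
  set δ := ε / 2 with hδ
  have hδ0 : 0 < δ := half_pos hε
  obtain ⟨D, hD, hω⟩ := exists_pow_card_primeFactors_le hδ0 (K := 2) (by norm_num)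
  set M := max 5 (8 * D / δ) with hM
  have hM5 : 5 ≤ M := le_max_left _ _
  have hMD : 8 * D ≤ M * δ := by
    rw [← div_le_iff₀ hδ0]; exact le_max_right _ _
  refine ⟨M, by linarith, fun q X hX hXq => ?_⟩
  have hq0 : 0 < q := by omega
  have hq1 : (1 : ℝ) ≤ q := by exact_mod_cast hq0
  set T := ((Finset.Icc 1 X).filter fun n => n.Coprime q).card with hT
  have hT1 : (1 : ℝ) ≤ T := by
    have : 0 < T := Finset.card_pos.2 ⟨1, by simp; omega⟩
    exact_mod_cast this
  set Y := (q : ℝ) ^ δ with hY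
  have hY1 : 1 ≤ Y := Real.one_le_rpow hq1 hδ0.le
  have hYε : (q : ℝ) ^ ε = Y * Y := by
    rw [hY, ← Real.rpow_add (by positivity), hδ, add_halves]
  rw [hYε]
  have hYY : 1 ≤ Y * Y := one_le_mul_of_one_le_of_one_le hY1 hY1
  by_cases hXM : (X : ℝ) ≤ M * (Y * Y)
  · nlinarith
  push Not at hXM
  have hX5 : (5 : ℝ) ≤ X := by nlinarith
  have hX0 : (0 : ℝ) < X := by linarith
  have h1 := le_primeCounting_mul_log (X := X) (by exact_mod_cast hX5)
  have h2 : Real.log X * δ ≤ Y := by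
    rw [← le_div_iff₀ hδ0]
    refine (Real.log_le_rpow_div hX0.le hδ0).trans ?_
    gcongr
    exact Real.rpow_le_rpow hX0.le (by exact_mod_cast hXq) hδ0.le
  have h3 : (X.primeCounting : ℝ) ≤ T + D * Y := by
    have h4 := primeCounting_le_card_coprime_add q X hq0.ne'
    have h5 : (q.primeFactors.card : ℝ) ≤ 2 ^ q.primeFactors.card := by
      exact_mod_cast Nat.lt_two_pow_self.le
    have h6 : (X.primeCounting : ℝ) ≤ T + q.primeFactors.card := by exact_mod_cast h4
    linarith [hω q hq0.ne']
  have h7 : (X : ℝ) * δ / 4 ≤ (T + D * Y) * Y := by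
    calc (X : ℝ) * δ / 4 = X / 4 * δ := by ring
      _ ≤ X.primeCounting * Real.log X * δ := by gcongr
      _ = X.primeCounting * (Real.log X * δ) := by ring
      _ ≤ _ := by gcongr
  have h8 : 8 * (D * (Y * Y)) ≤ X * δ := by
    calc 8 * (D * (Y * Y)) = 8 * D * (Y * Y) := by ring
      _ ≤ M * δ * (Y * Y) := by gcongr
      _ = M * (Y * Y) * δ := by ring
      _ ≤ _ := by gcongr
  have h9 : (X : ℝ) * δ ≤ 8 * (T * Y) := by nlinarith
  have h10 : 8 ≤ M * δ := by linarith
  have h11 : (X : ℝ) * δ ≤ M * (Y * Y) * T * δ := by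
    calc (X : ℝ) * δ ≤ 8 * (T * Y) := h9
      _ ≤ M * δ * (T * (Y * Y)) := by
        gcongr
        nlinarith
      _ = _ := by ring
  exact le_of_mul_le_mul_right h11 hδ0

/-- A dense set of dilations coprime to `q`, all of them large. -/
lemma exists_dilations {ε : ℝ} (hε : 0 < ε) :
    ∃ D : ℝ, 1 ≤ D ∧ ∀ q X : ℕ, 1 ≤ X → X ≤ q → ∃ P : Finset ℕ, P.Nonempty ∧
      (X : ℝ) ≤ D * (q : ℝ) ^ ε * P.card ∧
        ∀ p ∈ P, 0 < p ∧ p.Coprime q ∧ p ≤ X ∧ (X : ℝ) ≤ D * (q : ℝ) ^ ε * p := by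
  obtain ⟨D, hD, hcard⟩ := exists_le_card_coprime hε
  refine ⟨2 * D, by linarith, fun q X hX hXq => ?_⟩
  have h1 := hcard q X hX hXq
  set Q := (Finset.Icc 1 X).filter fun n => n.Coprime q with hQ
  have hQ0 : 0 < Q.card := Finset.card_pos.2 ⟨1, by simp [hQ]; omega⟩
  have h2 := Finset.card_filter_add_card_filter_not (s := Q) (fun p => Q.card ≤ 2 * p)
  have h3 : (Q.filter fun p => ¬ Q.card ≤ 2 * p).card ≤ (Q.card - 1) / 2 := by
    calc _ ≤ (Finset.Icc 1 ((Q.card - 1) / 2)).card := by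
          refine Finset.card_le_card fun p hp => ?_
          rw [Finset.mem_filter, hQ, Finset.mem_filter, Finset.mem_Icc, ← hQ] at hp
          rw [Finset.mem_Icc]
          omega
      _ = _ := by simp
  have hC : 0 ≤ D * (q : ℝ) ^ ε := by positivity
  have h4 : Q.card ≤ 2 * (Q.filter fun p => Q.card ≤ 2 * p).card := by omega
  have h5 : ∀ n : ℕ, Q.card ≤ 2 * n → (X : ℝ) ≤ 2 * D * (q : ℝ) ^ ε * n := by
    intro n hn
    have h6 : (Q.card : ℝ) ≤ 2 * n := by exact_mod_cast hn
    calc _ ≤ _ := h1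
      _ ≤ D * (q : ℝ) ^ ε * (2 * n) := by gcongr
      _ = _ := by ring
  refine ⟨Q.filter fun p => Q.card ≤ 2 * p, Finset.card_pos.1 (by omega), h5 _ h4,
    fun p hp => ?_⟩
  rw [Finset.mem_filter, hQ, Finset.mem_filter, Finset.mem_Icc, ← hQ] at hp
  exact ⟨hp.1.1.1, hp.1.2, hp.1.1.2, h5 p hp.2⟩

end Dilations

section LargeValues

lemma amplified_bound_eq (a w R x T h c y : ℝ) (n : ℕ) :
    a * w ^ 2 * R * x ^ n / (T * h) * (c * y ^ n) =
      a * w ^ 2 * R * (x * y) ^ n * (1 / T) / h * c := by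
  rw [mul_pow]; ring

lemma amplified_bound_simplify {r : ℕ} {C D E Y b h g s : ℝ} (hh : h ≠ 0)
    (hpow : h ^ (2 * r) = g * h ^ 2) :
    5184 * 4 ^ r * (3 * (D * Y)) ^ 2 * (E * Y) * (2 * (D * Y) * h) ^ (2 * r) *
        (2 * (D * Y) * b / h) / h * (2 * C * Y * s * 4 ^ r) =
      186624 * ((4 * 4) ^ r * (2 ^ 2) ^ r) * C * E * D ^ (2 * r + 3) * Y ^ (2 * r + 5) *
        (s * b) * g := by
  have h1 : (2 * (D * Y) * h) ^ (2 * r) / h / h = (2 ^ 2) ^ r * (D * Y) ^ (2 * r) * g := by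
    rw [mul_pow, mul_pow, hpow, ← pow_mul 2]
    field_simp
  calc _ = 186624 * (4 ^ r * 4 ^ r) * C * E * D ^ 3 * Y ^ 5 * (s * b) *
        ((2 * (D * Y) * h) ^ (2 * r) / h / h) := by ring
    _ = 186624 * (4 ^ r * 4 ^ r) * C * E * D ^ 3 * Y ^ 5 * (s * b) *
        ((2 ^ 2) ^ r * (D ^ (2 * r) * Y ^ (2 * r)) * g) := by rw [h1, mul_pow D]
    _ = _ := by rw [mul_pow 4 4]; ring

/-- Large values in the sparse case, through amplification. -/
theorem exists_sparse_large_values_le (r : ℕ) (hr : 0 < r) {ε : ℝ} (hε : 0 < ε) :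
    ∃ C : ℝ, 1 ≤ C ∧ ∀ (q : ℕ) [NeZero q], (∀ p : ℕ, p.Prime → ¬ p ^ 3 ∣ q) →
      ∀ χ : DirichletCharacter ℂ q, IsLocallyPrimitive χ → ∀ b : ℝ, 1 ≤ b → b ^ r = √q →
        ∀ H : ℕ, b ≤ H → H ≤ q → ∀ A : Finset ℕ, IsSpaced q H A → (A.card * H ^ 2 : ℝ) ≤ q * b →
          ∀ V : ℝ, 0 ≤ V → (∀ a ∈ A, V ≤ maxSum χ a H) →
            A.card * V ^ (2 * r) ≤ C * (q : ℝ) ^ ε * (√q * b) * H ^ (2 * r - 2) := by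
  set δ := ε / (2 * r + 5) with hδ
  have hδ0 : 0 < δ := by positivity
  obtain ⟨C, hC, hmom⟩ := exists_moment_maxSum_le r hr hδ0
  obtain ⟨D, hD, hdil⟩ := exists_dilations hδ0
  obtain ⟨E, hE, hdiv⟩ := exists_card_divisors_le hδ0
  refine ⟨186624 * 64 ^ r * C * E * D ^ (2 * r + 3), ?_,
    fun q _ hq χ hχ b hb1 hb H hbH hHq A hA hAH V hV hAV => ?_⟩
  · have h1 : (1 : ℝ) ≤ 64 ^ r := one_le_pow₀ (by norm_num)
    have h2 : 1 ≤ D ^ (2 * r + 3) := one_le_pow₀ hD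
    exact one_le_mul_of_one_le_of_one_le (one_le_mul_of_one_le_of_one_le
      (one_le_mul_of_one_le_of_one_le (one_le_mul_of_one_le_of_one_le (by norm_num) h1) hC) hE) h2
  have hq0 : 0 < q := Nat.pos_of_ne_zero (NeZero.ne q)
  have hq1 : (1 : ℝ) ≤ q := by exact_mod_cast hq0
  have hb0 : 0 < b := by linarith
  have hH1 : (1 : ℝ) ≤ H := hb1.trans hbH
  have hH0 : 0 < H := by exact_mod_cast (by linarith : (0 : ℝ) < H)
  set Y := (q : ℝ) ^ δ with hY
  have hY1 : 1 ≤ Y := Real.one_le_rpow hq1 hδ0.le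
  set K := D * Y with hK
  have hK1 : 1 ≤ K := one_le_mul_of_one_le_of_one_le hD hY1
  set X := ⌊(H : ℝ) / b⌋₊ with hX
  have hX1 : 1 ≤ X := Nat.one_le_floor_iff _ |>.2 ((one_le_div hb0).2 hbH)
  have hX1' : (1 : ℝ) ≤ X := by exact_mod_cast hX1
  have hXle : (X : ℝ) * b ≤ H := by
    rw [← le_div_iff₀ hb0]
    exact Nat.floor_le (by positivity)
  have hXge : (H : ℝ) ≤ 2 * X * b := by
    have := Nat.lt_floor_add_one ((H : ℝ) / b)
    rw [← hX, div_lt_iff₀ hb0] at this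
    nlinarith
  have hXH : X ≤ H := by
    have : (X : ℝ) ≤ H := by nlinarith
    exact_mod_cast this
  obtain ⟨P, hP0, hPcard, hP⟩ := hdil q X hX1 (hXH.trans hHq)
  have hPX : P.card ≤ X := by
    calc P.card ≤ (Finset.Icc 1 X).card := Finset.card_le_card fun p hp =>
          Finset.mem_Icc.2 ⟨(hP p hp).1, (hP p hp).2.2.1⟩
      _ = X := by simp
  set B := min ⌈K * H / X⌉₊ H with hB
  have hBge : b ≤ B := by
    rw [hB, Nat.cast_min]
    refine le_min (le_trans ?_ (Nat.le_ceil _)) hbH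
    rw [le_div_iff₀ (by linarith)]
    nlinarith
  have hBle : (X : ℝ) * B ≤ 2 * K * H := by
    have h1 : (B : ℝ) ≤ ⌈K * H / X⌉₊ := by exact_mod_cast min_le_left _ _
    have h2 := Nat.ceil_lt_add_one (a := K * H / X) (by positivity)
    calc (X : ℝ) * B ≤ X * (K * H / X + 1) := by gcongr; linarith
      _ = K * H + X := by field_simp
      _ ≤ K * H + K * H := by
        gcongr
        have : (X : ℝ) ≤ H := by exact_mod_cast hXH
        nlinarith
      _ = _ := by ring
  have hHpB : ∀ p ∈ P, H ≤ p * B := by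
    intro p hp
    obtain ⟨hp0, -, -, hpX⟩ := hP p hp
    rw [hB]
    rcases min_choice ⌈K * H / X⌉₊ H with h | h
    · rw [h]
      have h1 : (H : ℝ) ≤ p * ⌈K * H / X⌉₊ := by
        calc (H : ℝ) = X * (H / X) := by field_simp
          _ ≤ K * p * (H / X) := by gcongr
          _ = p * (K * H / X) := by ring
          _ ≤ _ := by gcongr; exact Nat.le_ceil _
      exact_mod_cast h1
    · rw [h]
      exact Nat.le_mul_of_pos_left H hp0
  have hcards : P.card * A.card * H ≤ q := by
    have h1 : (P.card : ℝ) * A.card * H * b ≤ q * b := by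
      have h2 : (P.card : ℝ) ≤ X := by exact_mod_cast hPX
      calc (P.card : ℝ) * A.card * H * b ≤ X * A.card * H * b := by gcongr
        _ = X * b * (A.card * H) := by ring
        _ ≤ H * (A.card * H) := by gcongr
        _ = A.card * H ^ 2 := by ring
        _ ≤ _ := hAH
    exact_mod_cast le_of_mul_le_mul_right h1 hb0
  set R := E * Y with hR
  have hR1 : 1 ≤ R := one_le_mul_of_one_le_of_one_le hE hY1
  have hmain := hA.large_values_le χ (B := B) (X := X) (P := P) hH0 hHq hr hV hAV
    (fun p hp => ⟨(hP p hp).1, (hP p hp).2.1, (hP p hp).2.2.1, hHpB p hp⟩) hP0 (R := R)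
    (fun k hk hkq => (hdiv k hk).trans (by
      rw [hR]
      gcongr
      exact Real.rpow_le_rpow (by positivity) (by exact_mod_cast hkq) hδ0.le)) hR1 hcards
  have hBpos : 0 < B := by exact_mod_cast hb0.trans_le hBge
  have hM := hmom q hq χ hχ (2 * B) (by omega) (by
    have : B ≤ H := min_le_right _ _
    omega)
  rw [← hY] at hM
  have hM2 : ∑ v, maxSum χ v (2 * B) ^ (2 * r) ≤ 2 * C * Y * √q * 4 ^ r * B ^ (2 * r) := by
    have h1 : √q ≤ ((2 * B : ℕ) : ℝ) ^ r := by
      rw [← hb]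
      push_cast
      gcongr
      linarith
    have h2 : (q : ℝ) * ((2 * B : ℕ) : ℝ) ^ r ≤ √q * ((2 * B : ℕ) : ℝ) ^ (2 * r) := by
      calc (q : ℝ) * ((2 * B : ℕ) : ℝ) ^ r = √q * √q * ((2 * B : ℕ) : ℝ) ^ r := by
            rw [Real.mul_self_sqrt (by positivity)]
        _ ≤ √q * ((2 * B : ℕ) : ℝ) ^ r * ((2 * B : ℕ) : ℝ) ^ r := by gcongr
        _ = _ := by ring
    calc _ ≤ _ := hM
      _ ≤ C * Y * (√q * ((2 * B : ℕ) : ℝ) ^ (2 * r) + √q * ((2 * B : ℕ) : ℝ) ^ (2 * r)) := by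
          gcongr
      _ = 2 * C * Y * √q * (2 ^ 2) ^ r * B ^ (2 * r) := by
          push_cast; rw [mul_pow, ← pow_mul 2]; ring
      _ = _ := by norm_num
  have hW : ((X * B / q + 1 : ℕ) : ℝ) ≤ 3 * K := by
    have h1 : ((X * B / q : ℕ) : ℝ) ≤ 2 * K := by
      refine Nat.cast_div_le.trans ?_
      rw [div_le_iff₀ (by positivity)]
      push_cast
      refine hBle.trans ?_
      have : (H : ℝ) ≤ q := by exact_mod_cast hHq
      gcongr
    push_cast at h1 ⊢
    linarith
  have hT : (0 : ℝ) < P.card := by exact_mod_cast Finset.card_pos.2 hP0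
  have hT2 : (1 : ℝ) / P.card ≤ 2 * K * b / H := by
    rw [div_le_div_iff₀ hT (by linarith)]
    nlinarith
  have hpow : (H : ℝ) ^ (2 * r) = H ^ (2 * r - 2) * H ^ 2 := by
    rw [← pow_add]; congr 1; omega
  have hYε : Y ^ (2 * r + 5) = (q : ℝ) ^ ε := by
    rw [hY, ← Real.rpow_natCast, ← Real.rpow_mul (by positivity)]
    congr 1
    rw [hδ]
    push_cast
    field_simp
  calc _ ≤ _ := hmain
    _ ≤ 5184 * 4 ^ r * ((X * B / q + 1 : ℕ) : ℝ) ^ 2 * R * X ^ (2 * r) /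
      (P.card * H) * (2 * C * Y * √q * 4 ^ r * B ^ (2 * r)) := by gcongr
    _ = 5184 * 4 ^ r * ((X * B / q + 1 : ℕ) : ℝ) ^ 2 * R * (X * B) ^ (2 * r) *
        (1 / P.card) / H * (2 * C * Y * √q * 4 ^ r) :=
        amplified_bound_eq _ _ _ _ _ _ _ _ _
    _ ≤ 5184 * 4 ^ r * (3 * K) ^ 2 * R * (2 * K * H) ^ (2 * r) *
        (2 * K * b / H) / H * (2 * C * Y * √q * 4 ^ r) := by gcongr
    _ = 186624 * ((4 * 4) ^ r * (2 ^ 2) ^ r) * C * E * D ^ (2 * r + 3) * Y ^ (2 * r + 5) *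
        (√q * b) * H ^ (2 * r - 2) := by
        rw [hR, hK]
        exact amplified_bound_simplify (by positivity) hpow
    _ = _ := by
        rw [← mul_pow, hYε]; norm_num

lemma sum_le_mul_harmonic {ι : Type*} {f : ι → ℝ} {W : ℝ} :
    ∀ (A : Finset ι), (∀ A' ⊆ A, ∀ a₀ ∈ A', (∀ a ∈ A', f a₀ ≤ f a) → A'.card * f a₀ ≤ W) →
      ∑ a ∈ A, f a ≤ W * harmonic A.card := by
  classical
  intro A
  induction hn : A.card generalizing A with
  | zero =>
    intro _
    rw [Finset.card_eq_zero.1 hn]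
    simp
  | succ n ih =>
    intro h
    obtain ⟨a₀, ha₀, hmin⟩ := Finset.exists_min_image A f (Finset.card_pos.1 (by omega))
    rw [← Finset.add_sum_erase A f ha₀, harmonic_succ]
    have h1 := ih (A.erase a₀) (by rw [Finset.card_erase_of_mem ha₀, hn]; rfl)
      fun A' hA' => h A' (hA'.trans (Finset.erase_subset _ _))
    have h2 := h A subset_rfl a₀ ha₀ hmin
    rw [hn, ← le_div_iff₀' (by positivity)] at h2
    push_cast at h2 ⊢
    rw [mul_add, ← div_eq_mul_inv]
    linarith

lemma exists_harmonic_le {ε : ℝ} (hε : 0 < ε) :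
    ∃ D : ℝ, 1 ≤ D ∧ ∀ n q : ℕ, 0 < q → n ≤ q → (harmonic n : ℝ) ≤ D * (q : ℝ) ^ ε := by
  refine ⟨1 + 1 / ε, by linarith [one_div_pos.2 hε], fun n q hq hn => ?_⟩
  have hq1 : (1 : ℝ) ≤ q := by exact_mod_cast hq
  have h1 := harmonic_le_one_add_log n
  have h2 : Real.log n ≤ (q : ℝ) ^ ε / ε := by
    refine (Real.log_le_rpow_div (by positivity) hε).trans ?_
    gcongr
  have h3 : 1 ≤ (q : ℝ) ^ ε := Real.one_le_rpow hq1 hε.le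
  calc _ ≤ _ := h1
    _ ≤ (q : ℝ) ^ ε + (q : ℝ) ^ ε / ε := by gcongr
    _ = _ := by ring

/-- Moments of maximal short sums over spaced points. -/
theorem exists_spaced_moment_le (r : ℕ) (hr : 0 < r) {ε : ℝ} (hε : 0 < ε) :
    ∃ C : ℝ, 1 ≤ C ∧ ∀ (q : ℕ) [NeZero q], (∀ p : ℕ, p.Prime → ¬ p ^ 3 ∣ q) →
      ∀ χ : DirichletCharacter ℂ q, χ.IsPrimitive → ∀ b : ℝ, 1 ≤ b → b ^ r = √q →
        ∀ H : ℕ, b ≤ H → H ≤ q → ∀ A : Finset ℕ, IsSpaced q H A →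
          ∑ a ∈ A, maxSum χ a H ^ (2 * r) ≤ C * (q : ℝ) ^ ε * (√q * b) * H ^ (2 * r - 2) := by
  have hε2 : 0 < ε / 2 := half_pos hε
  have hεr : 0 < ε / 2 / r := by positivity
  obtain ⟨C₁, hC₁, hsparse⟩ := exists_sparse_large_values_le r hr hε2
  obtain ⟨C₂, hC₂, hmean⟩ := exists_spaced_meanSquare_le hεr
  obtain ⟨D, hD, hharm⟩ := exists_harmonic_le hε2
  set C := max C₁ (C₂ ^ r) with hCdef
  have hC1 : 1 ≤ C := hC₁.trans (le_max_left _ _)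
  refine ⟨C * D, one_le_mul_of_one_le_of_one_le hC1 hD,
    fun q _ hq χ hχ b hb1 hb H hbH hHq A hA => ?_⟩
  have hq0 : 0 < q := Nat.pos_of_ne_zero (NeZero.ne q)
  have hq' : (0 : ℝ) < q := by exact_mod_cast hq0
  have hH1 : (1 : ℝ) ≤ H := hb1.trans hbH
  have hH0 : 0 < H := by exact_mod_cast (by linarith : (0 : ℝ) < H)
  have hb0 : 0 < b := by linarith
  have hcard : A.card ≤ q := by
    calc A.card ≤ (Finset.range q).card :=
          Finset.card_le_card fun a ha => Finset.mem_range.2 (hA.1 a ha)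
      _ = q := Finset.card_range q
  set Y := (q : ℝ) ^ (ε / 2) with hY
  have hYr : ((q : ℝ) ^ (ε / 2 / r)) ^ r = Y := by
    rw [← Real.rpow_natCast, ← Real.rpow_mul hq'.le]
    congr 1
    field_simp
  have hlarge := sum_le_mul_harmonic (f := fun a : ℕ => maxSum χ (a : ZMod q) H ^ (2 * r))
    (W := C * Y * (√q * b) * H ^ (2 * r - 2)) A fun A' hA' a₀ ha₀ hmin => by
      have hA'' := hA.mono hA'
      have hmin' : ∀ a ∈ A', maxSum χ a₀ H ≤ maxSum χ a H := fun a ha =>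
        le_of_pow_le_pow_left₀ (by omega) (maxSum_nonneg χ _ _) (hmin a ha)
      have hV := maxSum_nonneg χ (a₀ : ZMod q) H
      by_cases hAH : (A'.card * H ^ 2 : ℝ) ≤ q * b
      · refine (hsparse q hq χ hχ.isLocallyPrimitive b hb1 hb H hbH hHq A' hA'' hAH _ hV
          hmin').trans ?_
        gcongr
        exact le_max_left _ _
      · push Not at hAH
        have h1 : A'.card * maxSum χ a₀ H ^ 2 ≤ C₂ * (q : ℝ) ^ (ε / 2 / r) * q := by
          refine le_trans ?_ (hmean q χ hχ H hH0 hHq A' hA'')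
          rw [← nsmul_eq_mul]
          exact Finset.card_nsmul_le_sum A' _ _ fun a ha => pow_le_pow_left₀ hV (hmin' a ha) 2
        have h2 := pow_le_pow_left₀ (by positivity) h1 r
        rw [mul_pow, mul_pow, mul_pow, hYr, ← pow_mul] at h2
        obtain ⟨k, rfl⟩ := Nat.exists_eq_add_of_le' hr
        have h3 := pow_le_pow_left₀ (by positivity) hAH.le k
        rw [mul_pow, mul_pow, ← pow_mul] at h3
        have h4 : 2 * (k + 1) - 2 = 2 * k := by omega
        rw [h4]
        have h5 : (0 : ℝ) < q ^ k * b ^ k := by positivity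
        refine le_of_mul_le_mul_left ?_ h5
        calc _ ≤ (A'.card : ℝ) ^ k * H ^ (2 * k) *
              (A'.card * maxSum χ a₀ H ^ (2 * (k + 1))) := by gcongr
          _ = H ^ (2 * k) * ((A'.card : ℝ) ^ (k + 1) * maxSum χ a₀ H ^ (2 * (k + 1))) := by ring
          _ ≤ H ^ (2 * k) * (C₂ ^ (k + 1) * Y * q ^ (k + 1)) := by gcongr
          _ ≤ H ^ (2 * k) * (C * Y * q ^ (k + 1)) := by
              gcongr
              exact le_max_right _ _
          _ = H ^ (2 * k) * (C * Y * q ^ k * (√q * √q)) := by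
              rw [Real.mul_self_sqrt hq'.le]; ring
          _ = H ^ (2 * k) * (C * Y * q ^ k * (b ^ (k + 1) * √q)) := by rw [hb]
          _ = _ := by ring
  refine hlarge.trans ?_
  calc _ ≤ C * Y * (√q * b) * H ^ (2 * r - 2) * (D * Y) := by
        gcongr
        exact hharm _ q hq0 hcard
    _ = C * D * (Y * Y) * (√q * b) * H ^ (2 * r - 2) := by ring
    _ = _ := by rw [hY, ← Real.rpow_add hq', add_halves]

end LargeValues

/-- Mean-value Burgess-type estimate for cube-free `q`: for a primitive Dirichlet character
`χ` mod `q` with `q` cube-free, any positive integer `r`, `q^{1/(2r)} ≤ H ≤ q`, and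
`H`-spaced points `0 ≤ N_1 < ⋯ < N_J < q`,
`∑_j max_{1 ≤ h ≤ H} |S(N_j; h)|^{2r} ≤ C(ε,r) q^{1/2 + 1/(2r) + ε} H^{2r-2}`. -/
theorem stmt_2 (r : ℕ) (hr : 0 < r) (ε : ℝ) (hε : 0 < ε) :
    ∃ C : ℝ, ∀ (q : ℕ), 0 < q → (∀ p : ℕ, p.Prime → ¬ p ^ 3 ∣ q) →
      ∀ (χ : DirichletCharacter ℂ q), DirichletCharacter.IsPrimitive χ →
      ∀ (H : ℕ) (hH : 1 ≤ H), (q : ℝ) ^ ((1 : ℝ) / (2 * r)) ≤ (H : ℝ) → H ≤ q →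
      ∀ (J : ℕ) (N : ℕ → ℕ),
        (∀ j, 1 ≤ j → j < J → N j + H ≤ N (j + 1)) →
        (∀ j, 1 ≤ j → j ≤ J → N j < q) →
        ∑ j ∈ Finset.Icc 1 J,
            (Finset.Icc 1 H).sup' (Finset.nonempty_Icc.mpr hH)
              (fun h => ‖∑ n ∈ Finset.Ioc (N j) (N j + h), χ (n : ZMod q)‖ ^ (2 * r))
          ≤ C * (q : ℝ) ^ ((1 : ℝ) / 2 + 1 / (2 * r) + ε) * (H : ℝ) ^ (2 * r - 2) := by
  obtain ⟨C, -, hC⟩ := exists_spaced_moment_le r hr hε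
  refine ⟨C, fun q hq hcube χ hχ H hH hbH hHq J N hgap hlt => ?_⟩
  have : NeZero q := ⟨hq.ne'⟩
  have hq0 : (0 : ℝ) < q := by exact_mod_cast hq
  have hq1 : (1 : ℝ) ≤ q := by exact_mod_cast hq
  have hgap' : ∀ i j, 1 ≤ i → i < j → j ≤ J → N i + H ≤ N j := by
    intro i j hi hij
    induction j, hij using Nat.le_induction with
    | base => exact fun hj => hgap i hi hj
    | succ j hij ih =>
      intro hj
      have h1 := ih (by omega)
      have h2 := hgap j (by omega) hj
      omega
  have hinj : Set.InjOn N (Finset.Icc 1 J) := by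
    intro i hi j hj hij
    rw [Finset.mem_coe, Finset.mem_Icc] at hi hj
    rcases lt_trichotomy i j with h | h | h
    · have := hgap' i j hi.1 h hj.2
      omega
    · exact h
    · have := hgap' j i hj.1 h hi.2
      omega
  have hspaced : IsSpaced q H ((Finset.Icc 1 J).image N) := by
    refine ⟨fun a ha => ?_, fun a ha b hb hab => ?_⟩
    · obtain ⟨i, hi, rfl⟩ := Finset.mem_image.1 ha
      rw [Finset.mem_Icc] at hi
      exact hlt i hi.1 hi.2
    · obtain ⟨i, hi, rfl⟩ := Finset.mem_image.1 ha
      obtain ⟨j, hj, rfl⟩ := Finset.mem_image.1 hb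
      rw [Finset.mem_Icc] at hi hj
      rcases lt_trichotomy i j with h | rfl | h
      · exact hgap' i j hi.1 h hj.2
      · exact absurd hab (lt_irrefl _)
      · have := hgap' j i hj.1 h hi.2
        omega
  have hb : ((q : ℝ) ^ ((1 : ℝ) / (2 * r))) ^ r = √q := by
    rw [← Real.rpow_natCast, ← Real.rpow_mul hq0.le, Real.sqrt_eq_rpow]
    congr 1
    field_simp
  have hmain := hC q hcube χ hχ _ (Real.one_le_rpow hq1 (by positivity)) hb H hbH hHq _ hspaced
  rw [Finset.sum_image hinj] at hmain
  calc _ ≤ ∑ j ∈ Finset.Icc 1 J, maxSum χ (N j) H ^ (2 * r) := by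
        refine Finset.sum_le_sum fun j _ => Finset.sup'_le _ _ fun h hh => ?_
        rw [sum_Ioc_eq_shortSum]
        exact pow_le_pow_left₀ (norm_nonneg _)
          (norm_shortSum_le_maxSum χ _ (Finset.mem_Icc.1 hh).2) _
    _ ≤ _ := hmain
    _ = _ := by
        rw [Real.rpow_add hq0, Real.rpow_add hq0, Real.sqrt_eq_rpow]
        ring
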